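/- For every δ > 0 there exists a constant C > 0 depending only on δ with the following property. Let f, g ∈ H∞(𝔻×ℕ) satisfy ‖f‖ ≤ 1, ‖g‖ ≤ 1, and inf_{(z,n)∈𝔻×ℕ}(|f(z,n)| + |g(z,n)|) ≥ δ. Then there exists G ∈ H∞(𝔻×ℕ) such that ‖G‖ ≤ C and |f(z,n) + g(z,n)G(z,n)| ≥ 1/C for all (z,n) ∈ 𝔻×ℕ; in particular Φ = f + gG is invertible in H∞(𝔻×ℕ) and ‖Φ⁻¹‖ ≤ C. (This is the main quantitative theorem of the paper specialized to the countable disjoint union of unit disks, which is the unbranched covering of the finite bordered Riemann surface 𝔻 with countable fiber.) -/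

import Mathlib

/-- Membership in `H^∞(𝔻 × ℕ)`: a function on the countable disjoint union of
unit disks whose every slice `z ↦ f z n` is holomorphic on `𝔻 = {z : |z| < 1}`
and which is uniformly bounded. -/
def MemHinfN (f : ℂ → ℕ → ℂ) : Prop :=
  (∀ n : ℕ, DifferentiableOn ℂ (fun z => f z n) (Metric.ball 0 1)) ∧
    ∃ M : ℝ, ∀ z ∈ Metric.ball (0 : ℂ) 1, ∀ n : ℕ, ‖f z n‖ ≤ M

namespace Treil

open MeasureTheory Set Metric Complex
open scoped Real ComplexConjugate ContDiff Topology

section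

variable {E : Type*} [NormedAddCommGroup E] [NormedSpace ℝ E]

/-- Partial derivative in the direction of the real axis. -/
noncomputable def dX (F : ℂ → E) (z : ℂ) : E := fderiv ℝ F z 1

/-- Partial derivative in the direction of the imaginary axis. -/
noncomputable def dY (F : ℂ → E) (z : ℂ) : E := fderiv ℝ F z I

/-- The point of the unit circle with argument `θ`. -/
noncomputable def cis (θ : ℝ) : ℂ := ⟨Real.cos θ, Real.sin θ⟩

@[simp] lemma cis_re (θ : ℝ) : (cis θ).re = Real.cos θ := rfl
@[simp] lemma cis_im (θ : ℝ) : (cis θ).im = Real.sin θ := rfl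

lemma cis_eq (θ : ℝ) : cis θ = (Real.cos θ : ℂ) + (Real.sin θ : ℂ) * I := by
  apply Complex.ext <;> simp [-ofReal_cos, -ofReal_sin]

lemma cis_eq_exp (θ : ℝ) : cis θ = exp (θ * I) := by
  rw [cis_eq, exp_mul_I, ofReal_cos, ofReal_sin]

@[simp] lemma norm_cis (θ : ℝ) : ‖cis θ‖ = 1 := by
  rw [cis_eq_exp, norm_exp_ofReal_mul_I]

@[fun_prop] lemma continuous_cis : Continuous cis := by
  have : cis = fun θ : ℝ => exp (θ * I) := funext cis_eq_exp
  rw [this]; fun_prop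

lemma hasDerivAt_cis (θ : ℝ) : HasDerivAt cis (I * cis θ) θ := by
  have : cis = fun θ : ℝ => exp (θ * I) := funext cis_eq_exp
  rw [this]
  have h := ((hasDerivAt_id (θ : ℂ)).mul_const I).cexp.comp_ofReal
  simpa [mul_comm] using h

lemma fderiv_apply_eq (F : ℂ → E) (z w : ℂ) :
    fderiv ℝ F z w = w.re • dX F z + w.im • dY F z := by
  have : w = w.re • (1 : ℂ) + w.im • I := by apply Complex.ext <;> simp
  conv_lhs => rw [this]
  rw [map_add, map_smul, map_smul]; rfl

lemma continuousOn_dX {F : ℂ → E} {U : Set ℂ} (hU : IsOpen U) (hF : ContDiffOn ℝ 1 F U) :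
    ContinuousOn (dX F) U :=
  (hF.continuousOn_fderiv_of_isOpen hU le_rfl).clm_apply continuousOn_const

lemma continuousOn_dY {F : ℂ → E} {U : Set ℂ} (hU : IsOpen U) (hF : ContDiffOn ℝ 1 F U) :
    ContinuousOn (dY F) U :=
  (hF.continuousOn_fderiv_of_isOpen hU le_rfl).clm_apply continuousOn_const

lemma closedBall_subset_of_one_lt {R : ℝ} (hR : 1 < R) : closedBall (0 : ℂ) 1 ⊆ ball 0 R :=
  closedBall_subset_ball hR

lemma integrableOn_closedBall {E : Type*} [NormedAddCommGroup E] {F : ℂ → E} {R : ℝ} (hR : 1 < R)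
    (hF : ContinuousOn F (ball 0 R)) : IntegrableOn F (closedBall 0 1) :=
  (hF.mono (closedBall_subset_of_one_lt hR)).integrableOn_compact (isCompact_closedBall _ _)

lemma integral_closedBall_eq_polar (h : ℂ → E) (hc : ContinuousOn h (closedBall 0 1)) :
    ∫ z in closedBall (0 : ℂ) 1, h z =
      ∫ r in (0 : ℝ)..1, ∫ θ in (-π)..π, r • h (r * cis θ) := by
  rw [← integral_indicator isClosed_closedBall.measurableSet,
    ← Complex.integral_comp_polarCoord_symm]
  have e1 : ∀ p ∈ polarCoord.target, p.1 • (closedBall (0:ℂ) 1).indicator h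
      (Complex.polarCoord.symm p)
      = (Ioc (0:ℝ) 1 ×ˢ Ioo (-π) π).indicator (fun p => p.1 • h (p.1 * cis p.2)) p := by
    rintro ⟨r, θ⟩ ⟨hr, hθ⟩
    have hr' : 0 < r := hr
    have : Complex.polarCoord.symm (r, θ) = r * cis θ := by
      rw [Complex.polarCoord_symm_apply, cis_eq]
    rw [this]
    by_cases h1 : r ≤ 1
    · rw [indicator_of_mem, indicator_of_mem]
      · exact ⟨⟨hr, h1⟩, hθ⟩
      · simp [abs_of_pos hr', h1]
    · rw [indicator_of_notMem, indicator_of_notMem, smul_zero]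
      · exact fun h => h1 h.1.2
      · simp [abs_of_pos hr', h1]
  rw [setIntegral_congr_fun polarCoord.open_target.measurableSet e1,
    setIntegral_indicator (measurableSet_Ioc.prod measurableSet_Ioo)]
  have e2 : polarCoord.target ∩ Ioc (0:ℝ) 1 ×ˢ Ioo (-π) π = Ioc (0:ℝ) 1 ×ˢ Ioo (-π) π := by
    apply inter_eq_right.2
    rintro ⟨r, θ⟩ ⟨hr, hθ⟩
    exact ⟨hr.1, hθ⟩
  rw [e2, Measure.volume_eq_prod, setIntegral_prod]
  · rw [intervalIntegral.integral_of_le zero_le_one]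
    refine setIntegral_congr_fun measurableSet_Ioc fun r _ => ?_
    simp only
    rw [intervalIntegral.integral_of_le (by linarith [Real.pi_pos]), integral_Ioc_eq_integral_Ioo]
  · have : ContinuousOn (fun p : ℝ × ℝ => p.1 • h (p.1 * cis p.2)) (Icc (0:ℝ) 1 ×ˢ Icc (-π) π) := by
      refine continuousOn_fst.smul (hc.comp (by fun_prop) ?_)
      rintro ⟨r, θ⟩ ⟨hr, hθ⟩
      simp only [mem_closedBall, dist_zero_right, norm_mul, norm_cis, norm_real, mul_one,
        Real.norm_eq_abs, abs_of_nonneg hr.1]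
      exact hr.2
    exact (this.integrableOn_compact (isCompact_Icc.prod isCompact_Icc)).mono_set
      (prod_mono Ioc_subset_Icc_self Ioo_subset_Icc_self)

lemma hasFDerivAt_comp_polar {F : ℂ → E} (x : ℝ × ℝ)
    (hF : DifferentiableAt ℝ F (x.1 * cis x.2)) :
    ∃ L : ℝ × ℝ →L[ℝ] E, HasFDerivAt (fun x : ℝ × ℝ => F (x.1 * cis x.2)) L x ∧
      L (1, 0) = Real.cos x.2 • dX F (x.1 * cis x.2) + Real.sin x.2 • dY F (x.1 * cis x.2) ∧
      L (0, 1) = -(x.1 * Real.sin x.2) • dX F (x.1 * cis x.2)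
        + (x.1 * Real.cos x.2) • dY F (x.1 * cis x.2) := by
  have h1 : HasFDerivAt (fun x : ℝ × ℝ => (x.1 : ℂ))
    (ofRealCLM.comp (ContinuousLinearMap.fst ℝ ℝ ℝ)) x :=
    (ofRealCLM.comp (ContinuousLinearMap.fst ℝ ℝ ℝ)).hasFDerivAt
  have h2 : HasFDerivAt (fun x : ℝ × ℝ => cis x.2) _ x :=
    (hasDerivAt_cis x.2).hasFDerivAt.comp x hasFDerivAt_snd
  have h3 := h1.mul h2
  refine ⟨_, hF.hasFDerivAt.comp x h3, ?_, ?_⟩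
  · simp [fderiv_apply_eq]
  · simp [fderiv_apply_eq]

lemma polar_divergence [CompleteSpace E] {F : ℂ → E} {R : ℝ} (hR : 1 < R)
    (hF : ContDiffOn ℝ 1 F (ball 0 R)) (u v : ℝ) (cs sn : ℝ → ℝ)
    (hcs : ∀ θ, cs θ = u * Real.cos θ + v * Real.sin θ)
    (hsn : ∀ θ, sn θ = u * Real.sin θ - v * Real.cos θ) :
    ∫ r in (0 : ℝ)..1, ∫ θ in (-π)..π, r • (u • dX F (r * cis θ) + v • dY F (r * cis θ)) =
      ∫ θ in (-π)..π, cs θ • F (cis θ) := by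
  have hmem : ∀ x ∈ Icc (0:ℝ) 1 ×ˢ Icc (-π) π, ((x.1 : ℂ) * cis x.2) ∈ ball (0:ℂ) R := by
    rintro ⟨r, θ⟩ ⟨hr, hθ⟩
    simp only [mem_ball, dist_zero_right, norm_mul, norm_cis, norm_real, mul_one,
        Real.norm_eq_abs, abs_of_nonneg hr.1]
    exact hr.2.trans_lt hR
  have hcs' : cs = fun θ => u * Real.cos θ + v * Real.sin θ := funext hcs
  have hsn' : sn = fun θ => u * Real.sin θ - v * Real.cos θ := funext hsn
  have dcs : ∀ θ, HasDerivAt cs (-sn θ) θ := by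
    intro θ
    rw [hcs', hsn']
    have := ((Real.hasDerivAt_cos θ).const_mul u).add ((Real.hasDerivAt_sin θ).const_mul v)
    exact this.congr_deriv (by ring)
  have dsn : ∀ θ, HasDerivAt sn (cs θ) θ := by
    intro θ
    rw [hsn', hcs']
    have := ((Real.hasDerivAt_sin θ).const_mul u).sub ((Real.hasDerivAt_cos θ).const_mul v)
    exact this.congr_deriv (by ring)
  have csc : Continuous cs := by rw [hcs']; fun_prop
  have snc : Continuous sn := by rw [hsn']; fun_prop
  set p : ℝ × ℝ → ℂ := fun x => x.1 * cis x.2 with hp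
  set f : ℝ × ℝ → E := fun x => (x.1 * cs x.2) • F (p x) with hf
  set g : ℝ × ℝ → E := fun x => (-sn x.2) • F (p x) with hg
  have hpc : Continuous p := by fun_prop
  have hdiff : ∀ x ∈ Icc (0:ℝ) 1 ×ˢ Icc (-π) π, DifferentiableAt ℝ F (p x) := fun x hx =>
    (hF.differentiableOn one_ne_zero).differentiableAt (isOpen_ball.mem_nhds (hmem x hx))
  have key : ∀ x ∈ Icc (0:ℝ) 1 ×ˢ Icc (-π) π, DifferentiableAt ℝ f x ∧ DifferentiableAt ℝ g x ∧
      fderiv ℝ f x (1, 0) + fderiv ℝ g x (0, 1) = x.1 • (u • dX F (p x) + v • dY F (p x)) := by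
    intro x hx
    obtain ⟨L, hL, L1, L2⟩ := hasFDerivAt_comp_polar x (hdiff x hx)
    have a1 : HasFDerivAt (fun x : ℝ × ℝ => x.1 * cs x.2) _ x :=
      (hasFDerivAt_fst (𝕜 := ℝ) (E := ℝ) (F := ℝ) (p := x)).mul
        ((dcs x.2).hasFDerivAt.comp x hasFDerivAt_snd)
    have a2 : HasFDerivAt (fun x : ℝ × ℝ => - sn x.2) _ x :=
      ((dsn x.2).hasFDerivAt.comp x hasFDerivAt_snd).neg
    have b1 := a1.smul hL
    have b2 := a2.smul hL
    refine ⟨b1.differentiableAt, b2.differentiableAt, ?_⟩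
    have e1 := b1.fderiv
    have e2 := b2.fderiv
    change fderiv ℝ f x = _ at e1
    change fderiv ℝ g x = _ at e2
    rw [e1, e2]
    simp only [_root_.add_apply, _root_.smul_apply, L1, L2,
      ContinuousLinearMap.smulRight_apply, _root_.neg_apply,
      ContinuousLinearMap.comp_apply, ContinuousLinearMap.coe_fst', ContinuousLinearMap.coe_snd',
      ContinuousLinearMap.toSpanSingleton_apply, hcs, hsn]
    simp only [smul_eq_mul]
    have hsq := Real.sin_sq_add_cos_sq x.2
    have hv : Real.sin x.2 ^ 2 = 1 - Real.cos x.2 ^ 2 := by linarith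
    match_scalars <;> (ring_nf; try (rw [hv]; ring))
  have hFc : ContinuousOn (fun x => F (p x)) (Icc (0:ℝ) 1 ×ˢ Icc (-π) π) :=
    hF.continuousOn.comp hpc.continuousOn hmem
  have main := integral2_divergence_prod_of_hasFDerivAt_off_countable f g
    (fun x => fderiv ℝ f x) (fun x => fderiv ℝ g x) 0 (-π) 1 π ∅ countable_empty
  have hpi : -π ≤ π := by linarith [Real.pi_pos]
  rw [uIcc_of_le zero_le_one, uIcc_of_le hpi, min_eq_left zero_le_one, max_eq_right zero_le_one,
    min_eq_left hpi, max_eq_right hpi] at main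
  have hsub : Ioo (0:ℝ) 1 ×ˢ Ioo (-π) π ⊆ Icc (0:ℝ) 1 ×ˢ Icc (-π) π :=
    prod_mono Ioo_subset_Icc_self Ioo_subset_Icc_self
  have main := main (ContinuousOn.smul (by fun_prop) hFc) (ContinuousOn.smul (by fun_prop) hFc)
    (fun x hx => (key x (hsub hx.1)).1.hasFDerivAt)
    (fun x hx => (key x (hsub hx.1)).2.1.hasFDerivAt)
    (by
      refine IntegrableOn.congr_fun (f := fun x : ℝ × ℝ => x.1 • (u • dX F (p x) + v • dY F (p x)))
        ?_ (fun x hx => ((key x hx).2.2).symm) (measurableSet_Icc.prod measurableSet_Icc)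
      have hc : ContinuousOn (fun x : ℝ × ℝ => x.1 • (u • dX F (p x) + v • dY F (p x)))
          (Icc (0:ℝ) 1 ×ˢ Icc (-π) π) := continuousOn_fst.smul
        ((((continuousOn_dX isOpen_ball hF).comp hpc.continuousOn hmem).const_smul u).add
        (((continuousOn_dY isOpen_ball hF).comp hpc.continuousOn hmem).const_smul v))
      exact hc.integrableOn_compact (isCompact_Icc.prod isCompact_Icc))
  have lhs : (∫ x in (0:ℝ)..1, ∫ y in (-π)..π, fderiv ℝ f (x, y) (1, 0) + fderiv ℝ g (x, y)
      (0, 1)) =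
      ∫ r in (0 : ℝ)..1, ∫ θ in (-π)..π, r • (u • dX F (r * cis θ) + v • dY F (r * cis θ)) := by
    refine intervalIntegral.integral_congr fun r hr => ?_
    refine intervalIntegral.integral_congr fun θ hθ => ?_
    rw [uIcc_of_le zero_le_one] at hr
    rw [uIcc_of_le hpi] at hθ
    exact (key (r, θ) ⟨hr, hθ⟩).2.2
  rw [← lhs, main]
  have c1 : cis (-π) = cis π := by apply Complex.ext <;> simp
  have c2 : sn (-π) = sn π := by simp [hsn]
  simp [hf, hg, hp, c1, c2]

theorem integral_dX [CompleteSpace E] {F : ℂ → E} {R : ℝ} (hR : 1 < R)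
    (hF : ContDiffOn ℝ 1 F (ball 0 R)) :
    ∫ z in closedBall (0 : ℂ) 1, dX F z = ∫ θ in (-π)..π, Real.cos θ • F (cis θ) := by
  rw [integral_closedBall_eq_polar _
    ((continuousOn_dX isOpen_ball hF).mono (closedBall_subset_of_one_lt hR)),
    ← polar_divergence hR hF 1 0 Real.cos Real.sin (by simp) (by simp)]
  simp

theorem integral_dY [CompleteSpace E] {F : ℂ → E} {R : ℝ} (hR : 1 < R)
    (hF : ContDiffOn ℝ 1 F (ball 0 R)) :
    ∫ z in closedBall (0 : ℂ) 1, dY F z = ∫ θ in (-π)..π, Real.sin θ • F (cis θ) := by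
  rw [integral_closedBall_eq_polar _
    ((continuousOn_dY isOpen_ball hF).mono (closedBall_subset_of_one_lt hR)),
    ← polar_divergence hR hF 0 1 Real.sin (fun θ => - Real.cos θ) (by simp) (by simp)]
  simp

end

section

variable {E : Type*} [NormedAddCommGroup E] [NormedSpace ℝ E]

/-- Laplacian. -/
noncomputable def lap (F : ℂ → ℝ) (z : ℂ) : ℝ := dX (dX F) z + dY (dY F) z

/-- Scalar product of gradients. -/
noncomputable def gr (F G : ℂ → ℝ) (z : ℂ) : ℝ := dX F z * dX G z + dY F z * dY G z

section pointwise

variable {A : Type*} [NormedRing A] [NormedAlgebra ℝ A] {F G : ℂ → A} {z : ℂ}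

lemma dX_mul (hF : DifferentiableAt ℝ F z) (hG : DifferentiableAt ℝ G z) :
    dX (fun w => F w * G w) z = dX F z * G z + F z * dX G z := by
  simp only [dX, fderiv_fun_mul' hF hG]; simp [add_comm]

lemma dY_mul (hF : DifferentiableAt ℝ F z) (hG : DifferentiableAt ℝ G z) :
    dY (fun w => F w * G w) z = dY F z * G z + F z * dY G z := by
  simp only [dY, fderiv_fun_mul' hF hG]; simp [add_comm]

end pointwise

section linear

variable {F G : ℂ → E} {z : ℂ}

lemma dX_add (hF : DifferentiableAt ℝ F z) (hG : DifferentiableAt ℝ G z) :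
    dX (fun w => F w + G w) z = dX F z + dX G z := by
  simp only [dX, fderiv_fun_add hF hG]; rfl

lemma dY_add (hF : DifferentiableAt ℝ F z) (hG : DifferentiableAt ℝ G z) :
    dY (fun w => F w + G w) z = dY F z + dY G z := by
  simp only [dY, fderiv_fun_add hF hG]; rfl

lemma dX_sub (hF : DifferentiableAt ℝ F z) (hG : DifferentiableAt ℝ G z) :
    dX (fun w => F w - G w) z = dX F z - dX G z := by
  simp only [dX, fderiv_fun_sub hF hG]; rfl

lemma dY_sub (hF : DifferentiableAt ℝ F z) (hG : DifferentiableAt ℝ G z) :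
    dY (fun w => F w - G w) z = dY F z - dY G z := by
  simp only [dY, fderiv_fun_sub hF hG]; rfl

@[simp] lemma dX_const (c : E) : dX (fun _ => c) z = 0 := by simp [dX]
@[simp] lemma dY_const (c : E) : dY (fun _ => c) z = 0 := by simp [dY]

lemma dX_congr (h : F =ᶠ[𝓝 z] G) : dX F z = dX G z := by simp only [dX, h.fderiv_eq]
lemma dY_congr (h : F =ᶠ[𝓝 z] G) : dY F z = dY G z := by simp only [dY, h.fderiv_eq]

lemma dX_clm {E' : Type*} [NormedAddCommGroup E'] [NormedSpace ℝ E'] (L : E →L[ℝ] E')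
    (hF : DifferentiableAt ℝ F z) : dX (fun w => L (F w)) z = L (dX F z) := by
  have := (L.hasFDerivAt.comp z hF.hasFDerivAt).fderiv
  simp only [dX]; erw [this]; rfl

lemma dY_clm {E' : Type*} [NormedAddCommGroup E'] [NormedSpace ℝ E'] (L : E →L[ℝ] E')
    (hF : DifferentiableAt ℝ F z) : dY (fun w => L (F w)) z = L (dY F z) := by
  have := (L.hasFDerivAt.comp z hF.hasFDerivAt).fderiv
  simp only [dY]; erw [this]; rfl

end linear

section complexvalued

variable {F : ℂ → ℂ} {z : ℂ}

lemma dX_re (hF : DifferentiableAt ℝ F z) : dX (fun w => (F w).re) z = (dX F z).re :=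
  dX_clm reCLM hF
lemma dY_re (hF : DifferentiableAt ℝ F z) : dY (fun w => (F w).re) z = (dY F z).re :=
  dY_clm reCLM hF
lemma dX_im (hF : DifferentiableAt ℝ F z) : dX (fun w => (F w).im) z = (dX F z).im :=
  dX_clm imCLM hF
lemma dY_im (hF : DifferentiableAt ℝ F z) : dY (fun w => (F w).im) z = (dY F z).im :=
  dY_clm imCLM hF
lemma dX_conj (hF : DifferentiableAt ℝ F z) : dX (fun w => conj (F w)) z = conj (dX F z) :=
  dX_clm (conjCLE : ℂ →L[ℝ] ℂ) hF
lemma dY_conj (hF : DifferentiableAt ℝ F z) : dY (fun w => conj (F w)) z = conj (dY F z) :=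
  dY_clm (conjCLE : ℂ →L[ℝ] ℂ) hF
lemma dX_ofReal {u : ℂ → ℝ} (hu : DifferentiableAt ℝ u z) :
    dX (fun w => (u w : ℂ)) z = ((dX u z : ℝ) : ℂ) := dX_clm ofRealCLM hu
lemma dY_ofReal {u : ℂ → ℝ} (hu : DifferentiableAt ℝ u z) :
    dY (fun w => (u w : ℂ)) z = ((dY u z : ℝ) : ℂ) := dY_clm ofRealCLM hu

lemma dX_hol (h : DifferentiableAt ℂ F z) : dX F z = deriv F z := by
  rw [dX, (h.hasFDerivAt.restrictScalars ℝ).fderiv]; simp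

lemma dY_hol (h : DifferentiableAt ℂ F z) : dY F z = I * deriv F z := by
  rw [dY, (h.hasFDerivAt.restrictScalars ℝ).fderiv]; simp [fderiv_eq_smul_deriv]

lemma differentiableAt_real (h : DifferentiableAt ℂ F z) : DifferentiableAt ℝ F z :=
  h.restrictScalars ℝ

end complexvalued

section comp

variable {u : ℂ → ℝ} {φ : ℝ → ℝ} {z : ℂ} {d : ℝ}

lemma dX_comp (hφ : HasDerivAt φ d (u z)) (hu : DifferentiableAt ℝ u z) :
    dX (fun w => φ (u w)) z = d * dX u z := by
  have := (hφ.hasFDerivAt.comp z hu.hasFDerivAt).fderiv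
  simp only [dX]; erw [this]; simp [mul_comm]

lemma dY_comp (hφ : HasDerivAt φ d (u z)) (hu : DifferentiableAt ℝ u z) :
    dY (fun w => φ (u w)) z = d * dY u z := by
  have := (hφ.hasFDerivAt.comp z hu.hasFDerivAt).fderiv
  simp only [dY]; erw [this]; simp [mul_comm]

end comp

section smooth

variable {U : Set ℂ}

lemma contDiffOn_dX {F : ℂ → E} {n m : ℕ∞ω} (hU : IsOpen U) (hF : ContDiffOn ℝ n F U)
    (h : m + 1 ≤ n) : ContDiffOn ℝ m (dX F) U :=
  (hF.fderiv_of_isOpen hU h).clm_apply contDiffOn_const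

lemma contDiffOn_dY {F : ℂ → E} {n m : ℕ∞ω} (hU : IsOpen U) (hF : ContDiffOn ℝ n F U)
    (h : m + 1 ≤ n) : ContDiffOn ℝ m (dY F) U :=
  (hF.fderiv_of_isOpen hU h).clm_apply contDiffOn_const

lemma dX_dY_comm {F : ℂ → E} (hU : IsOpen U) (hF : ContDiffOn ℝ 2 F U) {z : ℂ} (hz : z ∈ U) :
    dX (dY F) z = dY (dX F) z := by
  have h2 : ContDiffAt ℝ 2 F z := hF.contDiffAt (hU.mem_nhds hz)
  have hs := h2.isSymmSndFDerivAt (by simp)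
  have hd : DifferentiableAt ℝ (fderiv ℝ F) z :=
    (h2.fderiv_right (m := 1) (by norm_num)).differentiableAt one_ne_zero
  have e1 : dX (dY F) z = fderiv ℝ (fderiv ℝ F) z 1 I := by
    exact dX_clm (ContinuousLinearMap.apply ℝ E I) hd
  have e2 : dY (dX F) z = fderiv ℝ (fderiv ℝ F) z I 1 := by
    exact dY_clm (ContinuousLinearMap.apply ℝ E 1) hd
  rw [e1, e2, hs.eq]

lemma ContDiffOn.diffAt {F : ℂ → E} {n : ℕ∞ω} (hF : ContDiffOn ℝ n F U) (hn : n ≠ 0)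
    (hU : IsOpen U) {z : ℂ} (hz : z ∈ U) : DifferentiableAt ℝ F z :=
  (hF.contDiffAt (hU.mem_nhds hz)).differentiableAt hn

lemma contDiffOn_hol {F : ℂ → ℂ} {n : ℕ∞ω} (hU : IsOpen U) (hF : DifferentiableOn ℂ F U) :
    ContDiffOn ℝ n F U :=
  ((hF.contDiffOn hU).of_le le_top).restrict_scalars ℝ

lemma contDiffOn_lap {F : ℂ → ℝ} (hU : IsOpen U) (hF : ContDiffOn ℝ 2 F U) :
    ContinuousOn (lap F) U :=
  (continuousOn_dX hU (contDiffOn_dX hU hF (by norm_num))).add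
    (continuousOn_dY hU (contDiffOn_dY hU hF (by norm_num)))

lemma continuousOn_gr {F G : ℂ → ℝ} (hU : IsOpen U) (hF : ContDiffOn ℝ 1 F U)
    (hG : ContDiffOn ℝ 1 G U) : ContinuousOn (gr F G) U :=
  ((continuousOn_dX hU hF).mul (continuousOn_dX hU hG)).add
    ((continuousOn_dY hU hF).mul (continuousOn_dY hU hG))

lemma lap_mul {F G : ℂ → ℝ} (hU : IsOpen U) (hF : ContDiffOn ℝ 2 F U) (hG : ContDiffOn ℝ 2 G U)
    {z : ℂ} (hz : z ∈ U) :
    lap (fun w => F w * G w) z = F z * lap G z + G z * lap F z + 2 * gr F G z := by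
  have dF := fun w hw => ContDiffOn.diffAt hF two_ne_zero hU (z := w) hw
  have dG := fun w hw => ContDiffOn.diffAt hG two_ne_zero hU (z := w) hw
  have dFx := ContDiffOn.diffAt (contDiffOn_dX (m := 1) hU hF (by norm_num)) one_ne_zero hU hz
  have dFy := ContDiffOn.diffAt (contDiffOn_dY (m := 1) hU hF (by norm_num)) one_ne_zero hU hz
  have dGx := ContDiffOn.diffAt (contDiffOn_dX (m := 1) hU hG (by norm_num)) one_ne_zero hU hz
  have dGy := ContDiffOn.diffAt (contDiffOn_dY (m := 1) hU hG (by norm_num)) one_ne_zero hU hz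
  have e1 : dX (fun w => F w * G w) =ᶠ[𝓝 z] fun w => dX F w * G w + F w * dX G w :=
    Filter.eventually_of_mem (hU.mem_nhds hz) fun w hw => dX_mul (dF w hw) (dG w hw)
  have e2 : dY (fun w => F w * G w) =ᶠ[𝓝 z] fun w => dY F w * G w + F w * dY G w :=
    Filter.eventually_of_mem (hU.mem_nhds hz) fun w hw => dY_mul (dF w hw) (dG w hw)
  rw [lap, dX_congr e1, dY_congr e2, dX_add (dFx.fun_mul (dG z hz)) ((dF z hz).fun_mul dGx),
    dY_add (dFy.fun_mul (dG z hz)) ((dF z hz).fun_mul dGy), dX_mul dFx (dG z hz), dX_mul (dF z hz)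
      dGx,
    dY_mul dFy (dG z hz), dY_mul (dF z hz) dGy, lap, lap, gr]
  ring

lemma lap_comp {u : ℂ → ℝ} {φ φ1 : ℝ → ℝ} {d : ℝ} (hU : IsOpen U) (hu : ContDiffOn ℝ 2 u U)
    {z : ℂ} (hz : z ∈ U) (h1 : ∀ w ∈ U, HasDerivAt φ (φ1 (u w)) (u w))
    (h2 : HasDerivAt φ1 d (u z)) :
    lap (fun w => φ (u w)) z = φ1 (u z) * lap u z + d * gr u u z := by
  have du := fun w hw => ContDiffOn.diffAt hu two_ne_zero hU (z := w) hw
  have dux := ContDiffOn.diffAt (contDiffOn_dX (m := 1) hU hu (by norm_num)) one_ne_zero hU hz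
  have duy := ContDiffOn.diffAt (contDiffOn_dY (m := 1) hU hu (by norm_num)) one_ne_zero hU hz
  have e1 : dX (fun w => φ (u w)) =ᶠ[𝓝 z] fun w => φ1 (u w) * dX u w :=
    Filter.eventually_of_mem (hU.mem_nhds hz) fun w hw => dX_comp (h1 w hw) (du w hw)
  have e2 : dY (fun w => φ (u w)) =ᶠ[𝓝 z] fun w => φ1 (u w) * dY u w :=
    Filter.eventually_of_mem (hU.mem_nhds hz) fun w hw => dY_comp (h1 w hw) (du w hw)
  have d1 : DifferentiableAt ℝ (fun w => φ1 (u w)) z := h2.differentiableAt.comp z (du z hz)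
  rw [lap, dX_congr e1, dY_congr e2, dX_mul d1 dux, dY_mul d1 duy, dX_comp h2 (du z hz),
    dY_comp h2 (du z hz), lap, gr]
  ring

end smooth

/-- Normal derivative on the unit circle. -/
noncomputable def dN (F : ℂ → ℝ) (θ : ℝ) : ℝ :=
  Real.cos θ * dX F (cis θ) + Real.sin θ * dY F (cis θ)

lemma cis_mem {R : ℝ} (hR : 1 < R) (θ : ℝ) : cis θ ∈ ball (0 : ℂ) R := by simpa using hR

lemma intervalIntegrable_cis {E : Type*} [NormedAddCommGroup E] {F : ℂ → E} {R : ℝ} (hR : 1 < R)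
    (hF : ContinuousOn F (ball 0 R)) (a b : ℝ) :
    IntervalIntegrable (fun θ => F (cis θ)) volume a b :=
  ((hF.comp_continuous continuous_cis (cis_mem hR))).intervalIntegrable a b

lemma continuous_comp_cis {E : Type*} [TopologicalSpace E] {F : ℂ → E} {R : ℝ} (hR : 1 < R)
    (hF : ContinuousOn F (ball 0 R)) : Continuous (fun θ => F (cis θ)) :=
  hF.comp_continuous continuous_cis (cis_mem hR)

lemma continuous_dN {F : ℂ → ℝ} {R : ℝ} (hR : 1 < R) (hF : ContDiffOn ℝ 1 F (ball 0 R)) :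
    Continuous (dN F) := by
  have h1 := continuous_comp_cis hR (continuousOn_dX isOpen_ball hF)
  have h2 := continuous_comp_cis hR (continuousOn_dY isOpen_ball hF)
  unfold dN; fun_prop

/-- Divergence theorem for `F ∇G`. -/
theorem green_first {F G : ℂ → ℝ} {R : ℝ} (hR : 1 < R) (hF : ContDiffOn ℝ 1 F (ball 0 R))
    (hG : ContDiffOn ℝ 2 G (ball 0 R)) :
    ∫ z in closedBall (0 : ℂ) 1, (F z * lap G z + gr F G z) =
      ∫ θ in (-π)..π, F (cis θ) * dN G θ := by
  have hU : IsOpen (ball (0 : ℂ) R) := isOpen_ball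
  have gx := contDiffOn_dX (m := 1) hU hG (by norm_num)
  have gy := contDiffOn_dY (m := 1) hU hG (by norm_num)
  have h1 := integral_dX hR (hF.mul gx)
  have h2 := integral_dY hR (hF.mul gy)
  have i1 := integrableOn_closedBall hR (continuousOn_dX hU (hF.mul gx))
  have i2 := integrableOn_closedBall hR (continuousOn_dY hU (hF.mul gy))
  have j1 : Continuous fun θ => F (cis θ) := continuous_comp_cis hR hF.continuousOn
  have j2 := continuous_comp_cis hR gx.continuousOn
  have j3 := continuous_comp_cis hR gy.continuousOn
  have e : ∀ z ∈ closedBall (0:ℂ) 1, F z * lap G z + gr F G z =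
      dX (fun w => F w * dX G w) z + dY (fun w => F w * dY G w) z := by
    intro z hz
    have hz' := closedBall_subset_of_one_lt hR hz
    rw [dX_mul (ContDiffOn.diffAt hF one_ne_zero hU hz') (ContDiffOn.diffAt gx one_ne_zero hU hz'),
      dY_mul (ContDiffOn.diffAt hF one_ne_zero hU hz') (ContDiffOn.diffAt gy one_ne_zero hU hz'),
      lap, gr]
    ring
  rw [setIntegral_congr_fun isClosed_closedBall.measurableSet e]
  erw [integral_add i1 i2, h1, h2]
  rw [← intervalIntegral.integral_add]
  · refine intervalIntegral.integral_congr fun θ _ => ?_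
    simp only [dN, smul_eq_mul]; ring
  · exact (Real.continuous_cos.smul (j1.mul j2)).intervalIntegrable _ _
  · exact (Real.continuous_sin.smul (j1.mul j3)).intervalIntegrable _ _

theorem green_second {F G : ℂ → ℝ} {R : ℝ} (hR : 1 < R) (hF : ContDiffOn ℝ 2 F (ball 0 R))
    (hG : ContDiffOn ℝ 2 G (ball 0 R)) :
    ∫ z in closedBall (0 : ℂ) 1, F z * lap G z = (∫ z in closedBall (0 : ℂ) 1, G z * lap F z) +
      ∫ θ in (-π)..π, (F (cis θ) * dN G θ - G (cis θ) * dN F θ) := by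
  have hU : IsOpen (ball (0 : ℂ) R) := isOpen_ball
  have F1 := hF.of_le (m := 1) (by norm_num)
  have G1 := hG.of_le (m := 1) (by norm_num)
  have h1 := green_first hR F1 hG
  have h2 := green_first hR G1 hF
  have i1 := integrableOn_closedBall hR (hF.continuousOn.mul (contDiffOn_lap hU hG))
  have i2 := integrableOn_closedBall hR (hG.continuousOn.mul (contDiffOn_lap hU hF))
  have i3 := integrableOn_closedBall hR (continuousOn_gr hU F1 G1)
  have i4 := integrableOn_closedBall hR (continuousOn_gr hU G1 F1)
  have e : gr G F = gr F G := by funext z; simp only [gr]; ring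
  rw [e] at h2 i4
  erw [integral_add i1 i3] at h1
  erw [integral_add i2 i4] at h2
  have j1 := (continuous_comp_cis hR hF.continuousOn).mul (continuous_dN hR G1)
  have j2 := (continuous_comp_cis hR hG.continuousOn).mul (continuous_dN hR F1)
  erw [intervalIntegral.integral_sub (j1.intervalIntegrable _ _) (j2.intervalIntegrable _ _),
    ← h1, ← h2]
  change _ = _ + ((∫ z in closedBall (0 : ℂ) 1, F z * lap G z) + _
    - ((∫ z in closedBall (0 : ℂ) 1, G z * lap F z) + _))
  ring

/-- The Jacobian of two functions integrates to a boundary term. -/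
theorem integral_jacobian {A : Type*} [NormedRing A] [NormedAlgebra ℝ A] [CompleteSpace A]
    {F G : ℂ → A} {R : ℝ} (hR : 1 < R) (hF : ContDiffOn ℝ 1 F (ball 0 R))
    (hG : ContDiffOn ℝ 2 G (ball 0 R)) :
    ∫ z in closedBall (0 : ℂ) 1, (dX F z * dY G z - dY F z * dX G z) =
      ∫ θ in (-π)..π, F (cis θ) * (Real.cos θ • dY G (cis θ) - Real.sin θ • dX G (cis θ)) := by
  have hU : IsOpen (ball (0 : ℂ) R) := isOpen_ball
  have gx := contDiffOn_dX (m := 1) hU hG (by norm_num)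
  have gy := contDiffOn_dY (m := 1) hU hG (by norm_num)
  have h1 := integral_dX hR (hF.mul gy)
  have h2 := integral_dY hR (hF.mul gx)
  have i1 := integrableOn_closedBall hR (continuousOn_dX hU (hF.mul gy))
  have i2 := integrableOn_closedBall hR (continuousOn_dY hU (hF.mul gx))
  have j1 : Continuous fun θ => F (cis θ) := continuous_comp_cis hR hF.continuousOn
  have j2 := continuous_comp_cis hR gx.continuousOn
  have j3 := continuous_comp_cis hR gy.continuousOn
  have e : ∀ z ∈ closedBall (0:ℂ) 1, dX F z * dY G z - dY F z * dX G z =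
      dX (fun w => F w * dY G w) z - dY (fun w => F w * dX G w) z := by
    intro z hz
    have hz' := closedBall_subset_of_one_lt hR hz
    rw [dX_mul (ContDiffOn.diffAt hF one_ne_zero hU hz') (ContDiffOn.diffAt gy one_ne_zero hU hz'),
      dY_mul (ContDiffOn.diffAt hF one_ne_zero hU hz') (ContDiffOn.diffAt gx one_ne_zero hU hz'),
      dX_dY_comm hU hG hz']
    abel
  rw [setIntegral_congr_fun isClosed_closedBall.measurableSet e]
  erw [integral_sub i1 i2, h1, h2]
  rw [← intervalIntegral.integral_sub]
  · refine intervalIntegral.integral_congr fun θ _ => ?_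
    simp only [mul_sub, mul_smul_comm]
  · exact (Real.continuous_cos.smul (j1.mul j3)).intervalIntegrable _ _
  · exact (Real.continuous_sin.smul (j1.mul j2)).intervalIntegrable _ _

end

section

section poscube

lemma hasDerivAt_max_pow (n : ℕ) (x : ℝ) :
    HasDerivAt (fun x : ℝ => max x 0 ^ (n + 2)) ((n + 2 : ℕ) * max x 0 ^ (n + 1)) x := by
  rcases lt_trichotomy x 0 with h | h | h
  · have e : (fun x : ℝ => max x 0 ^ (n + 2)) =ᶠ[𝓝 x] fun _ => 0 := by
      filter_upwards [Iio_mem_nhds h] with y hy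
      simp [max_eq_right (le_of_lt (mem_Iio.1 hy))]
    rw [max_eq_right h.le]
    simpa using (hasDerivAt_const x (0 : ℝ)).congr_of_eventuallyEq e
  · subst h
    have h1 : HasDerivWithinAt (fun x : ℝ => max x 0 ^ (n + 2)) 0 (Iic 0) 0 := by
      refine (hasDerivWithinAt_const (0:ℝ) _ (0 : ℝ)).congr (fun y hy => ?_) (by simp)
      simp [max_eq_right (show y ≤ 0 from hy)]
    have h2 : HasDerivWithinAt (fun x : ℝ => max x 0 ^ (n + 2)) 0 (Ici 0) 0 := by
      have := (hasDerivAt_pow (n + 2) (0 : ℝ)).hasDerivWithinAt (s := Ici 0)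
      simp only [Nat.add_succ_sub_one] at this
      rw [zero_pow (by omega), mul_zero] at this
      refine this.congr (fun y hy => ?_) (by simp)
      simp [max_eq_left (show 0 ≤ y from hy)]
    have := h1.union h2
    rw [Iic_union_Ici, hasDerivWithinAt_univ] at this
    simpa using this
  · have e : (fun x : ℝ => max x 0 ^ (n + 2)) =ᶠ[𝓝 x] fun x => x ^ (n + 2) := by
      filter_upwards [Ioi_mem_nhds h] with y hy
      simp [max_eq_left (le_of_lt (mem_Ioi.1 hy))]
    rw [max_eq_left h.le]
    have := (hasDerivAt_pow (n + 2) x).congr_of_eventuallyEq e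
    simpa using this

/-- The cube of the positive part. -/
noncomputable def pc (x : ℝ) : ℝ := max x 0 ^ 3

lemma hasDerivAt_pc (x : ℝ) : HasDerivAt pc (3 * max x 0 ^ 2) x := by
  have := hasDerivAt_max_pow 1 x
  norm_num at this
  exact this

lemma hasDerivAt_pc' (x : ℝ) : HasDerivAt (fun x => 3 * max x 0 ^ 2) (6 * max x 0) x := by
  refine ((hasDerivAt_max_pow 0 x).const_mul 3).congr_deriv ?_
  norm_num; ring

lemma contDiff_of_two {φ φ1 φ2 : ℝ → ℝ} (h1 : ∀ x, HasDerivAt φ (φ1 x) x)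
    (h2 : ∀ x, HasDerivAt φ1 (φ2 x) x) (h3 : Continuous φ2) : ContDiff ℝ 2 φ := by
  have d1 : deriv φ = φ1 := funext fun x => (h1 x).deriv
  have d2 : deriv φ1 = φ2 := funext fun x => (h2 x).deriv
  have c1 : ContDiff ℝ 1 φ1 := contDiff_one_iff_deriv.2 ⟨fun x => (h2 x).differentiableAt, d2 ▸ h3⟩
  have := (contDiff_succ_iff_deriv (f := φ) (n := 1) (𝕜 := ℝ)).2
    ⟨fun x => (h1 x).differentiableAt, by simp, d1 ▸ c1⟩
  exact this.of_le (by norm_num)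

lemma contDiff_pc : ContDiff ℝ 2 pc :=
  contDiff_of_two hasDerivAt_pc hasDerivAt_pc' (by fun_prop)

end poscube

section normSq

variable {h : ℂ → ℂ} {U : Set ℂ} {z : ℂ}

lemma contDiff_normSq {n : ℕ∞ω} : ContDiff ℝ n (normSq : ℂ → ℝ) := by
  have : (normSq : ℂ → ℝ) = fun z => reCLM z * reCLM z + imCLM z * imCLM z := by
    funext z; simp [normSq_apply]
  rw [this]
  exact (reCLM.contDiff.mul reCLM.contDiff).add (imCLM.contDiff.mul imCLM.contDiff)

lemma contDiffOn_normSq {n : ℕ∞ω} (hU : IsOpen U) (hh : DifferentiableOn ℂ h U) :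
    ContDiffOn ℝ n (fun z => normSq (h z)) U :=
  contDiff_normSq.comp_contDiffOn (contDiffOn_hol hU hh)

lemma dX_normSq {F : ℂ → ℂ} (hF : DifferentiableAt ℝ F z) :
    dX (fun z => normSq (F z)) z = 2 * (conj (F z) * dX F z).re := by
  have hr : DifferentiableAt ℝ (fun z => (F z).re) z := reCLM.differentiableAt.comp z hF
  have hi : DifferentiableAt ℝ (fun z => (F z).im) z := imCLM.differentiableAt.comp z hF
  have : (fun z => normSq (F z)) = fun z => (F z).re * (F z).re + (F z).im * (F z).im := by
    funext z; simp [normSq_apply]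
  rw [this, dX_add (hr.fun_mul hr) (hi.fun_mul hi), dX_mul hr hr, dX_mul hi hi, dX_re hF, dX_im hF]
  simp; ring

lemma dY_normSq {F : ℂ → ℂ} (hF : DifferentiableAt ℝ F z) :
    dY (fun z => normSq (F z)) z = 2 * (conj (F z) * dY F z).re := by
  have hr : DifferentiableAt ℝ (fun z => (F z).re) z := reCLM.differentiableAt.comp z hF
  have hi : DifferentiableAt ℝ (fun z => (F z).im) z := imCLM.differentiableAt.comp z hF
  have : (fun z => normSq (F z)) = fun z => (F z).re * (F z).re + (F z).im * (F z).im := by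
    funext z; simp [normSq_apply]
  rw [this, dY_add (hr.fun_mul hr) (hi.fun_mul hi), dY_mul hr hr, dY_mul hi hi, dY_re hF, dY_im hF]
  simp; ring

lemma dX_normSq_hol (hh : DifferentiableAt ℂ h z) :
    dX (fun z => normSq (h z)) z = 2 * (conj (h z) * deriv h z).re := by
  rw [dX_normSq (differentiableAt_real hh), dX_hol hh]

lemma dY_normSq_hol (hh : DifferentiableAt ℂ h z) :
    dY (fun z => normSq (h z)) z = -2 * (conj (h z) * deriv h z).im := by
  rw [dY_normSq (differentiableAt_real hh), dY_hol hh]; simp; ring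

lemma gr_normSq_self (hh : DifferentiableAt ℂ h z) :
    gr (fun z => normSq (h z)) (fun z => normSq (h z)) z
      = 4 * normSq (h z) * normSq (deriv h z) := by
  rw [gr, dX_normSq_hol hh, dY_normSq_hol hh]
  simp [normSq_apply]; ring

lemma lap_normSq (hU : IsOpen U) (hh : DifferentiableOn ℂ h U) (hz : z ∈ U) :
    lap (fun z => normSq (h z)) z = 4 * normSq (deriv h z) := by
  have hd := fun w hw => hh.differentiableAt (hU.mem_nhds (x := w) hw)
  have hd' : DifferentiableAt ℂ (deriv h) z := (hh.deriv hU).differentiableAt (hU.mem_nhds hz)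
  have e1 : dX (fun z => normSq (h z)) =ᶠ[𝓝 z] fun z => 2 * (conj (h z) * deriv h z).re :=
    Filter.eventually_of_mem (hU.mem_nhds hz) fun w hw => dX_normSq_hol (hd w hw)
  have e2 : dY (fun z => normSq (h z)) =ᶠ[𝓝 z] fun z => -2 * (conj (h z) * deriv h z).im :=
    Filter.eventually_of_mem (hU.mem_nhds hz) fun w hw => dY_normSq_hol (hd w hw)
  have r1 : DifferentiableAt ℝ (fun z => conj (h z)) z :=
    (conjCLE : ℂ →L[ℝ] ℂ).differentiableAt.comp z (differentiableAt_real (hd z hz))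
  have r2 := differentiableAt_real hd'
  have r3 := r1.fun_mul r2
  have r4 : DifferentiableAt ℝ (fun z => (conj (h z) * deriv h z).re) z :=
    reCLM.differentiableAt.comp z r3
  have r5 : DifferentiableAt ℝ (fun z => (conj (h z) * deriv h z).im) z :=
    imCLM.differentiableAt.comp z r3
  rw [lap, dX_congr e1, dY_congr e2, dX_mul (by simp) r4, dY_mul (by simp) r5, dX_re r3, dY_im r3,
    dX_mul r1 r2,
    dY_mul r1 r2, dX_conj (differentiableAt_real (hd z hz)),
    dY_conj (differentiableAt_real (hd z hz)), dX_hol (hd z hz), dY_hol (hd z hz), dX_hol hd',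
    dY_hol hd']
  simp [normSq_apply]; ring

end normSq

/-- The defining function `1 - |z|²` of the unit disc. -/
noncomputable def rho (z : ℂ) : ℝ := 1 - normSq z

lemma contDiff_rho {n : ℕ∞ω} : ContDiff ℝ n rho := contDiff_const.sub contDiff_normSq

lemma differentiableAt_rho (z : ℂ) : DifferentiableAt ℝ rho z :=
  (contDiff_rho (n := 1)).differentiable one_ne_zero z

lemma differentiableAt_normSq (z : ℂ) : DifferentiableAt ℝ (normSq : ℂ → ℝ) z :=
  (contDiff_normSq (n := 1)).differentiable one_ne_zero z

@[simp] lemma dX_id (z : ℂ) : dX (fun w : ℂ => w) z = 1 := by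
  rw [dX_hol (F := fun w => w) differentiableAt_id, deriv_id'']

@[simp] lemma dY_id (z : ℂ) : dY (fun w : ℂ => w) z = I := by
  rw [dY_hol (F := fun w => w) differentiableAt_id, deriv_id'', mul_one]

lemma dX_rho (z : ℂ) : dX rho z = -2 * z.re := by
  have h := dX_sub (z := z) (F := fun _ => (1 : ℝ)) (by simp) (differentiableAt_normSq z)
  have h2 := dX_normSq (z := z) (F := fun w => w) differentiableAt_id
  simp only [dX_id, dX_const, mul_one, conj_re] at h h2
  change dX rho z = _ at h
  change dX normSq z = _ at h2
  rw [h, h2]; ring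

lemma dY_rho (z : ℂ) : dY rho z = -2 * z.im := by
  have h := dY_sub (z := z) (F := fun _ => (1 : ℝ)) (by simp) (differentiableAt_normSq z)
  have h2 := dY_normSq (z := z) (F := fun w => w) differentiableAt_id
  simp only [dY_id, dY_const] at h h2
  change dY rho z = _ at h
  change dY normSq z = _ at h2
  rw [h, h2]; simp

lemma lap_rho (z : ℂ) : lap rho z = -4 := by
  have e1 : dX rho = fun z => -2 * reCLM z := funext dX_rho
  have e2 : dY rho = fun z => -2 * imCLM z := funext dY_rho
  rw [lap, e1, e2, dX_mul (by simp) reCLM.differentiableAt, dY_mul (by simp) imCLM.differentiableAt]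
  have a1 : dX (fun z => reCLM z) z = 1 := by
    have := dX_clm (z := z) reCLM (F := fun w => w) differentiableAt_id
    rw [this, dX_id]; simp
  have a2 : dY (fun z => imCLM z) z = 1 := by
    have := dY_clm (z := z) imCLM (F := fun w => w) differentiableAt_id
    rw [this, dY_id]; simp
  have b1 : dX (⇑reCLM) z = 1 := a1
  have b2 : dY (⇑imCLM) z = 1 := a2
  rw [b1, b2]; simp; norm_num

@[simp] lemma rho_cis (θ : ℝ) : rho (cis θ) = 0 := by
  rw [rho, normSq_eq_norm_sq, norm_cis]; norm_num

@[simp] lemma dN_rho (θ : ℝ) : dN rho θ = -2 := by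
  rw [dN, dX_rho, dY_rho]; simp; linarith [Real.sin_sq_add_cos_sq θ]

lemma rho_nonneg {z : ℂ} (hz : z ∈ closedBall (0 : ℂ) 1) : 0 ≤ rho z := by
  have : ‖z‖ ≤ 1 := by simpa using hz
  rw [rho, normSq_eq_norm_sq]; nlinarith [norm_nonneg z]

lemma rho_le_one (z : ℂ) : rho z ≤ 1 := by rw [rho]; linarith [normSq_nonneg z]

theorem integral_rho_lap {u : ℂ → ℝ} {R : ℝ} (hR : 1 < R) (hu : ContDiffOn ℝ 2 u (ball 0 R)) :
    (∫ z in closedBall (0 : ℂ) 1, rho z * lap u z) + 4 * (∫ z in closedBall (0 : ℂ) 1, u z) =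
      2 * ∫ θ in (-π)..π, u (cis θ) := by
  have := green_second hR (contDiff_rho (n := 2)).contDiffOn hu
  simp only [lap_rho, rho_cis, dN_rho, zero_mul, zero_sub] at this
  rw [this, integral_mul_const, ← intervalIntegral.integral_const_mul]
  have : ∀ θ : ℝ, -(u (cis θ) * -2) = 2 * u (cis θ) := fun θ => by ring
  simp only [this]; ring

/-- Integration by parts against a holomorphic density. -/
theorem integral_mul_hol {ψ q : ℂ → ℂ} {R : ℝ} (hR : 1 < R) (hψ : ContDiffOn ℝ 1 ψ (ball 0 R))
    (hq : DifferentiableOn ℂ q (ball 0 R)) :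
    ∫ z in closedBall (0 : ℂ) 1, ψ z * q z =
      ∫ z in closedBall (0 : ℂ) 1,
        rho z * q z * (2 * ψ z + conj z * ((dX ψ z + I * dY ψ z) / 2)) := by
  have hU : IsOpen (ball (0 : ℂ) R) := isOpen_ball
  set u : ℂ → ℂ := fun z => (rho z : ℂ) * (conj z * (ψ z * q z)) with hu
  have cr : ContDiffOn ℝ 1 (fun z => (rho z : ℂ)) (ball 0 R) :=
    (ofRealCLM.contDiff.comp contDiff_rho).contDiffOn
  have cc : ContDiffOn ℝ 1 (fun z : ℂ => conj z) (ball 0 R) :=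
    (conjCLE : ℂ →L[ℝ] ℂ).contDiff.contDiffOn
  have cq : ContDiffOn ℝ 1 q (ball 0 R) := contDiffOn_hol hU hq
  have cu : ContDiffOn ℝ 1 u (ball 0 R) := cr.mul (cc.mul (hψ.mul cq))
  have h1 := integral_dX hR cu
  have h2 := integral_dY hR cu
  have z1 : ∀ θ, u (cis θ) = 0 := fun θ => by simp [hu]
  simp only [z1, smul_zero, intervalIntegral.integral_zero] at h1 h2
  have i1 := integrableOn_closedBall hR (continuousOn_dX hU cu)
  have i2 := integrableOn_closedBall hR (continuousOn_dY hU cu)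
  have hs : ∫ z in closedBall (0 : ℂ) 1, (dX u z + I * dY u z) / 2 = 0 := by
    rw [integral_div]
    erw [integral_add i1 (i2.const_mul I), integral_const_mul]
    rw [h1, h2]; simp
  have i3 : IntegrableOn (fun z => ψ z * q z) (closedBall 0 1) :=
    integrableOn_closedBall hR (hψ.continuousOn.mul cq.continuousOn)
  have i4 : IntegrableOn (fun z => (dX u z + I * dY u z) / 2) (closedBall 0 1) :=
    (i1.add (i2.const_mul I)).div_const 2
  refine ((add_zero _).symm.trans (congrArg _ hs.symm)).trans ((integral_add i3 i4).symm.trans ?_)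
  refine setIntegral_congr_fun isClosed_closedBall.measurableSet fun z hz => ?_
  have hz' := closedBall_subset_of_one_lt hR hz
  have d1 := ContDiffOn.diffAt cr one_ne_zero hU hz'
  have d2 := ContDiffOn.diffAt cc one_ne_zero hU hz'
  have d3 := ContDiffOn.diffAt hψ one_ne_zero hU hz'
  have d4 := hq.differentiableAt (hU.mem_nhds hz')
  have d4' := differentiableAt_real d4
  simp only [hu]
  rw [dX_mul d1 (d2.fun_mul (d3.fun_mul d4')), dX_mul d2 (d3.fun_mul d4'), dX_mul d3 d4',
    dY_mul d1 (d2.fun_mul (d3.fun_mul d4')), dY_mul d2 (d3.fun_mul d4'), dY_mul d3 d4',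
    dX_ofReal (differentiableAt_rho z), dY_ofReal (differentiableAt_rho z), dX_rho, dY_rho,
    dX_conj (F := fun w => w) differentiableAt_id, dY_conj (F := fun w => w) differentiableAt_id,
    dX_hol d4, dY_hol d4, dX_id, dY_id]
  have e1 : (rho z : ℂ) = 1 - z * conj z := by rw [mul_conj, rho]; push_cast; rfl
  have e2 : (((-2 * z.re : ℝ) : ℂ) + I * ((-2 * z.im : ℝ) : ℂ)) = -2 * z := by
    conv_rhs => rw [← re_add_im z]
    push_cast; ring
  simp only [map_one, conj_I]
  linear_combination (conj z * (ψ z * q z) / 2) * e2 - (ψ z * q z) * e1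
    + (-(rho z : ℂ) * ψ z * q z / 2 + (rho z : ℂ) * conj z * ψ z * deriv q z / 2) * (I_mul_I)

theorem norm_integral_mul_hol_le {ψ q : ℂ → ℂ} {R : ℝ} (hR : 1 < R)
    (hψ : ContDiffOn ℝ 1 ψ (ball 0 R)) (hq : DifferentiableOn ℂ q (ball 0 R)) :
    ‖∫ z in closedBall (0 : ℂ) 1, ψ z * q z‖ ≤
      ∫ z in closedBall (0 : ℂ) 1, rho z * ‖q z‖ * (2 * ‖ψ z‖ + (‖dX ψ z‖ + ‖dY ψ z‖) / 2) := by
  rw [integral_mul_hol hR hψ hq]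
  refine norm_integral_le_of_norm_le ?_ ?_
  · apply integrableOn_closedBall hR
    exact ((contDiff_rho (n := 1)).continuous.continuousOn.mul hq.continuousOn.norm).mul
      ((continuousOn_const.mul hψ.continuousOn.norm).add
        (((continuousOn_dX isOpen_ball hψ).norm.add
          (continuousOn_dY isOpen_ball hψ).norm).div_const 2))
  · refine ae_restrict_of_forall_mem isClosed_closedBall.measurableSet fun z hz => ?_
    have hz' : ‖z‖ ≤ 1 := by simpa using hz
    rw [norm_mul, norm_mul, norm_real, Real.norm_of_nonneg (rho_nonneg hz)]
    have := rho_nonneg hz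
    gcongr
    calc ‖2 * ψ z + conj z * ((dX ψ z + I * dY ψ z) / 2)‖
        ≤ ‖2 * ψ z‖ + ‖conj z * ((dX ψ z + I * dY ψ z) / 2)‖ := norm_add_le _ _
      _ = 2 * ‖ψ z‖ + ‖z‖ * (‖dX ψ z + I * dY ψ z‖ / 2) := by simp
      _ ≤ 2 * ‖ψ z‖ + 1 * ((‖dX ψ z‖ + ‖dY ψ z‖) / 2) := by
        gcongr
        refine (norm_add_le _ _).trans ?_
        simp
      _ = _ := by ring

end

section

lemma exists_ball_subset_of_closedBall_subset {U : Set ℂ} (hU : IsOpen U)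
    (h : closedBall (0 : ℂ) 1 ⊆ U) : ∃ R : ℝ, 1 < R ∧ ball (0 : ℂ) R ⊆ U := by
  obtain ⟨ε, hε, hs⟩ := (isCompact_closedBall (0 : ℂ) 1).exists_thickening_subset_open hU h
  rw [thickening_closedBall hε zero_le_one] at hs
  exact ⟨ε + 1, by linarith, hs⟩

lemma abs_gr_le {F G : ℂ → ℝ} {z : ℂ} {b c : ℝ} (hb : 0 ≤ b) (hc : 0 ≤ c)
    (hF : dX F z ^ 2 + dY F z ^ 2 ≤ b ^ 2) (hG : dX G z ^ 2 + dY G z ^ 2 ≤ c ^ 2) :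
    |gr F G z| ≤ b * c := by
  apply abs_le_of_sq_le_sq _ (by positivity)
  have : gr F G z ^ 2 ≤ (dX F z ^ 2 + dY F z ^ 2) * (dX G z ^ 2 + dY G z ^ 2) := by
    rw [gr]; nlinarith [sq_nonneg (dX F z * dY G z - dY F z * dX G z)]
  calc _ ≤ _ := this
    _ ≤ b ^ 2 * c ^ 2 := by gcongr
    _ = _ := by ring

section sqrt

variable {u : ℂ → ℝ} {U : Set ℂ} {z : ℂ}

lemma contDiffOn_sqrt {n : ℕ∞ω} (hu : ContDiffOn ℝ n u U) (hp : ∀ w ∈ U, 0 < u w) :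
    ContDiffOn ℝ n (fun w => √(u w)) U :=
  hu.sqrt fun w hw => (hp w hw).ne'

lemma sqrt_mul_dX (hU : IsOpen U) (hu : ContDiffOn ℝ 2 u U) (hp : ∀ w ∈ U, 0 < u w) (hz : z ∈ U) :
    2 * √(u z) * dX (fun w => √(u w)) z = dX u z := by
  have hs := ContDiffOn.diffAt (contDiffOn_sqrt hu hp) two_ne_zero hU hz
  have := dX_mul hs hs
  rw [dX_congr (G := u) (Filter.eventually_of_mem (hU.mem_nhds hz) fun w hw =>
    Real.mul_self_sqrt (hp w hw).le)] at this
  rw [this]; ring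

lemma sqrt_mul_dY (hU : IsOpen U) (hu : ContDiffOn ℝ 2 u U) (hp : ∀ w ∈ U, 0 < u w) (hz : z ∈ U) :
    2 * √(u z) * dY (fun w => √(u w)) z = dY u z := by
  have hs := ContDiffOn.diffAt (contDiffOn_sqrt hu hp) two_ne_zero hU hz
  have := dY_mul hs hs
  rw [dY_congr (G := u) (Filter.eventually_of_mem (hU.mem_nhds hz) fun w hw =>
    Real.mul_self_sqrt (hp w hw).le)] at this
  rw [this]; ring

lemma lap_congr {F G : ℂ → ℝ} (hU : IsOpen U) (h : ∀ w ∈ U, F w = G w) (hz : z ∈ U) :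
    lap F z = lap G z := by
  have e1 : dX F =ᶠ[𝓝 z] dX G := Filter.eventually_of_mem (hU.mem_nhds hz) fun w hw =>
    dX_congr (Filter.eventually_of_mem (hU.mem_nhds hw) h)
  have e2 : dY F =ᶠ[𝓝 z] dY G := Filter.eventually_of_mem (hU.mem_nhds hz) fun w hw =>
    dY_congr (Filter.eventually_of_mem (hU.mem_nhds hw) h)
  rw [lap, lap, dX_congr e1, dY_congr e2]

lemma sqrt_mul_lap (hU : IsOpen U) (hu : ContDiffOn ℝ 2 u U) (hp : ∀ w ∈ U, 0 < u w) (hz : z ∈ U) :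
    2 * √(u z) * lap (fun w => √(u w)) z +
      2 * gr (fun w => √(u w)) (fun w => √(u w)) z = lap u z := by
  have hs := contDiffOn_sqrt hu hp
  have := lap_mul hU hs hs hz
  rw [lap_congr (G := u) hU (fun w hw => Real.mul_self_sqrt (hp w hw).le) hz] at this
  rw [this]; ring

end sqrt

/-- Regularised modulus of a holomorphic function. -/
noncomputable def rmod (t : ℝ) (k : ℂ → ℂ) (z : ℂ) : ℝ := √(normSq (k z) + t ^ 2)

section rmod

variable {t : ℝ} {k : ℂ → ℂ} {U : Set ℂ} {z : ℂ}

lemma rmod_arg_pos (ht : 0 < t) (k : ℂ → ℂ) (w : ℂ) : 0 < normSq (k w) + t ^ 2 := by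
  have := normSq_nonneg (k w); positivity

lemma rmod_pos (ht : 0 < t) (k : ℂ → ℂ) (z : ℂ) : 0 < rmod t k z :=
  Real.sqrt_pos.2 (rmod_arg_pos ht k z)

lemma rmod_sq (k : ℂ → ℂ) (z : ℂ) : rmod t k z ^ 2 = ‖k z‖ ^ 2 + t ^ 2 := by
  rw [rmod, Real.sq_sqrt (by have := normSq_nonneg (k z); positivity), normSq_eq_norm_sq]

lemma norm_le_rmod (ht : 0 < t) (k : ℂ → ℂ) (z : ℂ) : ‖k z‖ ≤ rmod t k z :=
  (abs_le_of_sq_le_sq' (by rw [rmod_sq]; nlinarith) (rmod_pos ht k z).le).2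

lemma rmod_le (ht : 0 < t) (k : ℂ → ℂ) (z : ℂ) : rmod t k z ≤ ‖k z‖ + t := by
  refine (abs_le_of_sq_le_sq' ?_ (by positivity)).2
  rw [rmod_sq]; nlinarith [norm_nonneg (k z)]

lemma contDiffOn_rmod (ht : 0 < t) {n : ℕ∞ω} (hU : IsOpen U) (hk : DifferentiableOn ℂ k U) :
    ContDiffOn ℝ n (rmod t k) U :=
  contDiffOn_sqrt ((contDiffOn_normSq hU hk).add contDiffOn_const) fun w _ => rmod_arg_pos ht k w

lemma rmod_mul_dX (ht : 0 < t) (hU : IsOpen U) (hk : DifferentiableOn ℂ k U) (hz : z ∈ U) :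
    rmod t k z * dX (rmod t k) z = (conj (k z) * deriv k z).re := by
  have h0 := contDiffOn_normSq (n := 2) hU hk
  have h := sqrt_mul_dX hU (h0.add contDiffOn_const) (fun w _ => rmod_arg_pos ht k w) hz
  have h1 := dX_add (F := fun w => normSq (k w)) (G := fun _ => t ^ 2)
    (ContDiffOn.diffAt h0 two_ne_zero hU hz) (by simp)
  rw [dX_normSq_hol (hk.differentiableAt (hU.mem_nhds hz)), dX_const] at h1
  change 2 * rmod t k z * dX (rmod t k) z = dX (fun w => normSq (k w) + t ^ 2) z at h
  linarith

lemma rmod_mul_dY (ht : 0 < t) (hU : IsOpen U) (hk : DifferentiableOn ℂ k U) (hz : z ∈ U) :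
    rmod t k z * dY (rmod t k) z = -(conj (k z) * deriv k z).im := by
  have h0 := contDiffOn_normSq (n := 2) hU hk
  have h := sqrt_mul_dY hU (h0.add contDiffOn_const) (fun w _ => rmod_arg_pos ht k w) hz
  have h1 := dY_add (F := fun w => normSq (k w)) (G := fun _ => t ^ 2)
    (ContDiffOn.diffAt h0 two_ne_zero hU hz) (by simp)
  rw [dY_normSq_hol (hk.differentiableAt (hU.mem_nhds hz)), dY_const] at h1
  change 2 * rmod t k z * dY (rmod t k) z = dY (fun w => normSq (k w) + t ^ 2) z at h
  linarith

lemma rmod_mul_lap (ht : 0 < t) (hU : IsOpen U) (hk : DifferentiableOn ℂ k U) (hz : z ∈ U) :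
    rmod t k z * lap (rmod t k) z + gr (rmod t k) (rmod t k) z = 2 * ‖deriv k z‖ ^ 2 := by
  have h0 := contDiffOn_normSq (n := 2) hU hk
  have h := sqrt_mul_lap hU (h0.add contDiffOn_const) (fun w _ => rmod_arg_pos ht k w) hz
  have e1 : ∀ w ∈ U, dX (fun w => normSq (k w) + t ^ 2) w = dX (fun w => normSq (k w)) w := by
    intro w hw
    rw [dX_add (ContDiffOn.diffAt h0 two_ne_zero hU hw) (by simp), dX_const, add_zero]
  have e2 : ∀ w ∈ U, dY (fun w => normSq (k w) + t ^ 2) w = dY (fun w => normSq (k w)) w := by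
    intro w hw
    rw [dY_add (ContDiffOn.diffAt h0 two_ne_zero hU hw) (by simp), dY_const, add_zero]
  have e3 : lap (fun w => normSq (k w) + t ^ 2) z = lap (fun w => normSq (k w)) z := by
    rw [lap, lap, dX_congr (Filter.eventually_of_mem (hU.mem_nhds hz) e1),
      dY_congr (Filter.eventually_of_mem (hU.mem_nhds hz) e2)]
  rw [lap_normSq hU hk hz, normSq_eq_norm_sq] at e3
  change 2 * rmod t k z * lap (rmod t k) z + 2 * gr (rmod t k) (rmod t k) z =
    lap (fun w => normSq (k w) + t ^ 2) z at h
  linarith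

lemma gr_rmod_le (ht : 0 < t) (hU : IsOpen U) (hk : DifferentiableOn ℂ k U) (hz : z ∈ U) :
    dX (rmod t k) z ^ 2 + dY (rmod t k) z ^ 2 ≤ ‖deriv k z‖ ^ 2 := by
  have h1 := rmod_mul_dX ht hU hk hz
  have h2 := rmod_mul_dY ht hU hk hz
  have hp := rmod_pos ht k z
  have h3 : rmod t k z ^ 2 * (dX (rmod t k) z ^ 2 + dY (rmod t k) z ^ 2) =
      ‖k z‖ ^ 2 * ‖deriv k z‖ ^ 2 := by
    rw [← normSq_eq_norm_sq, ← normSq_eq_norm_sq, ← normSq_conj (k z), ← normSq_mul, normSq_apply,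
      ← h1, ← neg_eq_iff_eq_neg.2 h2]
    ring
  have h4 : rmod t k z ^ 2 * (dX (rmod t k) z ^ 2 + dY (rmod t k) z ^ 2) ≤
      rmod t k z ^ 2 * ‖deriv k z‖ ^ 2 := by
    rw [h3]; gcongr; exact norm_le_rmod ht k z
  exact le_of_mul_le_mul_left h4 (by positivity)

lemma lap_rmod_ge (ht : 0 < t) (hU : IsOpen U) (hk : DifferentiableOn ℂ k U) (hz : z ∈ U) :
    ‖deriv k z‖ ^ 2 / rmod t k z ≤ lap (rmod t k) z := by
  rw [div_le_iff₀ (rmod_pos ht k z)]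
  have h1 := rmod_mul_lap ht hU hk hz
  have h2 := gr_rmod_le ht hU hk hz
  rw [gr] at h1; nlinarith

end rmod

section integrals

variable {t R M : ℝ} {k g : ℂ → ℂ} {V : ℂ → ℝ}

lemma continuousOn_lap_rmod_aux (ht : 0 < t) (hk : DifferentiableOn ℂ k (ball 0 R)) :
    ContinuousOn (fun z => rho z * (‖deriv k z‖ ^ 2 / rmod t k z)) (ball 0 R) := by
  have h1 := (contDiffOn_rmod (n := 1) ht isOpen_ball hk).continuousOn
  have h2 := (hk.deriv isOpen_ball).continuousOn
  exact (contDiff_rho (n := 1)).continuous.continuousOn.mul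
    ((h2.norm.pow 2).div h1 fun z _ => (rmod_pos ht k z).ne')

lemma setIntegral_mono_closedBall {u v : ℂ → ℝ} (hR : 1 < R) (hu : ContinuousOn u (ball 0 R))
    (hv : ContinuousOn v (ball 0 R)) (h : ∀ z ∈ closedBall (0 : ℂ) 1, u z ≤ v z) :
    ∫ z in closedBall (0 : ℂ) 1, u z ≤ ∫ z in closedBall (0 : ℂ) 1, v z :=
  setIntegral_mono_on (integrableOn_closedBall hR hu) (integrableOn_closedBall hR hv)
    isClosed_closedBall.measurableSet h

lemma integral_cis_mono {u v : ℂ → ℝ} (hR : 1 < R) (hu : ContinuousOn u (ball 0 R))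
    (hv : ContinuousOn v (ball 0 R)) (h : ∀ θ, u (cis θ) ≤ v (cis θ)) :
    ∫ θ in (-π)..π, u (cis θ) ≤ ∫ θ in (-π)..π, v (cis θ) :=
  intervalIntegral.integral_mono (by linarith [Real.pi_pos]) (intervalIntegrable_cis hR hu _ _)
    (intervalIntegrable_cis hR hv _ _) h

lemma integral_rmod_le (ht : 0 < t) (hR : 1 < R) (hk : DifferentiableOn ℂ k (ball 0 R)) :
    ∫ z in closedBall (0 : ℂ) 1, rmod t k z ≤ (∫ θ in (-π)..π, rmod t k (cis θ)) / 2 := by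
  have h := integral_rho_lap hR (contDiffOn_rmod ht isOpen_ball hk)
  have h2 : 0 ≤ ∫ z in closedBall (0 : ℂ) 1, rho z * lap (rmod t k) z := by
    refine setIntegral_nonneg isClosed_closedBall.measurableSet fun z hz => ?_
    refine mul_nonneg (rho_nonneg hz) (le_trans ?_ (lap_rmod_ge ht isOpen_ball hk
      (closedBall_subset_of_one_lt hR hz)))
    have := rmod_pos ht k z; positivity
  linarith

lemma integral_deriv_rmod_le (ht : 0 < t) (hR : 1 < R) (hk : DifferentiableOn ℂ k (ball 0 R)) :
    ∫ z in closedBall (0 : ℂ) 1, rho z * (‖deriv k z‖ ^ 2 / rmod t k z) ≤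
      2 * ∫ θ in (-π)..π, rmod t k (cis θ) := by
  have hc := contDiffOn_rmod (n := 2) ht isOpen_ball hk
  have h := integral_rho_lap hR hc
  have h2 : 0 ≤ ∫ z in closedBall (0 : ℂ) 1, rmod t k z :=
    setIntegral_nonneg isClosed_closedBall.measurableSet fun z hz => (rmod_pos ht k z).le
  have h3 := setIntegral_mono_closedBall hR (continuousOn_lap_rmod_aux ht hk)
    ((contDiff_rho (n := 1)).continuous.continuousOn.mul (contDiffOn_lap isOpen_ball hc))
    fun z hz => mul_le_mul_of_nonneg_left (lap_rmod_ge ht isOpen_ball hk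
      (closedBall_subset_of_one_lt hR hz)) (rho_nonneg hz)
  simp only [Pi.mul_apply] at h3
  linarith

/-- If `c z + ... ≤ lap u + b |k'|²/K` with `0 ≤ u ≤ B K`, the density `c` has small integral. -/
lemma integral_rho_le_of_lap (ht : 0 < t) (hR : 1 < R) (hk : DifferentiableOn ℂ k (ball 0 R))
    {u c : ℂ → ℝ} {b B : ℝ} (hu : ContDiffOn ℝ 2 u (ball 0 R)) (hc : ContinuousOn c (ball 0 R))
    (hb : 0 ≤ b)
    (h0 : ∀ z ∈ closedBall (0 : ℂ) 1, 0 ≤ u z) (h1 : ∀ θ, u (cis θ) ≤ B * rmod t k (cis θ))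
    (h : ∀ z ∈ closedBall (0 : ℂ) 1, c z ≤ lap u z + b * (‖deriv k z‖ ^ 2 / rmod t k z)) :
    ∫ z in closedBall (0 : ℂ) 1, rho z * c z ≤
      (2 * B + 2 * b) * ∫ θ in (-π)..π, rmod t k (cis θ) := by
  have e1 := integral_rho_lap hR hu
  have e2 : 0 ≤ ∫ z in closedBall (0 : ℂ) 1, u z :=
    setIntegral_nonneg isClosed_closedBall.measurableSet h0
  have rc := (contDiff_rho (n := 1)).continuous.continuousOn (s := ball 0 R)
  have c1 := rc.mul (contDiffOn_lap isOpen_ball hu)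
  have c2 := (continuousOn_lap_rmod_aux (R := R) ht hk).const_mul b
  have e3 := setIntegral_mono_closedBall hR (rc.mul hc) (c1.add c2) fun z hz => by
    have := mul_le_mul_of_nonneg_left (h z hz) (rho_nonneg hz)
    simp only [Pi.mul_apply, Pi.add_apply]
    linarith
  have e4 := integral_add (integrableOn_closedBall hR c1) (integrableOn_closedBall hR c2)
  rw [integral_const_mul] at e4
  have e5 := integral_deriv_rmod_le ht hR hk
  have e6 := integral_cis_mono hR hu.continuousOn
    ((contDiffOn_rmod (n := 1) ht isOpen_ball hk).continuousOn.const_mul B) h1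
  rw [intervalIntegral.integral_const_mul] at e6
  simp only [Pi.mul_apply, Pi.add_apply] at e3 e4
  have e7 := mul_le_mul_of_nonneg_left e5 hb
  linarith

lemma integral_deriv_sq_mul_rmod_le (ht : 0 < t) (hR : 1 < R)
    (hk : DifferentiableOn ℂ k (ball 0 R)) (hg : DifferentiableOn ℂ g (ball 0 R))
    (hg1 : ∀ z ∈ closedBall (0 : ℂ) 1, ‖g z‖ ≤ 1) :
    ∫ z in closedBall (0 : ℂ) 1, rho z * (‖deriv g z‖ ^ 2 * rmod t k z) ≤
      3 * ∫ θ in (-π)..π, rmod t k (cis θ) := by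
  have hU : IsOpen (ball (0 : ℂ) R) := isOpen_ball
  have hK := contDiffOn_rmod (n := 2) ht hU hk
  have hG := contDiffOn_normSq (n := 2) hU hg
  have := integral_rho_le_of_lap ht hR hk (u := fun z => normSq (g z) * rmod t k z)
    (c := fun z => ‖deriv g z‖ ^ 2 * rmod t k z) (b := 1 / 3) (B := 1) (hG.mul hK)
    (((hg.deriv hU).continuousOn.norm.pow 2).mul hK.continuousOn) (by norm_num)
    (fun z _ => mul_nonneg (normSq_nonneg _) (rmod_pos ht k z).le)
    (fun θ => by
      have h1 := hg1 (cis θ) (by simp)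
      rw [normSq_eq_norm_sq]
      have := rmod_pos ht k (cis θ)
      gcongr
      nlinarith [norm_nonneg (g (cis θ))])
    (fun z hz => by
      have hz' := closedBall_subset_of_one_lt hR hz
      rw [lap_mul hU hG hK hz', lap_normSq hU hg hz', normSq_eq_norm_sq, normSq_eq_norm_sq]
      have hgd := hg.differentiableAt (hU.mem_nhds hz')
      have h1 := gr_normSq_self hgd
      rw [gr, ← pow_two, ← pow_two, normSq_eq_norm_sq, normSq_eq_norm_sq] at h1
      have h2 := abs_gr_le (F := fun z => normSq (g z)) (G := rmod t k) (z := z)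
        (b := 2 * ‖g z‖ * ‖deriv g z‖) (c := ‖deriv k z‖)
        (by positivity) (by positivity) (by rw [h1]; apply le_of_eq; ring) (gr_rmod_le ht hU hk hz')
      have h3 := lap_rmod_ge ht hU hk hz'
      have hp := rmod_pos ht k z
      have h4 := hg1 z hz
      set K := rmod t k z
      set b := ‖deriv k z‖ ^ 2 / K with hb
      have hb0 : 0 ≤ b := by positivity
      have hkb : ‖deriv k z‖ ^ 2 = b * K := by rw [hb]; field_simp
      have h5 := (abs_le.1 h2).1
      have h6 : ‖g z‖ ^ 2 * b ≤ ‖g z‖ ^ 2 * lap (rmod t k) z := by gcongr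
      have h7 : ‖g z‖ ^ 2 * b ≤ b := by
        have : ‖g z‖ ^ 2 ≤ 1 := by nlinarith [norm_nonneg (g z)]
        nlinarith
      have h8 : 4 * ‖g z‖ * ‖deriv g z‖ * ‖deriv k z‖ ≤
          3 * (‖deriv g z‖ ^ 2 * K) + 4 / 3 * (‖g z‖ ^ 2 * b) := by
        have q : (4 * ‖g z‖ * ‖deriv g z‖ * ‖deriv k z‖) ^ 2 ≤
            (3 * (‖deriv g z‖ ^ 2 * K) + 4 / 3 * (‖g z‖ ^ 2 * b)) ^ 2 := by
          have : (4 * ‖g z‖ * ‖deriv g z‖ * ‖deriv k z‖) ^ 2 =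
              16 * (‖g z‖ ^ 2 * b) * (‖deriv g z‖ ^ 2 * K) := by
            have : (4 * ‖g z‖ * ‖deriv g z‖ * ‖deriv k z‖) ^ 2 =
              16 * ‖g z‖ ^ 2 * ‖deriv g z‖ ^ 2 * ‖deriv k z‖ ^ 2 := by ring
            rw [this, hkb]; ring
          rw [this]
          nlinarith [sq_nonneg (3 * (‖deriv g z‖ ^ 2 * K) - 4 / 3 * (‖g z‖ ^ 2 * b))]
        exact (abs_le_of_sq_le_sq' q (by positivity)).2
      linarith)
  refine this.trans ?_
  have : 0 ≤ ∫ θ in (-π)..π, rmod t k (cis θ) :=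
    intervalIntegral.integral_nonneg (by linarith [Real.pi_pos]) fun θ _ => (rmod_pos ht k _).le
  nlinarith

lemma integral_grad_sq_mul_rmod_le (ht : 0 < t) (hR : 1 < R) (hM : 0 ≤ M)
    (hk : DifferentiableOn ℂ k (ball 0 R)) (hV : ContDiffOn ℝ 2 V (ball 0 R))
    (hV1 : ∀ z ∈ closedBall (0 : ℂ) 1, -M ≤ V z) (hV0 : ∀ z ∈ closedBall (0 : ℂ) 1, V z ≤ 0)
    (hVl : ∀ z ∈ closedBall (0 : ℂ) 1, 0 ≤ lap V z) :
    ∫ z in closedBall (0 : ℂ) 1, rho z * ((dX V z ^ 2 + dY V z ^ 2) * rmod t k z) ≤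
      10 * M ^ 2 * ∫ θ in (-π)..π, rmod t k (cis θ) := by
  have hU : IsOpen (ball (0 : ℂ) R) := isOpen_ball
  have hK := contDiffOn_rmod (n := 2) ht hU hk
  have hV1' := hV.of_le (m := 1) (by norm_num)
  have hS : ContDiffOn ℝ 2 (fun z => V z + M) (ball 0 R) := hV.add contDiffOn_const
  have eX : ∀ w ∈ ball (0 : ℂ) R, dX (fun z => V z + M) w = dX V w := fun w hw => by
    rw [dX_add (ContDiffOn.diffAt hV two_ne_zero hU hw) (by simp), dX_const, add_zero]
  have eY : ∀ w ∈ ball (0 : ℂ) R, dY (fun z => V z + M) w = dY V w := fun w hw => by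
    rw [dY_add (ContDiffOn.diffAt hV two_ne_zero hU hw) (by simp), dY_const, add_zero]
  have hS2 := hS.mul hS
  have := integral_rho_le_of_lap ht hR hk (u := fun z => ((V z + M) * (V z + M)) * rmod t k z)
    (c := fun z => (dX V z ^ 2 + dY V z ^ 2) * rmod t k z) (b := 4 * M ^ 2) (B := M ^ 2)
    (hS2.mul hK)
    ((((continuousOn_dX hU hV1').pow 2).add ((continuousOn_dY hU hV1').pow 2)).mul hK.continuousOn)
    (by positivity)
    (fun z _ => mul_nonneg (mul_self_nonneg _) (rmod_pos ht k z).le)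
    (fun θ => by
      have h1 := hV1 (cis θ) (by simp)
      have h2 := hV0 (cis θ) (by simp)
      have := rmod_pos ht k (cis θ)
      gcongr
      nlinarith)
    (fun z hz => by
      have hz' := closedBall_subset_of_one_lt hR hz
      have dS := ContDiffOn.diffAt hS two_ne_zero hU hz'
      have lS : lap (fun z => V z + M) z = lap V z := by
        rw [lap, lap, dX_congr (Filter.eventually_of_mem (hU.mem_nhds hz') eX),
          dY_congr (Filter.eventually_of_mem (hU.mem_nhds hz') eY)]
      rw [lap_mul hU hS2 hK hz', lap_mul hU hS hS hz', lS]
      have g1 : gr (fun z => (V z + M) * (V z + M)) (rmod t k) z =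
          2 * (V z + M) * gr V (rmod t k) z := by
        rw [gr, gr, dX_mul dS dS, dY_mul dS dS, eX z hz', eY z hz']; ring
      have g2 : gr (fun z => V z + M) (fun z => V z + M) z = dX V z ^ 2 + dY V z ^ 2 := by
        rw [gr, eX z hz', eY z hz']; ring
      rw [g1, g2]
      have a1 := hV1 z hz
      have a2 := hV0 z hz
      have a3 := hVl z hz
      set N := dX V z ^ 2 + dY V z ^ 2 with hN
      have hN0 : 0 ≤ N := by positivity
      have h2 := abs_gr_le (F := V) (G := rmod t k) (z := z)
        (b := √N) (c := ‖deriv k z‖)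
        (by positivity) (by positivity) (by rw [Real.sq_sqrt hN0]) (gr_rmod_le ht hU hk hz')
      have h3 := lap_rmod_ge ht hU hk hz'
      have hp := rmod_pos ht k z
      set K := rmod t k z
      set b := ‖deriv k z‖ ^ 2 / K with hb
      have hb0 : 0 ≤ b := by positivity
      have hkb : ‖deriv k z‖ ^ 2 = b * K := by rw [hb]; field_simp
      have h5 := (abs_le.1 h2).1
      have s0 : 0 ≤ V z + M := by linarith
      have h6 : 0 ≤ (V z + M) * (V z + M) * lap (rmod t k) z :=
        mul_nonneg (mul_self_nonneg _) (hb0.trans h3)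
      have h7 : 0 ≤ (V z + M) * lap V z := mul_nonneg s0 a3
      have h8 : 4 * M * (√N * ‖deriv k z‖) ≤ N * K + 4 * M ^ 2 * b := by
        refine (abs_le_of_sq_le_sq' ?_ (by positivity)).2
        have : (4 * M * (√N * ‖deriv k z‖)) ^ 2 = 16 * M ^ 2 * N * (b * K) := by
          rw [← hkb, mul_pow, mul_pow √N, Real.sq_sqrt hN0]; ring
        rw [this]
        nlinarith [sq_nonneg (N * K - 4 * M ^ 2 * b)]
      have h9 : (V z + M) * (√N * ‖deriv k z‖) ≤ M * (√N * ‖deriv k z‖) := by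
        gcongr; linarith
      have h10 : -((V z + M) * (√N * ‖deriv k z‖)) ≤ (V z + M) * gr V (rmod t k) z := by
        nlinarith
      nlinarith)
  refine this.trans (le_of_eq (by ring))

end integrals

end

section

lemma fderiv_mul_apply {A : Type*} [NormedCommRing A] [NormedAlgebra ℝ A] {F G : ℂ → A} {z : ℂ}
    (hF : DifferentiableAt ℝ F z) (hG : DifferentiableAt ℝ G z) (v : ℂ) :
    fderiv ℝ (fun w => F w * G w) z v = fderiv ℝ F z v * G z + F z * fderiv ℝ G z v := by
  rw [fderiv_fun_mul hF hG]
  simp only [_root_.add_apply, _root_.smul_apply, smul_eq_mul]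
  ring

/-- Length of the vector `(P, W)`. -/
noncomputable def hyp (P W : ℂ → ℝ) (z : ℂ) : ℝ := √(P z * P z + W z * W z)

section hyp

variable {P W : ℂ → ℝ} {U : Set ℂ} {z : ℂ}

lemma hyp_sq (P W : ℂ → ℝ) (z : ℂ) : hyp P W z ^ 2 = P z ^ 2 + W z ^ 2 := by
  rw [hyp, Real.sq_sqrt (by nlinarith [sq_nonneg (P z), sq_nonneg (W z)])]; ring

lemma hyp_pos (h : 0 < W z) : 0 < hyp P W z := by
  rw [hyp]; apply Real.sqrt_pos.2; nlinarith [sq_nonneg (P z)]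

lemma abs_le_hyp (P W : ℂ → ℝ) (z : ℂ) : |P z| ≤ hyp P W z := by
  apply abs_le_of_sq_le_sq _ (Real.sqrt_nonneg _)
  rw [← hyp, hyp_sq]; nlinarith [sq_nonneg (W z)]

lemma le_hyp (P W : ℂ → ℝ) (z : ℂ) : W z ≤ hyp P W z := by
  refine (abs_le_of_sq_le_sq' ?_ (Real.sqrt_nonneg _)).2
  rw [← hyp, hyp_sq]; nlinarith [sq_nonneg (P z)]

lemma contDiffOn_hyp {n : ℕ∞ω} (hP : ContDiffOn ℝ n P U) (hW : ContDiffOn ℝ n W U)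
    (h : ∀ w ∈ U, 0 < W w) : ContDiffOn ℝ n (hyp P W) U :=
  contDiffOn_sqrt ((hP.mul hP).add (hW.mul hW)) fun w hw => by
    have := h w hw
    nlinarith [mul_self_nonneg (P w)]

lemma hyp_mul_fderiv (hU : IsOpen U) (hP : ContDiffOn ℝ 2 P U) (hW : ContDiffOn ℝ 2 W U)
    (h : ∀ w ∈ U, 0 < W w) (hz : z ∈ U) (v : ℂ) :
    hyp P W z * fderiv ℝ (hyp P W) z v = P z * fderiv ℝ P z v + W z * fderiv ℝ W z v := by
  have hs := ContDiffOn.diffAt (contDiffOn_hyp hP hW h) two_ne_zero hU hz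
  have dP := ContDiffOn.diffAt hP two_ne_zero hU hz
  have dW := ContDiffOn.diffAt hW two_ne_zero hU hz
  have h1 := fderiv_mul_apply hs hs v
  have h2 : (fun w => hyp P W w * hyp P W w) = fun w => P w * P w + W w * W w := by
    funext w; linarith [hyp_sq P W w]
  rw [h2, fderiv_fun_add (dP.fun_mul dP) (dW.fun_mul dW), _root_.add_apply,
    fderiv_mul_apply dP dP, fderiv_mul_apply dW dW] at h1
  linarith

lemma hyp_mul_lap (hU : IsOpen U) (hP : ContDiffOn ℝ 2 P U) (hW : ContDiffOn ℝ 2 W U)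
    (h : ∀ w ∈ U, 0 < W w) (hz : z ∈ U) :
    hyp P W z ^ 3 * lap (hyp P W) z = (P z * dX W z - W z * dX P z) ^ 2 +
      (P z * dY W z - W z * dY P z) ^ 2 + hyp P W z ^ 2 * (P z * lap P z + W z * lap W z) := by
  have hX : hyp P W z * dX (hyp P W) z = P z * dX P z + W z * dX W z :=
    hyp_mul_fderiv hU hP hW h hz 1
  have hY : hyp P W z * dY (hyp P W) z = P z * dY P z + W z * dY W z :=
    hyp_mul_fderiv hU hP hW h hz I
  have hs := contDiffOn_hyp hP hW h
  have h1 := lap_mul hU hs hs hz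
  have h2 : (fun w => hyp P W w * hyp P W w) = fun w => P w * P w + W w * W w := by
    funext w; linarith [hyp_sq P W w]
  have e1 : ∀ w ∈ U, dX (fun w => P w * P w + W w * W w) w =
      dX (fun w => P w * P w) w + dX (fun w => W w * W w) w := fun w hw =>
    dX_add (ContDiffOn.diffAt (hP.mul hP) two_ne_zero hU hw)
      (ContDiffOn.diffAt (hW.mul hW) two_ne_zero hU hw)
  have e2 : ∀ w ∈ U, dY (fun w => P w * P w + W w * W w) w =
      dY (fun w => P w * P w) w + dY (fun w => W w * W w) w := fun w hw =>
    dY_add (ContDiffOn.diffAt (hP.mul hP) two_ne_zero hU hw)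
      (ContDiffOn.diffAt (hW.mul hW) two_ne_zero hU hw)
  have e3 : lap (fun w => P w * P w + W w * W w) z =
      lap (fun w => P w * P w) z + lap (fun w => W w * W w) z := by
    have d1 := fun {F : ℂ → ℝ} (hF : ContDiffOn ℝ 2 F U) =>
      ContDiffOn.diffAt (contDiffOn_dX (m := 1) hU hF (by norm_num)) one_ne_zero hU hz
    have d2 := fun {F : ℂ → ℝ} (hF : ContDiffOn ℝ 2 F U) =>
      ContDiffOn.diffAt (contDiffOn_dY (m := 1) hU hF (by norm_num)) one_ne_zero hU hz
    have q1 := dX_add (d1 (hP.mul hP)) (d1 (hW.mul hW))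
    have q2 := dY_add (d2 (hP.mul hP)) (d2 (hW.mul hW))
    rw [lap, lap, lap, dX_congr (Filter.eventually_of_mem (hU.mem_nhds hz) e1),
      dY_congr (Filter.eventually_of_mem (hU.mem_nhds hz) e2)]
    exact (congrArg₂ (· + ·) q1 q2).trans (by ring_nf)
  rw [h2, e3, lap_mul hU hP hP hz, lap_mul hU hW hW hz] at h1
  have h3 : hyp P W z ^ 2 * gr (hyp P W) (hyp P W) z =
      (P z * dX P z + W z * dX W z) ^ 2 + (P z * dY P z + W z * dY W z) ^ 2 := by
    rw [← hX, ← hY, gr]; ring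
  have h4 := hyp_sq P W z
  have h5 : hyp P W z ^ 3 * lap (hyp P W) z = hyp P W z ^ 2 * (P z * lap P z + W z * lap W z) +
    (P z ^ 2 + W z ^ 2) * (gr P P z + gr W W z) - hyp P W z ^ 2 * gr (hyp P W) (hyp P W) z := by
    rw [← h4]; linear_combination (-hyp P W z ^ 2 / 2) * h1
  rw [h5, h3, gr, gr]; ring

/-- Directional derivative of the argument of `(P, W)` -/
noncomputable def darg (P W : ℂ → ℝ) (z v : ℂ) : ℝ :=
  (P z * fderiv ℝ W z v - W z * fderiv ℝ P z v) / hyp P W z ^ 2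

lemma lap_hyp (hU : IsOpen U) (hP : ContDiffOn ℝ 2 P U) (hW : ContDiffOn ℝ 2 W U)
    (h : ∀ w ∈ U, 0 < W w) (hz : z ∈ U) :
    lap (hyp P W) z = hyp P W z * (darg P W z 1 ^ 2 + darg P W z I ^ 2) +
      (P z / hyp P W z) * lap P z + (W z / hyp P W z) * lap W z := by
  have h1 := hyp_mul_lap hU hP hW h hz
  have hp := hyp_pos (P := P) (h z hz)
  have e1 : darg P W z 1 = (P z * dX W z - W z * dX P z) / hyp P W z ^ 2 := rfl
  have e2 : darg P W z I = (P z * dY W z - W z * dY P z) / hyp P W z ^ 2 := rfl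
  rw [e1, e2]
  field_simp
  linear_combination h1

lemma fderiv_div_hyp (hU : IsOpen U) (hP : ContDiffOn ℝ 2 P U) (hW : ContDiffOn ℝ 2 W U)
    (h : ∀ w ∈ U, 0 < W w) (hz : z ∈ U) (v : ℂ) :
    |fderiv ℝ (fun w => P w / hyp P W w) z v| ≤ |darg P W z v| ∧
      |fderiv ℝ (fun w => W w / hyp P W w) z v| ≤ |darg P W z v| := by
  have hR := hyp_mul_fderiv hU hP hW h hz v
  have hs := ContDiffOn.diffAt (contDiffOn_hyp hP hW h) two_ne_zero hU hz
  have dP := ContDiffOn.diffAt hP two_ne_zero hU hz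
  have dW := ContDiffOn.diffAt hW two_ne_zero hU hz
  have hp := hyp_pos (P := P) (h z hz)
  have key : ∀ {F : ℂ → ℝ}, DifferentiableAt ℝ F z →
      fderiv ℝ (fun w => F w / hyp P W w) z v * hyp P W z +
        F z / hyp P W z * fderiv ℝ (hyp P W) z v = fderiv ℝ F z v := by
    intro F hF
    have h1 := fderiv_mul_apply (F := fun w => F w / hyp P W w) (hF.mul (hs.inv hp.ne')) hs v
    rw [← h1]
    congr 1
    apply Filter.EventuallyEq.fderiv_eq
    filter_upwards [hU.mem_nhds hz] with w hw
    exact div_mul_cancel₀ _ (hyp_pos (h w hw)).ne'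
  have h4 := hyp_sq P W z
  have k1 := key dP
  have k2 := key dW
  have a1 : fderiv ℝ (fun w => P w / hyp P W w) z v = -(W z / hyp P W z) * darg P W z v := by
    rw [darg]; field_simp
    field_simp at k1
    have : hyp P W z ^ 3 * fderiv ℝ (fun w => P w / hyp P W w) z v =
      hyp P W z ^ 2 * fderiv ℝ P z v - P z * (P z * fderiv ℝ P z v + W z * fderiv ℝ W z v) := by
      rw [← hR]; linear_combination hyp P W z * k1
    rw [mul_comm, this, h4]; ring
  have a2 : fderiv ℝ (fun w => W w / hyp P W w) z v = (P z / hyp P W z) * darg P W z v := by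
    rw [darg]; field_simp
    field_simp at k2
    have : hyp P W z ^ 3 * fderiv ℝ (fun w => W w / hyp P W w) z v =
      hyp P W z ^ 2 * fderiv ℝ W z v - W z * (P z * fderiv ℝ P z v + W z * fderiv ℝ W z v) := by
      rw [← hR]; linear_combination hyp P W z * k2
    rw [mul_comm, this, h4]; ring
  have b1 : |P z / hyp P W z| ≤ 1 := by
    rw [abs_div, abs_of_pos hp, div_le_one hp]; exact abs_le_hyp P W z
  have b2 : |W z / hyp P W z| ≤ 1 := by
    rw [abs_div, abs_of_pos hp, div_le_one hp, abs_of_pos (h z hz)]; exact le_hyp P W z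
  constructor
  · rw [a1, abs_mul, abs_neg]; exact mul_le_of_le_one_left (abs_nonneg _) b2
  · rw [a2, abs_mul]; exact mul_le_of_le_one_left (abs_nonneg _) b1

end hyp

end

section

section bounds

variable {h k : ℂ → ℂ} {U : Set ℂ} {z : ℂ} {t : ℝ}

lemma fderiv_hol_apply (hh : DifferentiableAt ℂ h z) (v : ℂ) :
    fderiv ℝ h z v = v * deriv h z := by
  rw [hh.fderiv_restrictScalars ℝ]
  simp [fderiv_eq_smul_deriv]

lemma norm_fderiv_conj_hol (hh : DifferentiableAt ℂ h z) (v : ℂ) :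
    ‖fderiv ℝ (fun w => conj (h w)) z v‖ = ‖v‖ * ‖deriv h z‖ := by
  have : fderiv ℝ (fun w => conj (h w)) z = (conjCLE : ℂ →L[ℝ] ℂ).comp (fderiv ℝ h z) :=
    ((conjCLE : ℂ →L[ℝ] ℂ).hasFDerivAt.comp z (differentiableAt_real hh).hasFDerivAt).fderiv
  rw [this]
  simp [fderiv_hol_apply hh]

lemma abs_fderiv_normSq_hol_le (hh : DifferentiableAt ℂ h z) (v : ℂ) :
    |fderiv ℝ (fun w => normSq (h w)) z v| ≤ 2 * (‖h z‖ * (‖v‖ * ‖deriv h z‖)) := by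
  have e : (fun w => normSq (h w)) = fun w => ((h w).re * (h w).re + (h w).im * (h w).im) := by
    funext w; rw [normSq_apply]
  have hd := differentiableAt_real hh
  have hr : HasFDerivAt (fun w => (h w).re) (reCLM.comp (fderiv ℝ h z)) z :=
    reCLM.hasFDerivAt.comp z hd.hasFDerivAt
  have hi : HasFDerivAt (fun w => (h w).im) (imCLM.comp (fderiv ℝ h z)) z :=
    imCLM.hasFDerivAt.comp z hd.hasFDerivAt
  have key : fderiv ℝ (fun w => normSq (h w)) z v = 2 * (conj (h z) * (v * deriv h z)).re := by
    rw [e, fderiv_fun_add (hr.differentiableAt.fun_mul hr.differentiableAt)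
      (hi.differentiableAt.fun_mul hi.differentiableAt), _root_.add_apply,
      fderiv_mul_apply hr.differentiableAt hr.differentiableAt,
      fderiv_mul_apply hi.differentiableAt hi.differentiableAt, hr.fderiv, hi.fderiv]
    simp [fderiv_hol_apply hh]; ring
  rw [key, abs_mul, abs_two]
  gcongr
  refine (abs_re_le_norm _).trans ?_
  rw [norm_mul, norm_mul, RCLike.norm_conj]

lemma abs_fderiv_rmod_le (ht : 0 < t) (hU : IsOpen U) (hk : DifferentiableOn ℂ k U) (hz : z ∈ U)
    (v : ℂ) : |fderiv ℝ (rmod t k) z v| ≤ ‖v‖ * ‖deriv k z‖ := by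
  have hs := ContDiffOn.diffAt (contDiffOn_rmod (n := 1) ht hU hk) one_ne_zero hU hz
  have h1 := fderiv_mul_apply hs hs v
  have e : (fun w => rmod t k w * rmod t k w) = fun w => normSq (k w) + t ^ 2 := by
    funext w; rw [← pow_two, rmod_sq, normSq_eq_norm_sq]
  rw [e, fderiv_add_const] at h1
  have h2 := abs_fderiv_normSq_hol_le (hk.differentiableAt (hU.mem_nhds hz)) v
  have hp := rmod_pos ht k z
  have h3 := norm_le_rmod ht k z
  have h4 : 2 * rmod t k z * |fderiv ℝ (rmod t k) z v| ≤
      2 * rmod t k z * (‖v‖ * ‖deriv k z‖) := by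
    calc _ = |2 * rmod t k z * fderiv ℝ (rmod t k) z v| := by
          rw [abs_mul, abs_of_pos (by positivity : 0 < 2 * rmod t k z)]
      _ ≤ 2 * (‖k z‖ * (‖v‖ * ‖deriv k z‖)) := by
          rw [h1] at h2; convert h2 using 2; ring
      _ ≤ 2 * (rmod t k z * (‖v‖ * ‖deriv k z‖)) := by gcongr
      _ = _ := by ring
  exact le_of_mul_le_mul_left h4 (by positivity)

lemma norm_fderiv_prod_le {V b n : ℂ → ℝ} {w : ℂ → ℂ} {v : ℂ} {M B B' N w0 w1 : ℝ}
    (hV : DifferentiableAt ℝ V z) (hb : DifferentiableAt ℝ b z) (hn : DifferentiableAt ℝ n z)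
    (hw : DifferentiableAt ℝ w z) (hM : |V z| ≤ M) (hB : |b z| ≤ B) (hn1 : |n z| ≤ 1)
    (hB' : |fderiv ℝ b z v| ≤ B') (hN : |fderiv ℝ n z v| ≤ N) (hw0 : ‖w z‖ ≤ w0)
    (hw1 : ‖fderiv ℝ w z v‖ ≤ w1) :
    ‖fderiv ℝ (fun ζ => ((V ζ * b ζ * n ζ : ℝ) : ℂ) * w ζ) z v‖ ≤
      (|fderiv ℝ V z v| * B + M * B' + |V z| * |b z| * N) * w0 + M * B * w1 := by
  have h1 := (hV.fun_mul hb).fun_mul hn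
  have h2 : fderiv ℝ (fun ζ => ((V ζ * b ζ * n ζ : ℝ) : ℂ)) z =
      ofRealCLM.comp (fderiv ℝ (fun ζ => V ζ * b ζ * n ζ) z) :=
    (ofRealCLM.hasFDerivAt.comp z h1.hasFDerivAt).fderiv
  have h3 : DifferentiableAt ℝ (fun ζ => ((V ζ * b ζ * n ζ : ℝ) : ℂ)) z :=
    (ofRealCLM.hasFDerivAt.comp z h1.hasFDerivAt).differentiableAt
  have a1 := abs_nonneg (V z); have a2 := abs_nonneg (b z); have a3 := abs_nonneg (n z)
  have a4 := abs_nonneg (fderiv ℝ V z v); have a5 := abs_nonneg (fderiv ℝ b z v)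
  have a6 := abs_nonneg (fderiv ℝ n z v); have a7 := norm_nonneg (w z)
  have a8 := norm_nonneg (fderiv ℝ w z v)
  have hM0 := a1.trans hM
  have hB0 := a2.trans hB
  rw [fderiv_mul_apply h3 hw, h2]
  simp only [ContinuousLinearMap.comp_apply, ofRealCLM_apply]
  rw [fderiv_mul_apply (hV.fun_mul hb) hn, fderiv_mul_apply hV hb]
  refine (norm_add_le _ _).trans (add_le_add ?_ ?_)
  · rw [norm_mul, norm_real, Real.norm_eq_abs]
    have b1 := a5.trans hB'
    have b2 := a6.trans hN
    refine mul_le_mul ?_ hw0 (norm_nonneg _) (by positivity)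
    refine (abs_add_le _ _).trans (add_le_add ?_ ?_)
    · rw [abs_mul]
      refine (mul_le_of_le_one_right (abs_nonneg _) hn1).trans ?_
      refine (abs_add_le _ _).trans ?_
      rw [abs_mul, abs_mul]
      gcongr
    · rw [abs_mul, abs_mul]; gcongr
  · rw [norm_mul, norm_real, Real.norm_eq_abs, abs_mul, abs_mul]
    refine mul_le_mul ?_ hw1 (norm_nonneg _) (by positivity)
    exact (mul_le_of_le_one_right (by positivity) hn1).trans (by gcongr)

lemma norm_prod_le {V b n : ℂ → ℝ} {w : ℂ → ℂ} {M B w0 : ℝ}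
    (hM : |V z| ≤ M) (hB : |b z| ≤ B) (hn1 : |n z| ≤ 1) (hw0 : ‖w z‖ ≤ w0) :
    ‖((V z * b z * n z : ℝ) : ℂ) * w z‖ ≤ M * B * w0 := by
  rw [norm_mul, norm_real, Real.norm_eq_abs, abs_mul, abs_mul]
  have hM0 := (abs_nonneg _).trans hM
  have hB0 := (abs_nonneg _).trans hB
  refine mul_le_mul ?_ hw0 (norm_nonneg _) (by positivity)
  exact (mul_le_of_le_one_right (by positivity) hn1).trans (by gcongr)

end bounds

/-- Hypotheses for the Lyapunov function estimate. -/
structure Lyap (R t M x0 : ℝ) (g k : ℂ → ℂ) (V P : ℂ → ℝ) : Prop where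
  hR : 1 < R
  ht : 0 < t
  hM : 0 ≤ M
  hx0 : 0 ≤ x0
  hg : DifferentiableOn ℂ g (ball 0 R)
  hk : DifferentiableOn ℂ k (ball 0 R)
  hg1 : ∀ z ∈ closedBall (0 : ℂ) 1, ‖g z‖ ≤ 1
  hV : ContDiffOn ℝ 2 V (ball 0 R)
  hV1 : ∀ z ∈ closedBall (0 : ℂ) 1, -M ≤ V z
  hV0 : ∀ z ∈ closedBall (0 : ℂ) 1, V z ≤ 0
  hVl : ∀ z ∈ closedBall (0 : ℂ) 1, 0 ≤ lap V z
  hP : ContDiffOn ℝ 2 P (ball 0 R)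
  hPX : ∀ z ∈ closedBall (0 : ℂ) 1, x0 < normSq (g z) → dX P z = -(k z / g z).re
  hPY : ∀ z ∈ closedBall (0 : ℂ) 1, x0 < normSq (g z) → dY P z = (k z / g z).im
  hPl : ∀ z ∈ closedBall (0 : ℂ) 1, x0 < normSq (g z) → lap P z = 0
  hW : ∀ z ∈ ball (0 : ℂ) R, 0 < rho z * rmod t k z + t

/-- The weight `W = ρ K + t`. -/
noncomputable def wgt (t : ℝ) (k : ℂ → ℂ) (z : ℂ) : ℝ := rho z * rmod t k z + t

/-- The cutoff `max (|g|² - x₀) 0`. -/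
noncomputable def cut (x0 : ℝ) (g : ℂ → ℂ) (z : ℂ) : ℝ := max (normSq (g z) - x0) 0

namespace Lyap

variable {R t M x0 : ℝ} {g k : ℂ → ℂ} {V P : ℂ → ℝ} {z : ℂ}

lemma contDiffOn_wgt (H : Lyap R t M x0 g k V P) : ContDiffOn ℝ 2 (wgt t k) (ball 0 R) :=
  (contDiff_rho.contDiffOn.mul (contDiffOn_rmod H.ht isOpen_ball H.hk)).add contDiffOn_const

lemma contDiffOn_g2 (H : Lyap R t M x0 g k V P) :
    ContDiffOn ℝ 2 (fun z => normSq (g z) - x0) (ball 0 R) :=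
  (contDiffOn_normSq isOpen_ball H.hg).sub contDiffOn_const

lemma cut_nonneg (x0 : ℝ) (g : ℂ → ℂ) (z : ℂ) : 0 ≤ cut x0 g z := le_max_right _ _

lemma cut_le_one (H : Lyap R t M x0 g k V P) (hz : z ∈ closedBall (0 : ℂ) 1) :
    cut x0 g z ≤ 1 := by
  have := H.hg1 z hz
  have := H.hx0
  rw [cut, normSq_eq_norm_sq]
  exact max_le (by nlinarith [norm_nonneg (g z)]) zero_le_one

lemma fderiv_cut_pow (H : Lyap R t M x0 g k V P) (hz : z ∈ ball (0 : ℂ) R) (n : ℕ) (v : ℂ) :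
    fderiv ℝ (fun z => cut x0 g z ^ (n + 2)) z v =
      (n + 2) * cut x0 g z ^ (n + 1) * fderiv ℝ (fun z => normSq (g z)) z v := by
  have h1 := ContDiffOn.diffAt H.contDiffOn_g2 two_ne_zero isOpen_ball hz
  have h2 := (hasDerivAt_max_pow n (normSq (g z) - x0)).comp_hasFDerivAt z h1.hasFDerivAt
  have h3 : fderiv ℝ (fun z => cut x0 g z ^ (n + 2)) z = _ := h2.fderiv
  rw [h3]
  simp [fderiv_sub_const, cut]

lemma contDiffOn_cut_cube (H : Lyap R t M x0 g k V P) :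
    ContDiffOn ℝ 2 (fun z => cut x0 g z ^ 3) (ball 0 R) :=
  contDiff_pc.comp_contDiffOn H.contDiffOn_g2

lemma contDiff_max_sq : ContDiff ℝ 1 (fun x : ℝ => max x 0 ^ 2) := by
  rw [contDiff_one_iff_deriv]
  have h : ∀ x, HasDerivAt (fun x : ℝ => max x 0 ^ 2) (2 * max x 0) x := fun x => by
    simpa using hasDerivAt_max_pow 0 x
  refine ⟨fun x => (h x).differentiableAt, ?_⟩
  rw [funext fun x => (h x).deriv]
  fun_prop

lemma contDiffOn_cut_sq (H : Lyap R t M x0 g k V P) :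
    ContDiffOn ℝ 1 (fun z => cut x0 g z ^ 2) (ball 0 R) :=
  contDiff_max_sq.comp_contDiffOn (H.contDiffOn_g2.of_le (by norm_num))

lemma lap_cut_cube (H : Lyap R t M x0 g k V P) (hz : z ∈ ball (0 : ℂ) R) :
    0 ≤ lap (fun z => cut x0 g z ^ 3) z := by
  have h := lap_comp (φ := fun x => pc (x - x0)) (φ1 := fun x => 3 * max (x - x0) 0 ^ 2)
    (d := 6 * max (normSq (g z) - x0) 0) isOpen_ball
    (contDiffOn_normSq isOpen_ball H.hg) hz
    (fun w _ => (hasDerivAt_pc _).comp_sub_const _ _)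
    ((hasDerivAt_pc' _).comp_sub_const _ _)
  have e : (fun z => cut x0 g z ^ 3) = fun z => pc (normSq (g z) - x0) := rfl
  rw [e, h, lap_normSq isOpen_ball H.hg hz, gr]
  have h1 := normSq_nonneg (deriv g z)
  have h2 : 0 ≤ max (normSq (g z) - x0) 0 := le_max_right _ _
  have h3 := mul_self_nonneg (dX (fun z => normSq (g z)) z)
  have h4 := mul_self_nonneg (dY (fun z => normSq (g z)) z)
  positivity

end Lyap

end

section

namespace Lyap

variable {R t M x0 : ℝ} {g k : ℂ → ℂ} {V P : ℂ → ℝ} {z : ℂ}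

lemma dX_wgt (H : Lyap R t M x0 g k V P) (hz : z ∈ ball (0 : ℂ) R) :
    dX (wgt t k) z = -2 * z.re * rmod t k z + rho z * dX (rmod t k) z := by
  have hK := ContDiffOn.diffAt (contDiffOn_rmod (n := 1) H.ht isOpen_ball H.hk) one_ne_zero
    isOpen_ball hz
  have h1 := dX_add (F := fun z => rho z * rmod t k z) (G := fun _ => t)
    ((differentiableAt_rho z).mul hK) (by simp)
  rw [dX_mul (differentiableAt_rho z) hK, dX_rho, dX_const, add_zero] at h1
  exact h1

lemma dY_wgt (H : Lyap R t M x0 g k V P) (hz : z ∈ ball (0 : ℂ) R) :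
    dY (wgt t k) z = -2 * z.im * rmod t k z + rho z * dY (rmod t k) z := by
  have hK := ContDiffOn.diffAt (contDiffOn_rmod (n := 1) H.ht isOpen_ball H.hk) one_ne_zero
    isOpen_ball hz
  have h1 := dY_add (F := fun z => rho z * rmod t k z) (G := fun _ => t)
    ((differentiableAt_rho z).mul hK) (by simp)
  rw [dY_mul (differentiableAt_rho z) hK, dY_rho, dY_const, add_zero] at h1
  exact h1

lemma lap_wgt (H : Lyap R t M x0 g k V P) (hz : z ∈ ball (0 : ℂ) R) :
    lap (wgt t k) z = -4 * rmod t k z + 2 * gr rho (rmod t k) z + rho z * lap (rmod t k) z := by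
  have hK := contDiffOn_rmod (n := 2) H.ht isOpen_ball H.hk
  have hr := (contDiff_rho (n := 2)).contDiffOn (s := ball (0 : ℂ) R)
  have h1 := lap_mul isOpen_ball hr hK hz
  rw [lap_rho] at h1
  have e1 : ∀ w ∈ ball (0 : ℂ) R, dX (wgt t k) w = dX (fun z => rho z * rmod t k z) w :=
    fun w hw => by
      have := dX_add (F := fun z => rho z * rmod t k z) (G := fun _ => t)
        (ContDiffOn.diffAt (hr.mul hK) two_ne_zero isOpen_ball hw) (by simp)
      rw [dX_const, add_zero] at this
      exact this
  have e2 : ∀ w ∈ ball (0 : ℂ) R, dY (wgt t k) w = dY (fun z => rho z * rmod t k z) w :=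
    fun w hw => by
      have := dY_add (F := fun z => rho z * rmod t k z) (G := fun _ => t)
        (ContDiffOn.diffAt (hr.mul hK) two_ne_zero isOpen_ball hw) (by simp)
      rw [dY_const, add_zero] at this
      exact this
  have e3 : lap (wgt t k) z = lap (fun z => rho z * rmod t k z) z := by
    rw [lap, lap, dX_congr (Filter.eventually_of_mem (isOpen_ball.mem_nhds hz) e1),
      dY_congr (Filter.eventually_of_mem (isOpen_ball.mem_nhds hz) e2)]
  rw [e3, h1]; ring

lemma mul_gr_rho_rmod (H : Lyap R t M x0 g k V P) (hz : z ∈ ball (0 : ℂ) R) :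
    rmod t k z * gr rho (rmod t k) z = -2 * (conj (k z) * z * deriv k z).re := by
  have h1 := rmod_mul_dX H.ht isOpen_ball H.hk hz
  have h2 := rmod_mul_dY H.ht isOpen_ball H.hk hz
  rw [gr, dX_rho, dY_rho]
  have : conj (k z) * z * deriv k z = z * (conj (k z) * deriv k z) := by ring
  rw [this, mul_re, ← h1, ← neg_eq_iff_eq_neg.2 h2]; ring

lemma dX_cut_cube (H : Lyap R t M x0 g k V P) (hz : z ∈ ball (0 : ℂ) R) :
    dX (fun z => cut x0 g z ^ 3) z = 6 * cut x0 g z ^ 2 * (conj (g z) * deriv g z).re := by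
  have := H.fderiv_cut_pow hz 1 1
  norm_num at this
  rw [dX, this]
  have := dX_normSq_hol (H.hg.differentiableAt (isOpen_ball.mem_nhds hz))
  rw [dX] at this
  rw [this]; ring

lemma dY_cut_cube (H : Lyap R t M x0 g k V P) (hz : z ∈ ball (0 : ℂ) R) :
    dY (fun z => cut x0 g z ^ 3) z = -6 * cut x0 g z ^ 2 * (conj (g z) * deriv g z).im := by
  have := H.fderiv_cut_pow hz 1 I
  norm_num at this
  rw [dY, this]
  have := dY_normSq_hol (H.hg.differentiableAt (isOpen_ball.mem_nhds hz))
  rw [dY] at this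
  rw [this]; ring

lemma gr_cut_rho (H : Lyap R t M x0 g k V P) (hz : z ∈ ball (0 : ℂ) R) :
    gr (fun z => cut x0 g z ^ 3) rho z =
      -12 * cut x0 g z ^ 2 * (conj (g z) * z * deriv g z).re := by
  rw [gr, H.dX_cut_cube hz, H.dY_cut_cube hz, dX_rho, dY_rho]
  have : conj (g z) * z * deriv g z = z * (conj (g z) * deriv g z) := by ring
  rw [this, mul_re z]; ring

lemma lt_of_cut_ne_zero (h : cut x0 g z ≠ 0) : x0 < normSq (g z) := by
  by_contra hc
  exact h (max_eq_right (by linarith))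

lemma gr_cut_P (H : Lyap R t M x0 g k V P) (hz : z ∈ closedBall (0 : ℂ) 1) :
    gr (fun z => cut x0 g z ^ 3) P z =
      -6 * cut x0 g z ^ 2 * (conj (k z) * deriv g z).re := by
  have hz' := closedBall_subset_of_one_lt H.hR hz
  rw [gr, H.dX_cut_cube hz', H.dY_cut_cube hz']
  by_cases hc : cut x0 g z = 0
  · simp [hc]
  have hx := lt_of_cut_ne_zero hc
  have hg0 : g z ≠ 0 := by
    intro h0; rw [h0, map_zero] at hx; linarith [H.hx0]
  rw [H.hPX z hz hx, H.hPY z hz hx]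
  have : conj (k z) * deriv g z = conj (k z / g z) * (conj (g z) * deriv g z) := by
    rw [map_div₀]; field_simp [(map_ne_zero (starRingEnd ℂ)).2 hg0]
  rw [this, mul_re (conj (k z / g z)), conj_re, conj_im]
  ring

lemma cut_mul_lap_P (H : Lyap R t M x0 g k V P) (hz : z ∈ closedBall (0 : ℂ) 1) :
    cut x0 g z ^ 3 * lap P z = 0 := by
  by_cases hc : cut x0 g z = 0
  · simp [hc]
  · rw [H.hPl z hz (lt_of_cut_ne_zero hc), mul_zero]

lemma hyp_mul_gr (H : Lyap R t M x0 g k V P) (hz : z ∈ ball (0 : ℂ) R) (F : ℂ → ℝ) :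
    hyp P (wgt t k) z * gr F (hyp P (wgt t k)) z =
      P z * gr F P z + wgt t k z * gr F (wgt t k) z := by
  have hX : hyp P (wgt t k) z * dX (hyp P (wgt t k)) z = _ :=
    hyp_mul_fderiv isOpen_ball H.hP H.contDiffOn_wgt H.hW hz 1
  have hY : hyp P (wgt t k) z * dY (hyp P (wgt t k)) z = _ :=
    hyp_mul_fderiv isOpen_ball H.hP H.contDiffOn_wgt H.hW hz I
  simp only [gr, dX, dY] at hX hY ⊢
  linear_combination fderiv ℝ F z 1 * hX + fderiv ℝ F z I * hY

lemma hyp_pos' (H : Lyap R t M x0 g k V P) (hz : z ∈ ball (0 : ℂ) R) :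
    0 < hyp P (wgt t k) z := hyp_pos (H.hW z hz)

lemma V_mul_lap_le (H : Lyap R t M x0 g k V P) (hz : z ∈ closedBall (0 : ℂ) 1) :
    V z * lap (fun z => cut x0 g z ^ 3 * hyp P (wgt t k) z) z ≤
      -12 * (((V z * cut x0 g z ^ 2 * (P z / hyp P (wgt t k) z) : ℝ) : ℂ) *
        conj (k z) * deriv g z).re
      - 24 * (((V z * cut x0 g z ^ 2 * (wgt t k z / hyp P (wgt t k) z) : ℝ) : ℂ) *
        (conj (g z) * z * rmod t k z) * deriv g z).re
      - 4 * (((V z * cut x0 g z ^ 3 * (wgt t k z / hyp P (wgt t k) z) : ℝ) : ℂ) *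
        (conj (k z) * z / rmod t k z) * deriv k z).re
      + 2 * (V z * (wgt t k z / hyp P (wgt t k) z) * rho z *
        gr (fun z => cut x0 g z ^ 3) (rmod t k) z)
      - 4 * (V z * cut x0 g z ^ 3 * (wgt t k z / hyp P (wgt t k) z) * rmod t k z)
      + V z * cut x0 g z ^ 3 * hyp P (wgt t k) z *
        (darg P (wgt t k) z 1 ^ 2 + darg P (wgt t k) z I ^ 2) := by
  have hz' := closedBall_subset_of_one_lt H.hR hz
  have hW := H.contDiffOn_wgt
  have hs := contDiffOn_hyp H.hP hW H.hW
  have hRp := H.hyp_pos' hz'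
  have hKp := rmod_pos H.ht k z
  have hWp : 0 < wgt t k z := H.hW z hz'
  have hm := cut_nonneg x0 g z
  have hV0 := H.hV0 z hz
  have r1 := H.hyp_mul_gr hz' (fun z => cut x0 g z ^ 3)
  have r2 : gr (fun z => cut x0 g z ^ 3) (wgt t k) z = rmod t k z *
      gr (fun z => cut x0 g z ^ 3) rho z + rho z * gr (fun z => cut x0 g z ^ 3) (rmod t k) z := by
    rw [gr, gr, gr, H.dX_wgt hz', H.dY_wgt hz', dX_rho, dY_rho]; ring
  rw [H.gr_cut_P hz, r2, H.gr_cut_rho hz'] at r1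
  have r3 := H.mul_gr_rho_rmod hz'
  have l1 := H.lap_cut_cube hz'
  have l2 : 0 ≤ lap (rmod t k) z :=
    le_trans (by positivity) (lap_rmod_ge H.ht isOpen_ball H.hk hz')
  have l3 := H.cut_mul_lap_P hz
  have lh := lap_hyp isOpen_ball H.hP hW H.hW hz'
  rw [H.lap_wgt hz'] at lh
  rw [lap_mul isOpen_ball H.contDiffOn_cut_cube hs hz']
  have e1 : ∀ (r : ℝ) (w q : ℂ), ((r : ℂ) * w * q).re = r * (w * q).re := by
    intro r w q; rw [mul_assoc, re_ofReal_mul]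
  rw [e1, e1, e1]
  have e2 : (conj (g z) * z * (rmod t k z : ℂ) * deriv g z).re =
      rmod t k z * (conj (g z) * z * deriv g z).re := by
    rw [← re_ofReal_mul]; congr 1; ring
  have e3 : (conj (k z) * z / (rmod t k z : ℂ) * deriv k z).re =
      -(gr rho (rmod t k) z) / 2 := by
    have : conj (k z) * z / (rmod t k z : ℂ) * deriv k z =
      (((rmod t k z)⁻¹ : ℝ) : ℂ) * (conj (k z) * z * deriv k z) := by push_cast; ring
    rw [this, re_ofReal_mul]
    field_simp
    linarith
  rw [e2, e3]
  have g1 : gr (fun z => cut x0 g z ^ 3) (hyp P (wgt t k)) z =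
      (P z / hyp P (wgt t k) z) * (-6 * cut x0 g z ^ 2 * (conj (k z) * deriv g z).re) +
      (wgt t k z / hyp P (wgt t k) z) * (rmod t k z *
      (-12 * cut x0 g z ^ 2 * (conj (g z) * z * deriv g z).re) +
      rho z * gr (fun z => cut x0 g z ^ 3) (rmod t k) z) := by
    rw [div_mul_eq_mul_div, div_mul_eq_mul_div, ← add_div, eq_div_iff hRp.ne']
    linear_combination r1
  rw [g1]
  set m := cut x0 g z
  set Rr := hyp P (wgt t k) z
  set n1 := wgt t k z / Rr with hn1
  have n1p : 0 ≤ n1 := by positivity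
  have f1 : V z * (Rr * lap (fun z => cut x0 g z ^ 3) z) ≤ 0 :=
    mul_nonpos_of_nonpos_of_nonneg hV0 (by positivity)
  have f2 : V z * (m ^ 3 * n1 * (rho z * lap (rmod t k) z)) ≤ 0 :=
    mul_nonpos_of_nonpos_of_nonneg hV0
      (mul_nonneg (by positivity) (mul_nonneg (rho_nonneg hz) l2))
  rw [lh]
  linear_combination f1 + f2 + (V z * (P z / Rr)) * l3

end Lyap

end

section

lemma lyap_numeric {M v r m g j a b p q : ℝ} (hM : 0 ≤ M) (hv : 0 ≤ v) (hvM : v ≤ M) (hr : 0 ≤ r)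
    (hr1 : r ≤ 1) (hm : 0 ≤ m) (hm1 : m ≤ 1) :
    12 * (r * g * (2 * M + ((a + M * (4 * g) + v * m ^ 2 * p + M * j) +
        (b + M * (4 * g) + v * m ^ 2 * q + M * j)) / 2)) +
      24 * (r * g * (2 * M + ((a + M * (4 * g) + v * m ^ 2 * p + M * (g + 1 + j)) +
        (b + M * (4 * g) + v * m ^ 2 * q + M * (g + 1 + j))) / 2)) +
      4 * (r * j * (2 * M + ((a + M * (6 * g) + v * m ^ 3 * p + M * (2 * j + 1)) +
        (b + M * (6 * g) + v * m ^ 3 * q + M * (2 * j + 1))) / 2)) +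
      12 * (M * r * g * j) + 4 * M - v * m ^ 3 * r * (p ^ 2 + q ^ 2) ≤
    1000 * (1 + M) * (1 + r * g ^ 2 + r * (a ^ 2 + b ^ 2) + r * j ^ 2) := by
  have key : ∀ x y : ℝ, r * (x * y) ≤ r * x ^ 2 / 2 + r * y ^ 2 / 2 := fun x y => by
    nlinarith [mul_nonneg hr (sq_nonneg (x - y))]
  have keyM : ∀ x y : ℝ, M * (r * (x * y)) ≤ M * (r * x ^ 2) / 2 + M * (r * y ^ 2) / 2 :=
    fun x y => by nlinarith [mul_le_mul_of_nonneg_left (key x y) hM]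
  have hMr : M * r ≤ M := mul_le_of_le_one_right hM hr1
  have A1 : ∀ p : ℝ, v * (r * (g * (m ^ 2 * p))) * 18 ≤
      v * m ^ 3 * r * p ^ 2 / 2 + 162 * (M * (r * g ^ 2)) := fun p => by
    have h1 : 0 ≤ v * r * m * (m * p - 18 * g) ^ 2 := by positivity
    have h2 : v * m * (r * g ^ 2) ≤ M * (r * g ^ 2) := by
      apply mul_le_mul_of_nonneg_right _ (by positivity)
      nlinarith
    linear_combination h1 / 2 + 162 * h2
  have A2 : ∀ p : ℝ, v * (r * (j * (m ^ 3 * p))) * 2 ≤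
      v * m ^ 3 * r * p ^ 2 / 2 + 2 * (M * (r * j ^ 2)) := fun p => by
    have h1 : 0 ≤ v * r * m ^ 3 * (p - 2 * j) ^ 2 := by positivity
    have h3 : m ^ 3 ≤ 1 := pow_le_one₀ hm hm1
    have h2 : v * m ^ 3 * (r * j ^ 2) ≤ M * (r * j ^ 2) := by
      apply mul_le_mul_of_nonneg_right _ (by positivity)
      nlinarith
    linear_combination h1 / 2 + 2 * h2
  have B1 := key g a
  have B2 := key g b
  have B3 := key j a
  have B4 := key j b
  have C1 := keyM g 1
  have C2 := keyM j 1
  have C3 := keyM g j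
  have D1 := A1 p
  have D2 := A1 q
  have D3 := A2 p
  have D4 := A2 q
  have n1 : 0 ≤ r * g ^ 2 := by positivity
  have n2 : 0 ≤ r * a ^ 2 := by positivity
  have n3 : 0 ≤ r * b ^ 2 := by positivity
  have n4 : 0 ≤ r * j ^ 2 := by positivity
  have m1 := mul_nonneg hM n1
  have m2 := mul_nonneg hM n2
  have m3 := mul_nonneg hM n3
  have m4 := mul_nonneg hM n4
  nlinarith

namespace Lyap

variable {R t M x0 : ℝ} {g k : ℂ → ℂ} {V P : ℂ → ℝ} {z : ℂ}

lemma abs_n0_le (P W : ℂ → ℝ) (z : ℂ) : |P z / hyp P W z| ≤ 1 := by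
  have h0 : 0 ≤ hyp P W z := Real.sqrt_nonneg _
  rw [abs_div, abs_of_nonneg h0]
  exact div_le_one_of_le₀ (abs_le_hyp P W z) (Real.sqrt_nonneg _)

lemma abs_n1_le (H : Lyap R t M x0 g k V P) (hz : z ∈ ball (0 : ℂ) R) :
    |wgt t k z / hyp P (wgt t k) z| ≤ 1 := by
  have h0 : 0 < wgt t k z := H.hW z hz
  rw [abs_div, abs_of_pos (H.hyp_pos' hz), abs_of_pos h0]
  exact div_le_one_of_le₀ (le_hyp P _ z) (Real.sqrt_nonneg _)

lemma abs_fderiv_cut (H : Lyap R t M x0 g k V P) (hz : z ∈ closedBall (0 : ℂ) 1) (n : ℕ) {v : ℂ}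
    (hv : ‖v‖ ≤ 1) :
    |fderiv ℝ (fun z => cut x0 g z ^ (n + 2)) z v| ≤ 2 * (n + 2) * ‖deriv g z‖ := by
  have hz' := closedBall_subset_of_one_lt H.hR hz
  have h1 := abs_fderiv_normSq_hol_le (H.hg.differentiableAt (isOpen_ball.mem_nhds hz')) v
  have h2 := H.hg1 z hz
  have h3 := cut_nonneg x0 g z
  have h4 := H.cut_le_one hz
  rw [H.fderiv_cut_pow hz', abs_mul, abs_of_nonneg (by positivity)]
  calc _ ≤ (n + 2) * 1 * (2 * (1 * (1 * ‖deriv g z‖))) := by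
        gcongr
        · exact pow_le_one₀ h3 h4
        · exact h1.trans (by gcongr)
    _ = _ := by ring

/-- The first of the three vector fields appearing in the estimate. -/
noncomputable def psi1 (t x0 : ℝ) (g k : ℂ → ℂ) (V P : ℂ → ℝ) (z : ℂ) : ℂ :=
  ((V z * cut x0 g z ^ 2 * (P z / hyp P (wgt t k) z) : ℝ) : ℂ) * conj (k z)

/-- The second vector field appearing in the estimate. -/
noncomputable def psi2 (t x0 : ℝ) (g k : ℂ → ℂ) (V P : ℂ → ℝ) (z : ℂ) : ℂ :=
  ((V z * cut x0 g z ^ 2 * (wgt t k z / hyp P (wgt t k) z) : ℝ) : ℂ) *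
    (conj (g z) * z * rmod t k z)

/-- The third vector field appearing in the estimate. -/
noncomputable def psi3 (t x0 : ℝ) (g k : ℂ → ℂ) (V P : ℂ → ℝ) (z : ℂ) : ℂ :=
  ((V z * cut x0 g z ^ 3 * (wgt t k z / hyp P (wgt t k) z) : ℝ) : ℂ) *
    (conj (k z) * z / rmod t k z)

lemma contDiffOn_ofReal {u : ℂ → ℝ} {n : ℕ∞ω} {U : Set ℂ} (hu : ContDiffOn ℝ n u U) :
    ContDiffOn ℝ n (fun z => (u z : ℂ)) U :=
  ofRealCLM.contDiff.comp_contDiffOn hu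

lemma contDiffOn_conj_hol {h : ℂ → ℂ} {n : ℕ∞ω} {U : Set ℂ} (hU : IsOpen U)
    (hh : DifferentiableOn ℂ h U) : ContDiffOn ℝ n (fun z => conj (h z)) U :=
  (conjCLE : ℂ →L[ℝ] ℂ).contDiff.comp_contDiffOn (contDiffOn_hol hU hh)

lemma contDiffOn_n0 (H : Lyap R t M x0 g k V P) :
    ContDiffOn ℝ 1 (fun z => P z / hyp P (wgt t k) z) (ball 0 R) :=
  (H.hP.of_le (by norm_num)).div ((contDiffOn_hyp H.hP H.contDiffOn_wgt H.hW).of_le (by norm_num))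
    fun _ hz => (H.hyp_pos' hz).ne'

lemma contDiffOn_n1 (H : Lyap R t M x0 g k V P) :
    ContDiffOn ℝ 1 (fun z => wgt t k z / hyp P (wgt t k) z) (ball 0 R) :=
  (H.contDiffOn_wgt.of_le (by norm_num)).div
    ((contDiffOn_hyp H.hP H.contDiffOn_wgt H.hW).of_le (by norm_num))
    fun _ hz => (H.hyp_pos' hz).ne'

lemma contDiffOn_w2 (H : Lyap R t M x0 g k V P) :
    ContDiffOn ℝ 1 (fun z => conj (g z) * z * (rmod t k z : ℂ)) (ball 0 R) :=
  ((contDiffOn_conj_hol isOpen_ball H.hg).mul contDiffOn_id).mul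
    (contDiffOn_ofReal (contDiffOn_rmod H.ht isOpen_ball H.hk))

lemma contDiffOn_w3 (H : Lyap R t M x0 g k V P) :
    ContDiffOn ℝ 1 (fun z => conj (k z) * z / (rmod t k z : ℂ)) (ball 0 R) :=
  ((contDiffOn_conj_hol isOpen_ball H.hk).mul contDiffOn_id).mul
    ((contDiffOn_ofReal (contDiffOn_rmod H.ht isOpen_ball H.hk)).inv
      fun z _ => ofReal_ne_zero.2 (rmod_pos H.ht k z).ne')

lemma contDiffOn_psi1 (H : Lyap R t M x0 g k V P) :
    ContDiffOn ℝ 1 (psi1 t x0 g k V P) (ball 0 R) :=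
  (contDiffOn_ofReal (((H.hV.of_le (by norm_num)).mul H.contDiffOn_cut_sq).mul
    H.contDiffOn_n0)).mul (contDiffOn_conj_hol isOpen_ball H.hk)

lemma contDiffOn_psi2 (H : Lyap R t M x0 g k V P) :
    ContDiffOn ℝ 1 (psi2 t x0 g k V P) (ball 0 R) :=
  (contDiffOn_ofReal (((H.hV.of_le (by norm_num)).mul H.contDiffOn_cut_sq).mul
    H.contDiffOn_n1)).mul H.contDiffOn_w2

lemma contDiffOn_psi3 (H : Lyap R t M x0 g k V P) :
    ContDiffOn ℝ 1 (psi3 t x0 g k V P) (ball 0 R) :=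
  (contDiffOn_ofReal (((H.hV.of_le (by norm_num)).mul
    (H.contDiffOn_cut_cube.of_le (by norm_num))).mul H.contDiffOn_n1)).mul H.contDiffOn_w3

lemma abs_V_le (H : Lyap R t M x0 g k V P) (hz : z ∈ closedBall (0 : ℂ) 1) : |V z| ≤ M :=
  abs_le.2 ⟨H.hV1 z hz, (H.hV0 z hz).trans H.hM⟩

section pt

lemma abs_cut_pow_le (H : Lyap R t M x0 g k V P) (hz : z ∈ closedBall (0 : ℂ) 1)
    (n : ℕ) : |cut x0 g z ^ n| ≤ 1 := by
  rw [abs_of_nonneg (pow_nonneg (cut_nonneg _ _ _) _)]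
  exact pow_le_one₀ (cut_nonneg _ _ _) (H.cut_le_one hz)

lemma norm_psi1_le (H : Lyap R t M x0 g k V P) (hz : z ∈ closedBall (0 : ℂ) 1)
    : ‖psi1 t x0 g k V P z‖ ≤ M * 1 * rmod t k z :=
  norm_prod_le (b := fun z => cut x0 g z ^ 2) (n := fun z => P z / hyp P (wgt t k) z)
    (w := fun z => conj (k z)) (H.abs_V_le hz) (H.abs_cut_pow_le hz 2) (abs_n0_le _ _ _)
    (by rw [RCLike.norm_conj]; exact norm_le_rmod H.ht k z)

lemma norm_z_le (hz : z ∈ closedBall (0 : ℂ) 1) : ‖z‖ ≤ 1 := by simpa using hz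

lemma norm_w2_le (H : Lyap R t M x0 g k V P) (hz : z ∈ closedBall (0 : ℂ) 1)
    : ‖conj (g z) * z * (rmod t k z : ℂ)‖ ≤ rmod t k z := by
  have h1 := H.hg1 z hz
  have h2 := norm_z_le hz
  have hp := rmod_pos H.ht k z
  rw [norm_mul, norm_mul, RCLike.norm_conj, norm_real, Real.norm_eq_abs, abs_of_pos hp]
  refine mul_le_of_le_one_left hp.le (mul_le_one₀ h1 (norm_nonneg _) h2)

lemma norm_w3_le (H : Lyap R t M x0 g k V P) (hz : z ∈ closedBall (0 : ℂ) 1)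
    : ‖conj (k z) * z / (rmod t k z : ℂ)‖ ≤ 1 := by
  have h2 := norm_z_le hz
  have hp := rmod_pos H.ht k z
  rw [norm_div, norm_mul, RCLike.norm_conj, norm_real, Real.norm_eq_abs, abs_of_pos hp]
  refine div_le_one_of_le₀ ?_ hp.le
  exact (mul_le_of_le_one_right (norm_nonneg _) h2).trans (norm_le_rmod H.ht k z)

lemma norm_psi2_le (H : Lyap R t M x0 g k V P) (hz : z ∈ closedBall (0 : ℂ) 1)
    : ‖psi2 t x0 g k V P z‖ ≤ M * 1 * rmod t k z :=
  norm_prod_le (b := fun z => cut x0 g z ^ 2) (n := fun z => wgt t k z / hyp P (wgt t k) z)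
    (w := fun z => conj (g z) * z * (rmod t k z : ℂ)) (H.abs_V_le hz) (H.abs_cut_pow_le hz 2)
    (H.abs_n1_le (closedBall_subset_of_one_lt H.hR hz)) (H.norm_w2_le hz)

lemma norm_psi3_le (H : Lyap R t M x0 g k V P) (hz : z ∈ closedBall (0 : ℂ) 1)
    : ‖psi3 t x0 g k V P z‖ ≤ M * 1 * 1 :=
  norm_prod_le (b := fun z => cut x0 g z ^ 3) (n := fun z => wgt t k z / hyp P (wgt t k) z)
    (w := fun z => conj (k z) * z / (rmod t k z : ℂ)) (H.abs_V_le hz) (H.abs_cut_pow_le hz 3)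
    (H.abs_n1_le (closedBall_subset_of_one_lt H.hR hz)) (H.norm_w3_le hz)

lemma norm_fderiv_psi1_le (H : Lyap R t M x0 g k V P) (hz : z ∈ closedBall (0 : ℂ) 1)
    {v : ℂ} (hv : ‖v‖ ≤ 1) :
    ‖fderiv ℝ (psi1 t x0 g k V P) z v‖ ≤
      (|fderiv ℝ V z v| * 1 + M * (4 * ‖deriv g z‖) +
        |V z| * |cut x0 g z ^ 2| * |darg P (wgt t k) z v|) * rmod t k z +
      M * 1 * ‖deriv k z‖ := by
  have hz' := closedBall_subset_of_one_lt H.hR hz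
  refine norm_fderiv_prod_le (b := fun z => cut x0 g z ^ 2)
    (n := fun z => P z / hyp P (wgt t k) z) (w := fun z => conj (k z))
    (ContDiffOn.diffAt H.hV two_ne_zero isOpen_ball hz')
    (ContDiffOn.diffAt H.contDiffOn_cut_sq one_ne_zero isOpen_ball hz')
    (ContDiffOn.diffAt H.contDiffOn_n0 one_ne_zero isOpen_ball hz')
    (ContDiffOn.diffAt (contDiffOn_conj_hol (n := 1) isOpen_ball H.hk) one_ne_zero isOpen_ball hz')
    (H.abs_V_le hz) (H.abs_cut_pow_le hz 2) (abs_n0_le _ _ _) ?_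
    (fderiv_div_hyp isOpen_ball H.hP H.contDiffOn_wgt H.hW hz' v).1
    (by rw [RCLike.norm_conj]; exact norm_le_rmod H.ht k z) ?_
  · have := H.abs_fderiv_cut hz 0 hv
    norm_num at this
    exact this
  · rw [norm_fderiv_conj_hol (H.hk.differentiableAt (isOpen_ball.mem_nhds hz'))]
    exact mul_le_of_le_one_left (norm_nonneg _) hv

lemma norm_fderiv_w2_le (H : Lyap R t M x0 g k V P) (hz : z ∈ closedBall (0 : ℂ) 1)
    {v : ℂ} (hv : ‖v‖ ≤ 1) :
    ‖fderiv ℝ (fun z => conj (g z) * z * (rmod t k z : ℂ)) z v‖ ≤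
      ‖deriv g z‖ * rmod t k z + rmod t k z + ‖deriv k z‖ := by
  have hz' := closedBall_subset_of_one_lt H.hR hz
  have d1 := ContDiffOn.diffAt (contDiffOn_conj_hol (n := 1) isOpen_ball H.hg) one_ne_zero
    isOpen_ball hz'
  have d2 : DifferentiableAt ℝ (fun z : ℂ => z) z := differentiableAt_id
  have d3 := ContDiffOn.diffAt (contDiffOn_rmod (n := 1) H.ht isOpen_ball H.hk) one_ne_zero
    isOpen_ball hz'
  have d4 : HasFDerivAt (fun z => (rmod t k z : ℂ)) (ofRealCLM.comp (fderiv ℝ (rmod t k) z)) z :=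
    ofRealCLM.hasFDerivAt.comp z d3.hasFDerivAt
  rw [fderiv_mul_apply (d1.fun_mul d2) d4.differentiableAt, fderiv_mul_apply d1 d2, d4.fderiv]
  have h1 := norm_fderiv_conj_hol (H.hg.differentiableAt (isOpen_ball.mem_nhds hz')) v
  have h2 := abs_fderiv_rmod_le H.ht isOpen_ball H.hk hz' v
  have h3 := H.hg1 z hz
  have h4 := norm_z_le hz
  have hp := rmod_pos H.ht k z
  simp only [fderiv_fun_id, ContinuousLinearMap.comp_apply, ofRealCLM_apply,
    ContinuousLinearMap.coe_id', id_eq]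
  refine (norm_add_le _ _).trans (add_le_add ?_ ?_)
  · rw [norm_mul, norm_real, Real.norm_eq_abs, abs_of_pos hp, ← add_one_mul]
    gcongr
    refine (norm_add_le _ _).trans (add_le_add ?_ ?_)
    · rw [norm_mul, h1]
      exact (mul_le_of_le_one_right (by positivity) h4).trans
        (mul_le_of_le_one_left (norm_nonneg _) hv)
    · rw [norm_mul, RCLike.norm_conj]; exact mul_le_one₀ h3 (norm_nonneg _) hv
  · rw [norm_mul, norm_mul, RCLike.norm_conj, norm_real, Real.norm_eq_abs]
    refine (mul_le_of_le_one_left (abs_nonneg _) (mul_le_one₀ h3 (norm_nonneg _) h4)).trans ?_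
    exact h2.trans (mul_le_of_le_one_left (norm_nonneg _) hv)

lemma norm_fderiv_w3_le (H : Lyap R t M x0 g k V P) (hz : z ∈ closedBall (0 : ℂ) 1)
    {v : ℂ} (hv : ‖v‖ ≤ 1) :
    ‖fderiv ℝ (fun z => conj (k z) * z / (rmod t k z : ℂ)) z v‖ ≤
      2 * (‖deriv k z‖ / rmod t k z) + 1 := by
  have hz' := closedBall_subset_of_one_lt H.hR hz
  have d1 := ContDiffOn.diffAt (contDiffOn_conj_hol (n := 1) isOpen_ball H.hk) one_ne_zero
    isOpen_ball hz'
  have d2 : DifferentiableAt ℝ (fun z : ℂ => z) z := differentiableAt_id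
  have d3 := ContDiffOn.diffAt (contDiffOn_rmod (n := 1) H.ht isOpen_ball H.hk) one_ne_zero
    isOpen_ball hz'
  have d4 : HasFDerivAt (fun z => (rmod t k z : ℂ)) (ofRealCLM.comp (fderiv ℝ (rmod t k) z)) z :=
    ofRealCLM.hasFDerivAt.comp z d3.hasFDerivAt
  have d5 := ContDiffOn.diffAt H.contDiffOn_w3 one_ne_zero isOpen_ball hz'
  have h1 := norm_fderiv_conj_hol (H.hk.differentiableAt (isOpen_ball.mem_nhds hz')) v
  have h2 := abs_fderiv_rmod_le H.ht isOpen_ball H.hk hz' v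
  have h3 := norm_le_rmod H.ht k z
  have h4 := norm_z_le hz
  have h6 := H.norm_w3_le hz
  have hp := rmod_pos H.ht k z
  have key := fderiv_mul_apply d5 d4.differentiableAt v
  have e : (fun w => conj (k w) * w / (rmod t k w : ℂ) * (rmod t k w : ℂ)) =
      fun w => conj (k w) * w := by
    funext w; exact div_mul_cancel₀ _ (ofReal_ne_zero.2 (rmod_pos H.ht k w).ne')
  rw [e, fderiv_mul_apply d1 d2, d4.fderiv] at key
  simp only [fderiv_fun_id, ContinuousLinearMap.comp_apply, ofRealCLM_apply,
    ContinuousLinearMap.coe_id', id_eq] at key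
  have h7 : ‖fderiv ℝ (fun z => conj (k z) * z / (rmod t k z : ℂ)) z v‖ * rmod t k z ≤
      2 * ‖deriv k z‖ + rmod t k z := by
    rw [← sub_eq_iff_eq_add] at key
    calc _ = ‖fderiv ℝ (fun z => conj (k z) * z / (rmod t k z : ℂ)) z v * (rmod t k z : ℂ)‖ := by
          rw [norm_mul, norm_real, Real.norm_eq_abs, abs_of_pos hp]
      _ ≤ (‖deriv k z‖ + rmod t k z) + ‖deriv k z‖ := by
        rw [← key]
        refine (norm_sub_le _ _).trans (add_le_add ((norm_add_le _ _).trans (add_le_add ?_ ?_)) ?_)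
        · rw [norm_mul, h1]
          exact (mul_le_of_le_one_right (by positivity) h4).trans
            (mul_le_of_le_one_left (norm_nonneg _) hv)
        · rw [norm_mul, RCLike.norm_conj]
          exact (mul_le_of_le_one_right (norm_nonneg _) hv).trans h3
        · rw [norm_mul, norm_real, Real.norm_eq_abs]
          exact (mul_le_of_le_one_left (abs_nonneg _) h6).trans
            (h2.trans (mul_le_of_le_one_left (norm_nonneg _) hv))
      _ = _ := by ring
  rw [← le_div_iff₀ hp] at h7
  refine h7.trans (le_of_eq ?_)
  field_simp

lemma norm_fderiv_psi2_le (H : Lyap R t M x0 g k V P) (hz : z ∈ closedBall (0 : ℂ) 1)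
    {v : ℂ} (hv : ‖v‖ ≤ 1) :
    ‖fderiv ℝ (psi2 t x0 g k V P) z v‖ ≤
      (|fderiv ℝ V z v| * 1 + M * (4 * ‖deriv g z‖) +
        |V z| * |cut x0 g z ^ 2| * |darg P (wgt t k) z v|) * rmod t k z +
      M * 1 * (‖deriv g z‖ * rmod t k z + rmod t k z + ‖deriv k z‖) := by
  have hz' := closedBall_subset_of_one_lt H.hR hz
  refine norm_fderiv_prod_le (b := fun z => cut x0 g z ^ 2)
    (n := fun z => wgt t k z / hyp P (wgt t k) z)
    (w := fun z => conj (g z) * z * (rmod t k z : ℂ))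
    (ContDiffOn.diffAt H.hV two_ne_zero isOpen_ball hz')
    (ContDiffOn.diffAt H.contDiffOn_cut_sq one_ne_zero isOpen_ball hz')
    (ContDiffOn.diffAt H.contDiffOn_n1 one_ne_zero isOpen_ball hz')
    (ContDiffOn.diffAt H.contDiffOn_w2 one_ne_zero isOpen_ball hz')
    (H.abs_V_le hz) (H.abs_cut_pow_le hz 2) (H.abs_n1_le hz') ?_
    (fderiv_div_hyp isOpen_ball H.hP H.contDiffOn_wgt H.hW hz' v).2
    (H.norm_w2_le hz) (H.norm_fderiv_w2_le hz hv)
  have := H.abs_fderiv_cut hz 0 hv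
  norm_num at this
  exact this

lemma norm_fderiv_psi3_le (H : Lyap R t M x0 g k V P) (hz : z ∈ closedBall (0 : ℂ) 1)
    {v : ℂ} (hv : ‖v‖ ≤ 1) :
    ‖fderiv ℝ (psi3 t x0 g k V P) z v‖ ≤
      (|fderiv ℝ V z v| * 1 + M * (6 * ‖deriv g z‖) +
        |V z| * |cut x0 g z ^ 3| * |darg P (wgt t k) z v|) * 1 +
      M * 1 * (2 * (‖deriv k z‖ / rmod t k z) + 1) := by
  have hz' := closedBall_subset_of_one_lt H.hR hz
  refine norm_fderiv_prod_le (b := fun z => cut x0 g z ^ 3)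
    (n := fun z => wgt t k z / hyp P (wgt t k) z)
    (w := fun z => conj (k z) * z / (rmod t k z : ℂ))
    (ContDiffOn.diffAt H.hV two_ne_zero isOpen_ball hz')
    (ContDiffOn.diffAt H.contDiffOn_cut_cube two_ne_zero isOpen_ball hz')
    (ContDiffOn.diffAt H.contDiffOn_n1 one_ne_zero isOpen_ball hz')
    (ContDiffOn.diffAt H.contDiffOn_w3 one_ne_zero isOpen_ball hz')
    (H.abs_V_le hz) (H.abs_cut_pow_le hz 3) (H.abs_n1_le hz') ?_
    (fderiv_div_hyp isOpen_ball H.hP H.contDiffOn_wgt H.hW hz' v).2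
    (H.norm_w3_le hz) (H.norm_fderiv_w3_le hz hv)
  have := H.abs_fderiv_cut hz 1 hv
  norm_num at this
  exact this

end pt

end Lyap

end

section

namespace Lyap

variable {R t M x0 : ℝ} {g k : ℂ → ℂ} {V P : ℂ → ℝ} {z : ℂ}

lemma abs_gr_cut_le (H : Lyap R t M x0 g k V P) (hz : z ∈ closedBall (0 : ℂ) 1) :
    |gr (fun z => cut x0 g z ^ 3) (rmod t k) z| ≤ 6 * ‖deriv g z‖ * ‖deriv k z‖ := by
  have hz' := closedBall_subset_of_one_lt H.hR hz
  have hd := H.hg.differentiableAt (isOpen_ball.mem_nhds hz')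
  refine abs_gr_le (by positivity) (by positivity) ?_ (gr_rmod_le H.ht isOpen_ball H.hk hz')
  have h1 : dX (fun z => cut x0 g z ^ 3) z = _ := H.fderiv_cut_pow hz' 1 1
  have h2 : dY (fun z => cut x0 g z ^ 3) z = _ := H.fderiv_cut_pow hz' 1 I
  have h3 : fderiv ℝ (fun z => normSq (g z)) z 1 = _ := dX_normSq_hol hd
  have h4 : fderiv ℝ (fun z => normSq (g z)) z I = _ := dY_normSq_hol hd
  rw [h1, h2, h3, h4]
  have e : ((starRingEnd ℂ) (g z) * deriv g z).re ^ 2 +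
      ((starRingEnd ℂ) (g z) * deriv g z).im ^ 2 = ‖g z‖ ^ 2 * ‖deriv g z‖ ^ 2 := by
    rw [← mul_pow, ← RCLike.norm_conj (g z), ← norm_mul, ← normSq_eq_norm_sq, normSq_apply]; ring
  have m0 := cut_nonneg x0 g z
  have m1 := H.cut_le_one hz
  have g1 := H.hg1 z hz
  have m4 : cut x0 g z ^ 4 ≤ 1 := pow_le_one₀ m0 m1
  have g2 : ‖g z‖ ^ 2 ≤ 1 := pow_le_one₀ (norm_nonneg _) g1
  have : cut x0 g z ^ 4 * ‖g z‖ ^ 2 ≤ 1 := mul_le_one₀ m4 (by positivity) g2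
  have key := mul_le_mul_of_nonneg_right this (sq_nonneg ‖deriv g z‖)
  generalize ((starRingEnd ℂ) (g z) * deriv g z).re = a at *
  generalize ((starRingEnd ℂ) (g z) * deriv g z).im = b at *
  push_cast
  linear_combination 36 * cut x0 g z ^ 4 * e + 36 * key

/-- The remainder in the averaged form of the pointwise estimate. -/
noncomputable def err (ψ q : ℂ → ℂ) (z : ℂ) : ℝ :=
  rho z * ‖deriv q z‖ * (2 * ‖ψ z‖ + (‖dX ψ z‖ + ‖dY ψ z‖) / 2)

lemma err_le {ψ q : ℂ → ℂ} {A B C : ℝ} (hz : z ∈ closedBall (0 : ℂ) 1) (h1 : ‖ψ z‖ ≤ A)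
    (h2 : ‖dX ψ z‖ ≤ B) (h3 : ‖dY ψ z‖ ≤ C) :
    err ψ q z ≤ rho z * ‖deriv q z‖ * (2 * A + (B + C) / 2) := by
  have := rho_nonneg hz
  rw [err]
  gcongr

lemma V_mul_lap_add_err_le (H : Lyap R t M x0 g k V P) (hz : z ∈ closedBall (0 : ℂ) 1) :
    V z * lap (fun z => cut x0 g z ^ 3 * hyp P (wgt t k) z) z +
        12 * (psi1 t x0 g k V P z * deriv g z).re + 24 * (psi2 t x0 g k V P z * deriv g z).re +
        4 * (psi3 t x0 g k V P z * deriv k z).re + 12 * err (psi1 t x0 g k V P) g z +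
        24 * err (psi2 t x0 g k V P) g z + 4 * err (psi3 t x0 g k V P) k z ≤
      1000 * (1 + M) * (rmod t k z + rho z * (‖deriv g z‖ ^ 2 * rmod t k z) +
        rho z * ((dX V z ^ 2 + dY V z ^ 2) * rmod t k z) +
        rho z * (‖deriv k z‖ ^ 2 / rmod t k z)) := by
  have hz' := closedBall_subset_of_one_lt H.hR hz
  have h0 : V z * lap (fun z => cut x0 g z ^ 3 * hyp P (wgt t k) z) z ≤
      -12 * (psi1 t x0 g k V P z * deriv g z).re - 24 * (psi2 t x0 g k V P z * deriv g z).re -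
      4 * (psi3 t x0 g k V P z * deriv k z).re + _ - _ + _ := H.V_mul_lap_le hz
  have a1 := H.norm_psi1_le hz
  have a2 := H.norm_psi2_le hz
  have a3 := H.norm_psi3_le hz
  have b1 : ‖dX (psi1 t x0 g k V P) z‖ ≤ _ := H.norm_fderiv_psi1_le hz (v := 1) (by simp)
  have b2 : ‖dX (psi2 t x0 g k V P) z‖ ≤ _ := H.norm_fderiv_psi2_le hz (v := 1) (by simp)
  have b3 : ‖dX (psi3 t x0 g k V P) z‖ ≤ _ := H.norm_fderiv_psi3_le hz (v := 1) (by simp)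
  have c1 : ‖dY (psi1 t x0 g k V P) z‖ ≤ _ := H.norm_fderiv_psi1_le hz (v := I) (by simp)
  have c2 : ‖dY (psi2 t x0 g k V P) z‖ ≤ _ := H.norm_fderiv_psi2_le hz (v := I) (by simp)
  have c3 : ‖dY (psi3 t x0 g k V P) z‖ ≤ _ := H.norm_fderiv_psi3_le hz (v := I) (by simp)
  have hr := rho_nonneg hz
  have hr1 := rho_le_one z
  have m0 := cut_nonneg x0 g z
  have m1 := H.cut_le_one hz
  have hK := rmod_pos H.ht k z
  have num := lyap_numeric (M := M) (v := |V z|) (r := rho z) (m := cut x0 g z) (g := ‖deriv g z‖)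
    (j := ‖deriv k z‖ / rmod t k z) (a := |dX V z|) (b := |dY V z|)
    (p := |darg P (wgt t k) z 1|) (q := |darg P (wgt t k) z I|) H.hM (abs_nonneg _) (H.abs_V_le hz)
    hr hr1 m0 m1
  have hgr := H.abs_gr_cut_le hz
  have hn1 := H.abs_n1_le hz'
  have hWpos : 0 < wgt t k z := H.hW z hz'
  have hWh := le_hyp P (wgt t k) z
  have hrW : rho z * rmod t k z ≤ wgt t k z := by rw [wgt]; linarith [H.ht]
  have hV := H.abs_V_le hz
  have hV0 : V z = -|V z| := by rw [abs_of_nonpos (H.hV0 z hz)]; ring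
  have hk' : ‖deriv k z‖ = ‖deriv k z‖ / rmod t k z * rmod t k z := by field_simp
  have hk2 : ‖deriv k z‖ ^ 2 / rmod t k z = (‖deriv k z‖ / rmod t k z) ^ 2 * rmod t k z := by
    field_simp
  rw [hk2]
  rw [← sq_abs (dX V z), ← sq_abs (dY V z)]
  simp only [abs_of_nonneg (pow_nonneg m0 _)] at b1 b2 b3 c1 c2 c3
  have d1 : 2 * (V z * (wgt t k z / hyp P (wgt t k) z) * rho z *
        gr (fun z => cut x0 g z ^ 3) (rmod t k) z) ≤
      12 * (M * rho z * ‖deriv g z‖ * ‖deriv k z‖) := by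
    have : |V z * (wgt t k z / hyp P (wgt t k) z) * rho z *
        gr (fun z => cut x0 g z ^ 3) (rmod t k) z| ≤ M * 1 * rho z *
        (6 * ‖deriv g z‖ * ‖deriv k z‖) := by
      rw [abs_mul, abs_mul, abs_mul, abs_of_nonneg hr]
      have := H.hM
      gcongr
    linarith [le_abs_self (V z * (wgt t k z / hyp P (wgt t k) z) * rho z *
        gr (fun z => cut x0 g z ^ 3) (rmod t k) z)]
  have d2 : -4 * (V z * cut x0 g z ^ 3 * (wgt t k z / hyp P (wgt t k) z) * rmod t k z) ≤
      4 * M * rmod t k z := by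
    have : |V z * cut x0 g z ^ 3 * (wgt t k z / hyp P (wgt t k) z) * rmod t k z| ≤
        M * 1 * 1 * rmod t k z := by
      rw [abs_mul, abs_mul, abs_mul, abs_of_pos hK]
      have := H.hM
      have := H.abs_cut_pow_le hz 3
      gcongr
    linarith [neg_le_abs (V z * cut x0 g z ^ 3 * (wgt t k z / hyp P (wgt t k) z) * rmod t k z)]
  have d3 : V z * cut x0 g z ^ 3 * hyp P (wgt t k) z *
        (darg P (wgt t k) z 1 ^ 2 + darg P (wgt t k) z I ^ 2) ≤
      -(|V z| * cut x0 g z ^ 3 * rho z * (|darg P (wgt t k) z 1| ^ 2 +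
        |darg P (wgt t k) z I| ^ 2)) * rmod t k z := by
    rw [sq_abs, sq_abs]
    have h1 : 0 ≤ |V z| * cut x0 g z ^ 3 *
      (darg P (wgt t k) z 1 ^ 2 + darg P (wgt t k) z I ^ 2) := by positivity
    have h2 := mul_le_mul_of_nonneg_left (hrW.trans hWh) h1
    nth_rewrite 1 [hV0]
    linarith
  obtain ⟨j, hj⟩ : ∃ j, j = ‖deriv k z‖ / rmod t k z := ⟨_, rfl⟩
  rw [← hj] at num hk' b3 c3 ⊢
  rw [hk'] at d1 b1 c1 b2 c2
  have e1 := err_le (q := g) hz a1 b1 c1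
  have e2 := err_le (q := g) hz a2 b2 c2
  have e3 := err_le (q := k) hz a3 b3 c3
  rw [hk'] at e3
  change _ ≤ _ * (_ + (((|dX V z| * _ + _ + _) * _ + _) + ((|dY V z| * _ + _ + _) * _ + _)) / 2)
    at e1 e2 e3
  have num' := mul_le_mul_of_nonneg_right num hK.le
  linear_combination num' + d1 + d2 + d3 + h0 + 12 * e1 + 24 * e2 + 4 * e3

lemma continuousOn_err {ψ q : ℂ → ℂ} (hψ : ContDiffOn ℝ 1 ψ (ball 0 R))
    (hq : DifferentiableOn ℂ q (ball 0 R)) : ContinuousOn (err ψ q) (ball 0 R) := by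
  have h1 := continuousOn_dX isOpen_ball hψ
  have h2 := continuousOn_dY isOpen_ball hψ
  have h3 := (hq.deriv isOpen_ball).continuousOn
  have h4 := hψ.continuousOn
  have h5 : ContinuousOn rho (ball 0 R) := (contDiff_rho (n := 1)).continuous.continuousOn
  unfold err
  fun_prop

lemma integral_re_add_err_nonneg (hR : 1 < R) {ψ q : ℂ → ℂ} (hψ : ContDiffOn ℝ 1 ψ (ball 0 R))
    (hq : DifferentiableOn ℂ q (ball 0 R)) :
    0 ≤ ∫ z in closedBall (0 : ℂ) 1, ((ψ z * deriv q z).re + err ψ q z) := by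
  have h := norm_integral_mul_hol_le hR hψ (hq.deriv isOpen_ball)
  have hc : ContinuousOn (fun z => ψ z * deriv q z) (ball 0 R) :=
    hψ.continuousOn.mul (hq.deriv isOpen_ball).continuousOn
  have hi := integrableOn_closedBall hR hc
  rw [integral_add (f := fun z => (ψ z * deriv q z).re)
    (integrableOn_closedBall hR (continuous_re.comp_continuousOn hc))
    (integrableOn_closedBall hR (continuousOn_err hψ hq))]
  have e : ∫ z in closedBall (0 : ℂ) 1, (ψ z * deriv q z).re =
      (∫ z in closedBall (0 : ℂ) 1, ψ z * deriv q z).re := by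
    have := reCLM.integral_comp_comm hi
    simpa using this
  simp only [err]
  rw [e]
  linarith [(abs_le.1 (abs_re_le_norm (∫ z in closedBall (0 : ℂ) 1, ψ z * deriv q z))).1]

lemma integral_add_four {u v w s : ℂ → ℝ} (hR : 1 < R) (hu : ContinuousOn u (ball 0 R))
    (hv : ContinuousOn v (ball 0 R)) (hw : ContinuousOn w (ball 0 R))
    (hs : ContinuousOn s (ball 0 R)) (a b c : ℝ) :
    ∫ z in closedBall (0 : ℂ) 1, (u z + a * v z + b * w z + c * s z) =
      (∫ z in closedBall (0 : ℂ) 1, u z) + a * (∫ z in closedBall (0 : ℂ) 1, v z) +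
        b * (∫ z in closedBall (0 : ℂ) 1, w z) + c * ∫ z in closedBall (0 : ℂ) 1, s z := by
  rw [integral_add, integral_add, integral_add, integral_const_mul, integral_const_mul,
    integral_const_mul]
  all_goals exact integrableOn_closedBall hR (by fun_prop)

lemma contDiffOn_prod (H : Lyap R t M x0 g k V P) :
    ContDiffOn ℝ 2 (fun z => cut x0 g z ^ 3 * hyp P (wgt t k) z) (ball 0 R) :=
  H.contDiffOn_cut_cube.mul (contDiffOn_hyp H.hP H.contDiffOn_wgt H.hW)

lemma integral_V_mul_lap_le (H : Lyap R t M x0 g k V P) :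
    ∫ z in closedBall (0 : ℂ) 1, V z * lap (fun z => cut x0 g z ^ 3 * hyp P (wgt t k) z) z ≤
      1000 * (1 + M) * (6 + 10 * M ^ 2) * ∫ θ in (-π)..π, rmod t k (cis θ) := by
  have i1 := integral_re_add_err_nonneg H.hR H.contDiffOn_psi1 H.hg
  have i2 := integral_re_add_err_nonneg H.hR H.contDiffOn_psi2 H.hg
  have i3 := integral_re_add_err_nonneg H.hR H.contDiffOn_psi3 H.hk
  have hc : ∀ {ψ q : ℂ → ℂ}, ContDiffOn ℝ 1 ψ (ball 0 R) → DifferentiableOn ℂ q (ball 0 R) →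
      ContinuousOn (fun z => (ψ z * deriv q z).re + err ψ q z) (ball 0 R) := fun hψ hq =>
    (continuous_re.comp_continuousOn (hψ.continuousOn.mul (hq.deriv isOpen_ball).continuousOn)).add
      (continuousOn_err hψ hq)
  have c1 := hc H.contDiffOn_psi1 H.hg
  have c2 := hc H.contDiffOn_psi2 H.hg
  have c3 := hc H.contDiffOn_psi3 H.hk
  have c0 : ContinuousOn
      (fun z => V z * lap (fun z => cut x0 g z ^ 3 * hyp P (wgt t k) z) z) (ball 0 R) :=
    H.hV.continuousOn.mul (contDiffOn_lap isOpen_ball H.contDiffOn_prod)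
  have cK : ContinuousOn (rmod t k) (ball 0 R) :=
    (contDiffOn_rmod (n := 1) H.ht isOpen_ball H.hk).continuousOn
  have cg := (H.hg.deriv isOpen_ball).continuousOn
  have crho : ContinuousOn rho (ball 0 R) := (contDiff_rho (n := 1)).continuous.continuousOn
  have cVX := continuousOn_dX isOpen_ball (H.hV.of_le (m := 1) (by norm_num))
  have cVY := continuousOn_dY isOpen_ball (H.hV.of_le (m := 1) (by norm_num))
  have r1 : ContinuousOn (fun z => rho z * (‖deriv g z‖ ^ 2 * rmod t k z)) (ball 0 R) := by
    fun_prop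
  have r2 : ContinuousOn (fun z => rho z * ((dX V z ^ 2 + dY V z ^ 2) * rmod t k z))
    (ball 0 R) := by fun_prop
  have r3 := continuousOn_lap_rmod_aux (R := R) H.ht H.hk
  have j1 := integral_rmod_le H.ht H.hR H.hk
  have j2 := integral_deriv_sq_mul_rmod_le H.ht H.hR H.hk H.hg H.hg1
  have j3 := integral_grad_sq_mul_rmod_le H.ht H.hR H.hM H.hk H.hV H.hV1 H.hV0 H.hVl
  have j4 := integral_deriv_rmod_le H.ht H.hR H.hk
  have main := setIntegral_mono_closedBall H.hR
    (((c0.add (c1.const_mul 12)).add (c2.const_mul 24)).add (c3.const_mul 4))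
    ((((cK.add r1).add r2).add r3).const_mul (1000 * (1 + M))) fun z hz => by
      have := H.V_mul_lap_add_err_le hz
      simp only [Pi.add_apply]
      linarith
  have e1 := integral_add_four H.hR c0 c1 c2 c3 12 24 4
  have e2 := integral_add_four H.hR cK r1 r2 r3 1 1 1
  simp only [one_mul] at e2
  have main' := e1.symm.le.trans (main.trans
    ((integral_const_mul _ _).trans (congrArg (1000 * (1 + M) * ·) e2)).le)
  have hM := H.hM
  have := mul_le_mul_of_nonneg_left (add_le_add (add_le_add (add_le_add j1 j2) j3) j4)
    (show 0 ≤ 1000 * (1 + M) by positivity)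
  have hp : 0 ≤ ∫ θ in (-π)..π, rmod t k (cis θ) :=
    intervalIntegral.integral_nonneg (by linarith [Real.pi_pos]) fun θ _ => (rmod_pos H.ht k _).le
  have := mul_nonneg (show 0 ≤ 1000 * (1 + M) by positivity) hp
  linarith

end Lyap

end

section

lemma dN_mul {F G : ℂ → ℝ} {θ : ℝ} (hF : DifferentiableAt ℝ F (cis θ))
    (hG : DifferentiableAt ℝ G (cis θ)) :
    dN (fun z => F z * G z) θ = F (cis θ) * dN G θ + G (cis θ) * dN F θ := by
  rw [dN, dX_mul hF hG, dY_mul hF hG, dN, dN]; ring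

namespace Lyap

variable {R t M x0 : ℝ} {g k : ℂ → ℂ} {V P : ℂ → ℝ} {z : ℂ}

lemma wgt_cis (t : ℝ) (k : ℂ → ℂ) (θ : ℝ) : wgt t k (cis θ) = t := by simp [wgt, rho_cis]

lemma hyp_cis (H : Lyap R t M x0 g k V P) {θ : ℝ} (hP : P (cis θ) = 0) :
    hyp P (wgt t k) (cis θ) = t := by
  rw [hyp, hP, wgt_cis, mul_zero, zero_add, Real.sqrt_mul_self H.ht.le]

lemma dN_hyp (H : Lyap R t M x0 g k V P) {θ : ℝ} (hP : P (cis θ) = 0) :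
    dN (hyp P (wgt t k)) θ = -2 * rmod t k (cis θ) := by
  have hz := cis_mem H.hR θ
  have h1 := hyp_mul_fderiv isOpen_ball H.hP H.contDiffOn_wgt H.hW hz 1
  have h2 := hyp_mul_fderiv isOpen_ball H.hP H.contDiffOn_wgt H.hW hz I
  rw [hP, H.hyp_cis hP, wgt_cis, zero_mul, zero_add] at h1 h2
  have e1 : dX (hyp P (wgt t k)) (cis θ) = dX (wgt t k) (cis θ) := mul_left_cancel₀ H.ht.ne' h1
  have e2 : dY (hyp P (wgt t k)) (cis θ) = dY (wgt t k) (cis θ) := mul_left_cancel₀ H.ht.ne' h2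
  rw [dN, e1, e2, H.dX_wgt hz, H.dY_wgt hz, rho_cis, cis_re, cis_im]
  linear_combination -2 * rmod t k (cis θ) * Real.sin_sq_add_cos_sq θ

lemma integral_hyp_lap_le (H : Lyap R t M x0 g k V P) (hP : ∀ θ, P (cis θ) = 0) :
    ∫ z in closedBall (0 : ℂ) 1, cut x0 g z ^ 3 * |P z| * lap V z ≤
      1000 * (1 + M) * (6 + 10 * M ^ 2) * (∫ θ in (-π)..π, rmod t k (cis θ)) +
        t * ∫ θ in (-π)..π, |cut x0 g (cis θ) ^ 3 * dN V θ -
          V (cis θ) * dN (fun z => cut x0 g z ^ 3) θ| := by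
  have h1 := H.integral_V_mul_lap_le
  have h2 := green_second H.hR H.contDiffOn_prod H.hV
  have cV := H.hV.of_le (m := 1) (by norm_num)
  have ca := H.contDiffOn_cut_cube.of_le (m := 1) (by norm_num)
  have ch := contDiffOn_hyp H.hP H.contDiffOn_wgt H.hW
  have cl := contDiffOn_lap isOpen_ball H.hV
  have cp := H.contDiffOn_prod.of_le (m := 1) (by norm_num)
  have k1 := continuous_comp_cis H.hR cV.continuousOn
  have k2 := continuous_comp_cis H.hR ca.continuousOn
  have k3 := continuous_dN H.hR cV
  have k4 := continuous_dN H.hR ca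
  have k5 := continuous_comp_cis H.hR cp.continuousOn
  have k6 := continuous_dN H.hR cp
  have h3 : ∫ θ in (-π)..π, ((cut x0 g (cis θ) ^ 3 * hyp P (wgt t k) (cis θ)) * dN V θ -
      V (cis θ) * dN (fun z => cut x0 g z ^ 3 * hyp P (wgt t k) z) θ) ≤
      ∫ θ in (-π)..π, t * |cut x0 g (cis θ) ^ 3 * dN V θ -
          V (cis θ) * dN (fun z => cut x0 g z ^ 3) θ| := by
    refine intervalIntegral.integral_mono (by linarith [Real.pi_pos])
      ((k5.mul k3).sub (k1.mul k6)).continuousOn.intervalIntegrable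
      (((k2.mul k3).sub (k1.mul k4)).abs.const_mul t).continuousOn.intervalIntegrable fun θ => ?_
    have hz := cis_mem H.hR θ
    have hz' : cis θ ∈ closedBall (0 : ℂ) 1 := by simp
    dsimp only
    rw [dN_mul (ContDiffOn.diffAt H.contDiffOn_cut_cube two_ne_zero isOpen_ball hz)
      (ContDiffOn.diffAt ch two_ne_zero isOpen_ball hz), H.hyp_cis (hP θ), H.dN_hyp (hP θ)]
    have a1 := mul_nonneg (mul_nonneg (neg_nonneg.2 (H.hV0 _ hz')) (pow_nonneg
      (cut_nonneg x0 g (cis θ)) 3)) (rmod_pos H.ht k (cis θ)).le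
    have a2 := mul_le_mul_of_nonneg_left (le_abs_self (cut x0 g (cis θ) ^ 3 * dN V θ -
          V (cis θ) * dN (fun z => cut x0 g z ^ 3) θ)) H.ht.le
    linarith
  rw [intervalIntegral.integral_const_mul] at h3
  have cabs : ContinuousOn (fun z => |P z|) (ball 0 R) := H.hP.continuousOn.abs
  have h4 := setIntegral_mono_closedBall H.hR ((ca.continuousOn.mul cabs).mul cl)
    (cp.continuousOn.mul cl) fun z hz => by
      have := H.hVl z hz
      have := cut_nonneg x0 g z
      have := abs_le_hyp P (wgt t k) z
      simp only [Pi.mul_apply]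
      gcongr
  simp only [Pi.mul_apply] at h4
  linarith

end Lyap

theorem integral_abs_lap_le {R M x0 : ℝ} {g k : ℂ → ℂ} {V P : ℂ → ℝ} (hR : 1 < R) (hM : 0 ≤ M)
    (hx0 : 0 ≤ x0) (hg : DifferentiableOn ℂ g (ball 0 R)) (hk : DifferentiableOn ℂ k (ball 0 R))
    (hg1 : ∀ z ∈ closedBall (0 : ℂ) 1, ‖g z‖ ≤ 1) (hV : ContDiffOn ℝ 2 V (ball 0 R))
    (hV1 : ∀ z ∈ closedBall (0 : ℂ) 1, -M ≤ V z) (hV0 : ∀ z ∈ closedBall (0 : ℂ) 1, V z ≤ 0)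
    (hVl : ∀ z ∈ closedBall (0 : ℂ) 1, 0 ≤ lap V z) (hP : ContDiffOn ℝ 2 P (ball 0 R))
    (hPX : ∀ z ∈ closedBall (0 : ℂ) 1, x0 < normSq (g z) → dX P z = -(k z / g z).re)
    (hPY : ∀ z ∈ closedBall (0 : ℂ) 1, x0 < normSq (g z) → dY P z = (k z / g z).im)
    (hPl : ∀ z ∈ closedBall (0 : ℂ) 1, x0 < normSq (g z) → lap P z = 0)
    (hP0 : ∀ θ, P (cis θ) = 0) :
    ∫ z in closedBall (0 : ℂ) 1, cut x0 g z ^ 3 * |P z| * lap V z ≤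
      1000 * (1 + M) * (6 + 10 * M ^ 2) * ∫ θ in (-π)..π, ‖k (cis θ)‖ := by
  set C := 1000 * (1 + M) * (6 + 10 * M ^ 2)
  have hC : 0 ≤ C := by positivity
  set B := ∫ θ in (-π)..π, |cut x0 g (cis θ) ^ 3 * dN V θ -
          V (cis θ) * dN (fun z => cut x0 g z ^ 3) θ|
  have hB : 0 ≤ B := intervalIntegral.integral_nonneg (by linarith [Real.pi_pos])
    fun θ _ => abs_nonneg _
  have key : ∀ t, 0 < t → ∫ z in closedBall (0 : ℂ) 1, cut x0 g z ^ 3 * |P z| * lap V z ≤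
      C * (∫ θ in (-π)..π, ‖k (cis θ)‖) + t * (C * (2 * π) + B) := fun t ht => by
    have cK : ContinuousOn (rmod t k) (ball 0 R) :=
      (contDiffOn_rmod (n := 1) ht isOpen_ball hk).continuousOn
    have cW : ContinuousOn (fun z => rho z * rmod t k z + t) (ball 0 R) :=
      (((contDiff_rho (n := 1)).continuous.continuousOn).mul cK).add continuousOn_const
    obtain ⟨R', hR', hs⟩ := exists_ball_subset_of_closedBall_subset
      (cW.isOpen_inter_preimage isOpen_ball (isOpen_Ioi (a := (0 : ℝ)))) fun z hz =>
        ⟨closedBall_subset_of_one_lt hR hz, by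
          have := mul_nonneg (rho_nonneg hz) (rmod_pos ht k z).le
          simp only [mem_preimage, mem_Ioi]; linarith⟩
    have hs1 : ball (0 : ℂ) R' ⊆ ball 0 R := fun z hz => (hs hz).1
    have H : Lyap R' t M x0 g k V P :=
      ⟨hR', ht, hM, hx0, hg.mono hs1, hk.mono hs1, hg1, hV.mono hs1, hV1, hV0, hVl, hP.mono hs1,
        hPX, hPY, hPl, fun z hz => (hs hz).2⟩
    have h1 := H.integral_hyp_lap_le hP0
    have kk := continuous_comp_cis hR hk.continuousOn
    have h2 : ∫ θ in (-π)..π, rmod t k (cis θ) ≤ ∫ θ in (-π)..π, (‖k (cis θ)‖ + t) :=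
      intervalIntegral.integral_mono (by linarith [Real.pi_pos])
        (intervalIntegrable_cis hR cK _ _)
        (kk.norm.add continuous_const).continuousOn.intervalIntegrable
        fun θ => rmod_le ht k (cis θ)
    rw [intervalIntegral.integral_add kk.norm.continuousOn.intervalIntegrable
      intervalIntegrable_const, intervalIntegral.integral_const, smul_eq_mul] at h2
    have h3 := mul_le_mul_of_nonneg_left h2 hC
    linarith
  refine le_of_forall_pos_le_add fun ε hε => ?_
  have hD : 0 ≤ C * (2 * π) + B := by positivity
  refine (key (ε / (C * (2 * π) + B + 1)) (by positivity)).trans ?_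
  gcongr
  rw [div_mul_eq_mul_div, div_le_iff₀ (by positivity)]
  nlinarith

end

section

/-- A `C²` function, equal to the identity on `[1, ∞)` and bounded below by `1/3` on `[0, ∞)`. -/
noncomputable def reg (y : ℝ) : ℝ := y + pc (1 - y) / 3

lemma hasDerivAt_reg (y : ℝ) : HasDerivAt reg (1 - max (1 - y) 0 ^ 2) y := by
  have h1 : HasDerivAt (fun y : ℝ => 1 - y) (-1) y := (hasDerivAt_id y).const_sub 1
  have h := (hasDerivAt_id y).add (((hasDerivAt_pc (1 - y)).comp y h1).div_const 3)
  exact h.congr_deriv (by ring)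

lemma hasDerivAt_reg' (y : ℝ) :
    HasDerivAt (fun y => 1 - max (1 - y) 0 ^ 2) (2 * max (1 - y) 0) y := by
  have h1 : HasDerivAt (fun y : ℝ => 1 - y) (-1) y := (hasDerivAt_id y).const_sub 1
  have h := (((hasDerivAt_pc' (1 - y)).comp y h1).div_const 3).const_sub 1
  refine (h.congr_of_eventuallyEq (Filter.Eventually.of_forall fun x => ?_)).congr_deriv (by ring)
  simp only [Function.comp]; ring

lemma contDiff_reg : ContDiff ℝ 2 reg :=
  contDiff_of_two hasDerivAt_reg hasDerivAt_reg' (by fun_prop)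

lemma reg_of_one_le {y : ℝ} (h : 1 ≤ y) : reg y = y := by
  rw [reg, pc, max_eq_right (by linarith)]; ring

lemma reg_of_le_one {y : ℝ} (h : y ≤ 1) : reg y = 1 / 3 + y ^ 2 - y ^ 3 / 3 := by
  rw [reg, pc, max_eq_left (by linarith)]; ring

lemma third_le_reg (y : ℝ) : 1 / 3 ≤ reg y := by
  rcases le_total y 1 with h1 | h1
  · rw [reg_of_le_one h1]; nlinarith [mul_nonneg (sq_nonneg y) (sub_nonneg.2 h1), sq_nonneg y]
  · rw [reg_of_one_le h1]; linarith

lemma reg_le {y b : ℝ} (h : 0 ≤ y) (hb : 1 ≤ b) (hy : y ≤ b) : reg y ≤ b := by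
  rcases le_total y 1 with h1 | h1
  · rw [reg_of_le_one h1]
    nlinarith [pow_le_one₀ h h1 (n := 2), pow_le_one₀ h h1 (n := 3),
      mul_nonneg (mul_nonneg h (sub_nonneg.2 h1)) h, mul_nonneg h (sub_nonneg.2 h1)]
  · rwa [reg_of_one_le h1]

/-- A smoothed version of `x ↦ log (max √x η)`. -/
noncomputable def vlog (η x : ℝ) : ℝ := Real.log (reg (x / η ^ 2)) / 2 + Real.log η

noncomputable def vlog' (η x : ℝ) : ℝ :=
  (1 - max (1 - x / η ^ 2) 0 ^ 2) / η ^ 2 / reg (x / η ^ 2) / 2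

variable {η : ℝ}

lemma reg_pos (y : ℝ) : 0 < reg y :=
  lt_of_lt_of_le (by norm_num) (third_le_reg _)

lemma hasDerivAt_vlog (x : ℝ) : HasDerivAt (vlog η) (vlog' η x) x := by
  have h1 : HasDerivAt (fun x : ℝ => x / η ^ 2) (1 / η ^ 2) x := (hasDerivAt_id x).div_const _
  have h2 := (hasDerivAt_reg (x / η ^ 2)).comp x h1
  have h := ((h2.log (reg_pos _).ne').div_const 2).add_const (Real.log η)
  refine h.congr_deriv ?_
  rw [vlog']; simp only [Function.comp]; ring

lemma hasDerivAt_vlog' (x : ℝ) : HasDerivAt (vlog' η)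
    ((2 * max (1 - x / η ^ 2) 0 * reg (x / η ^ 2) - (1 - max (1 - x / η ^ 2) 0 ^ 2) ^ 2) /
      (2 * (η ^ 2) ^ 2 * reg (x / η ^ 2) ^ 2)) x := by
  have h1 : HasDerivAt (fun x : ℝ => x / η ^ 2) (1 / η ^ 2) x := (hasDerivAt_id x).div_const _
  have h2 := (hasDerivAt_reg (x / η ^ 2)).comp x h1
  have h3 := ((hasDerivAt_reg' (x / η ^ 2)).comp x h1).div_const (η ^ 2)
  have h0 := (reg_pos (x / η ^ 2)).ne'
  refine ((h3.div h2 h0).div_const 2).congr_deriv ?_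
  simp only [Function.comp]
  generalize reg (x / η ^ 2) = r at *
  generalize max (1 - x / η ^ 2) 0 = m at *
  rcases eq_or_ne η 0 with rfl | hη
  · simp
  field_simp

section

variable {f : ℂ → ℂ} {U : Set ℂ} {z : ℂ}

lemma contDiffOn_vlog (hU : IsOpen U) (hf : DifferentiableOn ℂ f U) :
    ContDiffOn ℝ 2 (fun z => vlog η (normSq (f z))) U :=
  (((contDiff_reg.comp_contDiffOn ((contDiffOn_normSq hU hf).div_const _)).log
    fun _ _ => (reg_pos _).ne').div_const 2).add contDiffOn_const

lemma vlog_ge (x : ℝ) : -(Real.log 3 / 2 - Real.log η) ≤ vlog η x := by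
  have h1 := third_le_reg (x / η ^ 2)
  have h2 := Real.log_le_log (by norm_num) h1
  rw [one_div, Real.log_inv] at h2
  rw [vlog]; linarith

lemma vlog_nonpos (hη : 0 < η) (hη1 : η ≤ 1) {x : ℝ} (hx : 0 ≤ x) (hx1 : x ≤ 1) :
    vlog η x ≤ 0 := by
  have h0 : η ^ 2 ≤ 1 := pow_le_one₀ hη.le hη1
  have h1 := reg_le (y := x / η ^ 2) (b := 1 / η ^ 2) (by positivity)
    (by rwa [le_div_iff₀ (by positivity), one_mul]) (by gcongr)
  have h2 := Real.log_le_log (reg_pos _) h1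
  rw [one_div, Real.log_inv, Real.log_pow] at h2
  rw [vlog]; push_cast at h2; linarith

lemma lap_vlog (hU : IsOpen U) (hf : DifferentiableOn ℂ f U) (hz : z ∈ U) :
    lap (fun z => vlog η (normSq (f z))) z = 4 * normSq (deriv f z) *
      (vlog' η (normSq (f z)) + normSq (f z) *
      ((2 * max (1 - normSq (f z) / η ^ 2) 0 * reg (normSq (f z) / η ^ 2) -
        (1 - max (1 - normSq (f z) / η ^ 2) 0 ^ 2) ^ 2) /
      (2 * (η ^ 2) ^ 2 * reg (normSq (f z) / η ^ 2) ^ 2))) := by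
  rw [lap_comp hU (contDiffOn_normSq hU hf) hz (fun w _ => hasDerivAt_vlog _)
    (hasDerivAt_vlog' _), lap_normSq hU hf hz,
    gr_normSq_self (hf.differentiableAt (hU.mem_nhds hz))]
  ring

lemma lap_vlog_nonneg (hη : 0 < η) (hU : IsOpen U) (hf : DifferentiableOn ℂ f U) (hz : z ∈ U) :
    0 ≤ lap (fun z => vlog η (normSq (f z))) z := by
  rw [lap_vlog hU hf hz, vlog']
  have hx := normSq_nonneg (f z)
  have hd := normSq_nonneg (deriv f z)
  refine mul_nonneg (by positivity) ?_
  have h0 := reg_pos (normSq (f z) / η ^ 2)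
  obtain ⟨y, hy⟩ : ∃ y, y = normSq (f z) / η ^ 2 := ⟨_, rfl⟩
  have hx' : normSq (f z) = y * η ^ 2 := by rw [hy]; field_simp
  have hy0 : 0 ≤ y := by rw [hy]; positivity
  rw [← hy] at h0 ⊢
  rw [hx']
  have : (1 - max (1 - y) 0 ^ 2) / η ^ 2 / reg y / 2 + y * η ^ 2 *
      ((2 * max (1 - y) 0 * reg y - (1 - max (1 - y) 0 ^ 2) ^ 2) /
      (2 * (η ^ 2) ^ 2 * reg y ^ 2)) = ((1 - max (1 - y) 0 ^ 2) * reg y + y *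
        (2 * max (1 - y) 0 * reg y - (1 - max (1 - y) 0 ^ 2) ^ 2)) / (2 * η ^ 2 * reg y ^ 2) := by
    field_simp
  rw [this]
  refine div_nonneg ?_ (by positivity)
  rcases le_total y 1 with h1 | h1
  · rw [reg_of_le_one h1, max_eq_left (by linarith)]
    have e : (1 - (1 - y) ^ 2) * (1 / 3 + y ^ 2 - y ^ 3 / 3) + y *
        (2 * (1 - y) * (1 / 3 + y ^ 2 - y ^ 3 / 3) - (1 - (1 - y) ^ 2) ^ 2) =
      y / 3 * (3 * (1 - y) + (1 - y ^ 3)) := by ring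
    rw [e]
    have := pow_le_one₀ hy0 h1 (n := 3)
    have : 0 ≤ 1 - y := by linarith
    have : 0 ≤ 1 - y ^ 3 := by linarith
    positivity
  · rw [reg_of_one_le h1, max_eq_right (by linarith)]
    apply le_of_eq; ring

lemma one_le_normSq_div (hη : 0 < η) (h : η ≤ ‖f z‖) :
    1 ≤ normSq (f z) / η ^ 2 := by
  rw [le_div_iff₀ (by positivity), one_mul, normSq_eq_norm_sq]; gcongr

lemma vlog'_eq (hη : 0 < η) (h : η ≤ ‖f z‖) :
    vlog' η (normSq (f z)) = 1 / (2 * normSq (f z)) := by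
  have h1 := one_le_normSq_div hη h
  have : 0 < normSq (f z) := by
    rw [normSq_eq_norm_sq]; have := hη.trans_le h; positivity
  rw [vlog', max_eq_right (by linarith), reg_of_one_le h1]
  field_simp; ring

lemma lap_vlog_eq_zero (hη : 0 < η) (hU : IsOpen U) (hf : DifferentiableOn ℂ f U) (hz : z ∈ U)
    (h : η ≤ ‖f z‖) : lap (fun z => vlog η (normSq (f z))) z = 0 := by
  have h1 := one_le_normSq_div hη h
  have : 0 < normSq (f z) := by
    rw [normSq_eq_norm_sq]; have := hη.trans_le h; positivity
  rw [lap_vlog hU hf hz, vlog'_eq hη h, max_eq_right (by linarith), reg_of_one_le h1]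
  field_simp; ring

lemma dX_vlog (hη : 0 < η) (hU : IsOpen U) (hf : DifferentiableOn ℂ f U) (hz : z ∈ U)
    (h : η ≤ ‖f z‖) : dX (fun z => vlog η (normSq (f z))) z = (deriv f z / f z).re := by
  have hd := hf.differentiableAt (hU.mem_nhds hz)
  rw [dX_comp (u := fun z => normSq (f z)) (hasDerivAt_vlog _)
    (ContDiffOn.diffAt (contDiffOn_normSq (n := 1) hU hf) one_ne_zero hU hz), vlog'_eq hη h,
    dX_normSq_hol hd, div_re, mul_re, conj_re, conj_im]
  ring

lemma dY_vlog (hη : 0 < η) (hU : IsOpen U) (hf : DifferentiableOn ℂ f U) (hz : z ∈ U)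
    (h : η ≤ ‖f z‖) : dY (fun z => vlog η (normSq (f z))) z = -(deriv f z / f z).im := by
  have hd := hf.differentiableAt (hU.mem_nhds hz)
  rw [dY_comp (u := fun z => normSq (f z)) (hasDerivAt_vlog _)
    (ContDiffOn.diffAt (contDiffOn_normSq (n := 1) hU hf) one_ne_zero hU hz), vlog'_eq hη h,
    dY_normSq_hol hd, div_im, mul_im, conj_re, conj_im]
  ring

end

end

section

section logarithms

variable {R x : ℝ} {g : ℂ → ℂ} {S : Set ℂ} {p p' : ℂ}

lemma one_sub_mem_slitPlane {u : ℂ} (h : ‖u‖ < 1) : 1 - u ∈ slitPlane := by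
  refine Or.inl ?_
  have := abs_le.1 (abs_re_le_norm u)
  simp only [sub_re, one_re]; linarith

/-- `f` has a holomorphic logarithm on `S`. -/
def HasLog (S : Set ℂ) (f : ℂ → ℂ) : Prop :=
  ∃ l : ℂ → ℂ, DifferentiableOn ℂ l S ∧ ∀ z ∈ S, exp (l z) = f z

lemma HasLog.mul {f h : ℂ → ℂ} (hf : HasLog S f) (hh : HasLog S h) :
    HasLog S fun z => f z * h z := by
  obtain ⟨l, hl, hl'⟩ := hf
  obtain ⟨m, hm, hm'⟩ := hh
  exact ⟨_, hl.add hm, fun z hz => by rw [Pi.add_apply, exp_add, hl' z hz, hm' z hz]⟩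

lemma HasLog.div {f h : ℂ → ℂ} (hf : HasLog S f) (hh : HasLog S h) :
    HasLog S fun z => f z / h z := by
  obtain ⟨l, hl, hl'⟩ := hf
  obtain ⟨m, hm, hm'⟩ := hh
  exact ⟨_, hl.sub hm, fun z hz => by rw [Pi.sub_apply, exp_sub, hl' z hz, hm' z hz]⟩

lemma hasLog_const {c : ℂ} (hc : c ≠ 0) : HasLog S fun _ => c :=
  ⟨fun _ => log c, differentiableOn_const _, fun _ _ => exp_log hc⟩

lemma hasLog_of_mem_slitPlane {f : ℂ → ℂ} (hf : DifferentiableOn ℂ f S)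
    (h : ∀ z ∈ S, f z ∈ slitPlane) : HasLog S f :=
  ⟨fun z => log (f z), hf.clog h, fun z hz => exp_log (slitPlane_ne_zero (h z hz))⟩

lemma hasLog_quot (h : ∀ z ∈ S, ‖p' - p‖ < ‖z - p‖) : HasLog S fun z => (z - p') / (z - p) := by
  have h0 : ∀ z ∈ S, z - p ≠ 0 := fun z hz =>
    norm_pos_iff.1 ((norm_nonneg _).trans_lt (h z hz))
  refine hasLog_of_mem_slitPlane ((differentiableOn_id.sub_const _).div
    (differentiableOn_id.sub_const _) h0) fun z hz => ?_
  have h1 : (z - p') / (z - p) = 1 - (p' - p) / (z - p) := by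
    have := h0 z hz
    field_simp; ring
  rw [h1]
  refine one_sub_mem_slitPlane ?_
  rw [norm_div]
  exact (div_lt_one ((norm_nonneg _).trans_lt (h z hz))).2 (h z hz)

lemma hasLog_sub_iff (h : ∀ z ∈ S, ‖p' - p‖ < ‖z - p‖) :
    (HasLog S fun z => z - p) ↔ HasLog S fun z => z - p' := by
  have h0 : ∀ z ∈ S, z - p ≠ 0 := fun z hz =>
    norm_pos_iff.1 ((norm_nonneg _).trans_lt (h z hz))
  have hq := hasLog_quot h
  constructor
  · intro hl
    obtain ⟨l, hl, hl'⟩ := hl.mul hq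
    exact ⟨l, hl, fun z hz => by rw [hl' z hz]; have := h0 z hz; field_simp⟩
  · intro hl
    obtain ⟨l, hl, hl'⟩ := hl.div hq
    refine ⟨l, hl, fun z hz => ?_⟩
    have h1 := hl' z hz
    have := h0 z hz
    by_cases h2 : z - p' = 0
    · simp only [h2, zero_div] at h1
      exact absurd h1 (exp_ne_zero _)
    · rw [h1]; field_simp

lemma hasLog_sub_of_one_le (hp : 1 ≤ ‖p‖) : HasLog (ball 0 1) fun z => z - p := by
  have h0 : p ≠ 0 := norm_pos_iff.1 (by linarith)
  have h1 : HasLog (ball 0 1) fun z => 1 - z / p := by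
    refine hasLog_of_mem_slitPlane (by fun_prop) fun z hz => one_sub_mem_slitPlane ?_
    rw [norm_div, div_lt_one (by linarith)]
    have : ‖z‖ < 1 := by simpa using hz
    linarith
  obtain ⟨l, hl, hl'⟩ := (hasLog_const (neg_ne_zero.2 h0)).mul h1
  exact ⟨l, hl, fun z hz => by rw [hl' z hz]; field_simp; ring⟩

lemma HasLog.mono {T : Set ℂ} {f : ℂ → ℂ} (h : HasLog T f) (hs : S ⊆ T) : HasLog S f := by
  obtain ⟨l, hl, hl'⟩ := h
  exact ⟨l, hl.mono hs, fun z hz => hl' z (hs hz)⟩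

/-- On a sublevel set of `|g|` in the disc, `z - p` has a holomorphic logarithm as soon as `p` is
not in the closed sublevel set. -/
theorem hasLog_sub_of_lt (hR : 1 < R) (hg : DifferentiableOn ℂ g (ball 0 R))
    (hp : p ∈ ball (0 : ℂ) R) (hpx : x < ‖g p‖) :
    HasLog {z | z ∈ ball (0 : ℂ) 1 ∧ ‖g z‖ < x} fun z => z - p := by
  set S := {z | z ∈ ball (0 : ℂ) 1 ∧ ‖g z‖ < x}
  set W := {z | z ∈ ball (0 : ℂ) R ∧ x < ‖g z‖}
  have hW : IsOpen W := hg.continuousOn.norm.isOpen_inter_preimage isOpen_ball isOpen_Ioi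
  have near : ∀ q ∈ W, ∃ r > 0, ball q r ⊆ W ∧ ∀ q' ∈ ball q r,
      ((HasLog S fun z => z - q) ↔ HasLog S fun z => z - q') := fun q hq => by
    obtain ⟨r, hr, hs⟩ := Metric.isOpen_iff.1 hW q hq
    refine ⟨r, hr, hs, fun q' hq' => hasLog_sub_iff fun z hz => ?_⟩
    by_contra! hlt
    have : z ∈ W := hs (by
      rw [mem_ball, dist_eq_norm] at hq' ⊢; linarith)
    exact absurd this.2 (not_lt.2 hz.2.le)
  set N := {q | q ∈ W ∧ ¬ HasLog S fun z => z - q}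
  have hN : IsOpen N := by
    refine Metric.isOpen_iff.2 fun q hq => ?_
    obtain ⟨r, hr, hs, h⟩ := near q hq.1
    exact ⟨r, hr, fun q' hq' => ⟨hs hq', fun h' => hq.2 ((h q' hq').2 h')⟩⟩
  have hN1 : N ⊆ ball 0 1 := fun q hq => by
    by_contra h
    have : 1 ≤ ‖q‖ := by simpa using h
    exact hq.2 ((hasLog_sub_of_one_le this).mono fun z hz => hz.1)
  have hcl : closure N ⊆ ball 0 R := fun q hq => by
    have : q ∈ closedBall (0 : ℂ) 1 := closure_ball_subset_closedBall (closure_mono hN1 hq)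
    exact closedBall_subset_of_one_lt hR this
  by_contra hcon
  have hpN : p ∈ N := ⟨⟨hp, hpx⟩, hcon⟩
  have := Complex.norm_le_of_forall_mem_frontier_norm_le (U := N) (f := g) (C := x)
    (isBounded_ball.subset hN1) ((hg.mono hcl).diffContOnCl) (fun q hq => by
      by_contra! hlt
      have hqW : q ∈ W := ⟨hcl hq.1, hlt⟩
      obtain ⟨r, hr, hs, h⟩ := near q hqW
      obtain ⟨q', hq', hd⟩ := Metric.mem_closure_iff.1 hq.1 r hr
      have h1 : ¬ HasLog S fun z => z - q := fun h' =>
        hq'.2 ((h q' (by rwa [mem_ball, dist_comm])).1 h')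
      exact hq.2 (by rw [hN.interior_eq]; exact ⟨hqW, h1⟩)) (subset_closure hpN)
  linarith

theorem hasLog_polynomial (hR : 1 < R) (hg : DifferentiableOn ℂ g (ball 0 R))
    (f : Polynomial ℂ) (hf : f ≠ 0) (h : ∀ p ∈ ball (0 : ℂ) 1, f.eval p = 0 → x < ‖g p‖) :
    HasLog {z | z ∈ ball (0 : ℂ) 1 ∧ ‖g z‖ < x} fun z => f.eval z := by
  set S := {z | z ∈ ball (0 : ℂ) 1 ∧ ‖g z‖ < x}
  have key : ∀ s : Multiset ℂ, (∀ p ∈ s, f.eval p = 0) →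
      HasLog S fun z => (s.map fun p => z - p).prod := by
    intro s
    induction s using Multiset.induction with
    | empty => intro _; simpa using hasLog_const one_ne_zero
    | cons p s ih =>
      intro hs
      simp only [Multiset.map_cons, Multiset.prod_cons]
      refine HasLog.mul ?_ (ih fun q hq => hs q (Multiset.mem_cons_of_mem hq))
      by_cases hp : p ∈ ball (0 : ℂ) 1
      · exact hasLog_sub_of_lt hR hg (ball_subset_ball hR.le hp)
          (h p hp (hs p (Multiset.mem_cons_self p s)))
      · exact (hasLog_sub_of_one_le (by simpa using hp)).mono fun z hz => hz.1
  obtain ⟨l, hl, hl'⟩ := (hasLog_const (S := S) (Polynomial.leadingCoeff_ne_zero.2 hf)).mul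
    (key f.roots fun p hp => (Polynomial.mem_roots hf).1 hp)
  refine ⟨l, hl, fun z hz => ?_⟩
  rw [hl' z hz]
  change _ = Polynomial.eval z f
  conv_rhs => rw [(IsAlgClosed.splits f).eq_prod_roots]
  rw [Polynomial.eval_mul, Polynomial.eval_C, Polynomial.eval_multiset_prod, Multiset.map_map]
  simp

end logarithms

section primitives

variable {Ω U : Set ℂ} {z z₀ z₁ z₂ : ℂ}

/-- `c` is locally constant at all points of `U`. -/
def LocConst (U : Set ℂ) (c : ℂ → ℂ) : Prop := ∀ z ∈ U, ∀ᶠ w in 𝓝 z, c w = c z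

/-- `1 / (z - z₀) - 1 / (z - z₁)` has a primitive on `Ω`. -/
def Rel (Ω : Set ℂ) (z₀ z₁ : ℂ) : Prop :=
  ∃ l : ℂ → ℂ, ∀ z ∈ Ω, HasDerivAt l (1 / (z - z₀) - 1 / (z - z₁)) z

lemma Rel.symm (h : Rel Ω z₀ z₁) : Rel Ω z₁ z₀ := by
  obtain ⟨l, hl⟩ := h
  exact ⟨-l, fun z hz => (hl z hz).neg.congr_deriv (by ring)⟩

lemma Rel.trans (h : Rel Ω z₀ z₁) (h' : Rel Ω z₁ z₂) : Rel Ω z₀ z₂ := by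
  obtain ⟨l, hl⟩ := h
  obtain ⟨m, hm⟩ := h'
  exact ⟨l + m, fun z hz => ((hl z hz).add (hm z hz)).congr_deriv (by ring)⟩

lemma Rel.refl (Ω : Set ℂ) (z₀ : ℂ) : Rel Ω z₀ z₀ :=
  ⟨0, fun z _ => (hasDerivAt_const z 0).congr_deriv (by ring)⟩

lemma rel_of_lt (h : ∀ z ∈ Ω, ‖z₁ - z₀‖ < ‖z - z₀‖) : Rel Ω z₁ z₀ := by
  refine ⟨fun z => log (1 - (z₁ - z₀) / (z - z₀)), fun z hz => ?_⟩
  have h0 : z - z₀ ≠ 0 := norm_pos_iff.1 ((norm_nonneg _).trans_lt (h z hz))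
  have hs : 1 - (z₁ - z₀) / (z - z₀) ∈ slitPlane := one_sub_mem_slitPlane (by
    rw [norm_div]
    exact (div_lt_one ((norm_nonneg _).trans_lt (h z hz))).2 (h z hz))
  have h1 : z - z₁ ≠ 0 := fun h1 => by
    refine slitPlane_ne_zero hs ?_
    have : z₁ - z₀ = z - z₀ := by linear_combination -h1
    rw [this, div_self h0, sub_self]
  have hd := (((hasDerivAt_const z (z₁ - z₀)).div ((hasDerivAt_id z).sub_const z₀) h0).const_sub
    1).clog hs
  refine hd.congr_deriv ?_
  have h2 : 1 - (z₁ - z₀) / (z - z₀) = (z - z₁) / (z - z₀) := by field_simp; ring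
  simp only [id, Pi.div_apply] at *
  rw [h2]
  field_simp
  ring

lemma exists_primitive_of_sum_eq_zero (hU : IsOpen U) (hΩ : Disjoint U Ω) (Z : Finset ℂ)
    (a : ℂ → ℂ) (h : ∀ c, LocConst U c → ∑ ζ ∈ Z, a ζ * c ζ = 0) :
    ∃ L : ℂ → ℂ, ∀ z ∈ Ω, HasDerivAt L (∑ ζ ∈ Z, a ζ / (z - ζ)) z := by
  let s : Setoid ℂ := ⟨Rel Ω, Rel.refl Ω, Rel.symm, Rel.trans⟩
  let rep : ℂ → ℂ := fun z => (Quotient.mk s z).out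
  have hrep : ∀ z, Rel Ω z (rep z) := fun z => (Quotient.mk_out (s := s) z).symm
  have hloc : LocConst U rep := fun ζ hζ => by
    obtain ⟨r, hr, hs⟩ := Metric.isOpen_iff.1 hU ζ hζ
    filter_upwards [ball_mem_nhds ζ hr] with w hw
    have : Rel Ω w ζ := rel_of_lt fun z hz => by
      by_contra! hlt
      refine Set.disjoint_left.1 hΩ (hs ?_) hz
      rw [mem_ball, dist_eq_norm] at hw ⊢; linarith
    exact congrArg Quotient.out (Quotient.sound (s := s) this)
  choose l hl using hrep
  refine ⟨fun z => ∑ ζ ∈ Z, a ζ * l ζ z, fun z hz => ?_⟩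
  refine (HasDerivAt.fun_sum fun ζ _ => (hl ζ z hz).const_mul (a ζ)).congr_deriv ?_
  have := h (fun w => 1 / (z - rep w)) fun ζ hζ => (hloc ζ hζ).mono fun w hw => by
    simp only [hw]
  rw [← sub_zero (∑ ζ ∈ Z, a ζ / (z - ζ)), ← this, ← Finset.sum_sub_distrib]
  exact Finset.sum_congr rfl fun ζ _ => by ring

end primitives

end

section

section pompeiu

variable {R : ℝ} {F G φ : ℂ → ℂ} {z ζ : ℂ}

/-- Twice the Cauchy-Riemann operator. -/
noncomputable def db (F : ℂ → ℂ) (z : ℂ) : ℂ := dX F z + I * dY F z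

lemma continuousOn_db {U : Set ℂ} (hU : IsOpen U) (hF : ContDiffOn ℝ 1 F U) :
    ContinuousOn (db F) U :=
  (continuousOn_dX hU hF).add (continuousOn_const.mul (continuousOn_dY hU hF))

lemma db_congr (h : F =ᶠ[𝓝 z] G) : db F z = db G z := by
  rw [db, db, dX_congr h, dY_congr h]

lemma db_hol (h : DifferentiableAt ℂ F z) : db F z = 0 := by
  rw [db, dX_hol h, dY_hol h]
  linear_combination deriv F z * I_mul_I

lemma db_mul (hF : DifferentiableAt ℝ F z) (hG : DifferentiableAt ℝ G z) :
    db (fun w => F w * G w) z = db F z * G z + F z * db G z := by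
  rw [db, db, db, dX_mul hF hG, dY_mul hF hG]; ring

lemma integral_db (hR : 1 < R) (hF : ContDiffOn ℝ 1 F (ball 0 R)) :
    ∫ z in closedBall (0 : ℂ) 1, db F z = ∫ θ in (-π)..π, F (cis θ) * cis θ := by
  have i1 := integrableOn_closedBall hR (continuousOn_dX isOpen_ball hF)
  have i2 := integrableOn_closedBall hR (continuousOn_dY isOpen_ball hF)
  have c1 := continuous_comp_cis hR hF.continuousOn
  have j1 : IntervalIntegrable (fun θ => Real.cos θ • F (cis θ)) volume (-π) π :=
    (Real.continuous_cos.smul c1).intervalIntegrable _ _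
  have j2 : IntervalIntegrable (fun θ => I * (Real.sin θ • F (cis θ))) volume (-π) π :=
    (continuous_const.mul (Real.continuous_sin.smul c1)).intervalIntegrable _ _
  have : ∫ z in closedBall (0 : ℂ) 1, db F z =
      (∫ z in closedBall (0 : ℂ) 1, dX F z) + I * ∫ z in closedBall (0 : ℂ) 1, dY F z := by
    rw [← integral_const_mul]
    exact integral_add i1 (i2.const_mul I)
  rw [this, integral_dX hR hF, integral_dY hR hF, ← intervalIntegral.integral_const_mul,
    ← intervalIntegral.integral_add j1 j2]
  refine intervalIntegral.integral_congr fun θ _ => ?_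
  simp only [real_smul, cis_eq]
  ring

lemma integral_hol_mul_cis (hR : 1 < R) (hF : DifferentiableOn ℂ F (ball 0 R)) :
    ∫ θ in (-π)..π, F (cis θ) * cis θ = 0 := by
  rw [← integral_db hR (contDiffOn_hol isOpen_ball hF)]
  refine (setIntegral_congr_fun (g := fun _ => 0) isClosed_closedBall.measurableSet
    fun z hz => ?_).trans (by simp)
  exact db_hol (hF.differentiableAt (isOpen_ball.mem_nhds (closedBall_subset_of_one_lt hR hz)))

lemma exists_one_lt_mul_lt (Z : Finset ℂ) (hZ : ∀ ζ ∈ Z, ‖ζ‖ < 1) :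
    ∃ R : ℝ, 1 < R ∧ ∀ ζ ∈ Z, ‖ζ‖ * R < 1 := by
  have h : ∀ᶠ R : ℝ in 𝓝[>] 1, ∀ ζ ∈ Z, ‖ζ‖ * R < 1 := by
    rw [Filter.eventually_all_finset]
    intro ζ hζ
    have : Filter.Tendsto (fun R : ℝ => ‖ζ‖ * R) (𝓝[>] 1) (𝓝 (‖ζ‖ * 1)) :=
      ((continuous_const.mul continuous_id).tendsto 1).mono_left nhdsWithin_le_nhds
    exact this.eventually_lt_const (by simpa using hZ ζ hζ)
  obtain ⟨R, hR, hR1⟩ := (h.and self_mem_nhdsWithin).exists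
  exact ⟨R, hR1, hR⟩

lemma one_sub_conj_mul_ne_zero (h : ‖ζ‖ * R < 1) (hz : z ∈ ball 0 R) : 1 - conj ζ * z ≠ 0 := by
  intro h0
  have h1 : ‖conj ζ * z‖ = 1 := by rw [← sub_eq_zero.1 h0, norm_one]
  rw [norm_mul, RCLike.norm_conj] at h1
  rw [mem_ball_zero_iff] at hz
  nlinarith [norm_nonneg ζ]

lemma differentiableOn_inv_one_sub (h : ‖ζ‖ * R < 1) (c : ℂ) :
    DifferentiableOn ℂ (fun z => c / (1 - conj ζ * z)) (ball 0 R) := fun z hz =>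
  ((differentiableAt_const c).fun_div (d := fun z => 1 - conj ζ * z) (by fun_prop)
    (one_sub_conj_mul_ne_zero h hz)).differentiableWithinAt

lemma integral_add_of_continuous {u v : ℝ → ℂ} (hu : Continuous u) (hv : Continuous v) :
    ∫ θ in (-π)..π, (u θ + v θ) = (∫ θ in (-π)..π, u θ) + ∫ θ in (-π)..π, v θ :=
  intervalIntegral.integral_add (hu.intervalIntegrable _ _) (hv.intervalIntegrable _ _)

lemma cis_sub_ne_zero (hζ : ‖ζ‖ < 1) (θ : ℝ) : cis θ - ζ ≠ 0 := by
  intro h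
  rw [← sub_eq_zero.1 h, norm_cis] at hζ
  exact lt_irrefl _ hζ

lemma cis_mul_conj (θ : ℝ) : cis θ * conj (cis θ) = 1 := by
  rw [mul_conj, normSq_eq_norm_sq, norm_cis]; simp

lemma conj_cis_div_sub (hζ : ‖ζ‖ < 1) (θ : ℝ) :
    conj (cis θ / (cis θ - ζ)) = 1 + conj ζ / (1 - conj ζ * cis θ) * cis θ := by
  have h1 : conj (cis θ) - conj ζ ≠ 0 := by
    rw [← map_sub]; exact (map_ne_zero _).2 (cis_sub_ne_zero hζ θ)
  have h2 : 1 - conj ζ * cis θ = cis θ * (conj (cis θ) - conj ζ) := by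
    linear_combination -cis_mul_conj θ
  have h3 : cis θ ≠ 0 := norm_pos_iff.1 (by simp)
  rw [h2, map_div₀, map_sub]
  field_simp
  ring

lemma integral_cis_div_sub (hζ : ‖ζ‖ < 1) :
    ∫ θ in (-π)..π, cis θ / (cis θ - ζ) = 2 * π := by
  obtain ⟨R, hR, hR'⟩ := exists_one_lt_mul_lt {ζ} (by simpa using hζ)
  have hd := differentiableOn_inv_one_sub (hR' ζ (by simp)) (conj ζ)
  have h0 := integral_hol_mul_cis hR hd
  have h1 : ∫ θ in (-π)..π, conj (cis θ / (cis θ - ζ)) = 2 * π := by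
    simp_rw [conj_cis_div_sub hζ]
    rw [integral_add_of_continuous (u := fun _ => 1)
      (v := fun θ => conj ζ / (1 - conj ζ * cis θ) * cis θ) continuous_const
      ((continuous_comp_cis hR hd.continuousOn).mul continuous_cis), h0]
    simp; ring
  rw [intervalIntegral.intervalIntegral_conj] at h1
  rw [← RCLike.conj_conj (∫ θ in (-π)..π, cis θ / (cis θ - ζ)), h1]
  simp [conj_ofNat]

lemma differentiableOn_dslope_ball (hζ : ζ ∈ ball 0 R) (hF : DifferentiableOn ℂ F (ball 0 R)) :
    DifferentiableOn ℂ (dslope F ζ) (ball 0 R) :=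
  (differentiableOn_dslope (isOpen_ball.mem_nhds hζ)).2 hF

lemma integral_hol_mul_cis_div_sub (hR : 1 < R) (hζ : ‖ζ‖ < 1)
    (hF : DifferentiableOn ℂ F (ball 0 R)) :
    ∫ θ in (-π)..π, F (cis θ) * (cis θ / (cis θ - ζ)) = 2 * π * F ζ := by
  have hd := differentiableOn_dslope_ball (mem_ball_zero_iff.2 (hζ.trans hR)) hF
  have h : ∀ θ, F (cis θ) * (cis θ / (cis θ - ζ)) =
      F ζ * (cis θ / (cis θ - ζ)) + dslope F ζ (cis θ) * cis θ := fun θ => by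
    have h1 := cis_sub_ne_zero hζ θ
    rw [dslope_of_ne _ (sub_ne_zero.1 h1), slope_def_field]
    field_simp
    ring
  simp_rw [h]
  rw [integral_add_of_continuous (u := fun θ => F ζ * (cis θ / (cis θ - ζ)))
    (v := fun θ => dslope F ζ (cis θ) * cis θ)
    (continuous_const.mul (continuous_cis.div (continuous_cis.sub continuous_const)
      (cis_sub_ne_zero hζ))) ((continuous_comp_cis hR hd.continuousOn).mul continuous_cis),
    integral_hol_mul_cis hR hd, intervalIntegral.integral_const_mul, integral_cis_div_sub hζ]
  ring

/-- The Cauchy-Pompeiu formula for functions vanishing on the unit circle. -/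
lemma integral_db_div_sub (hR : 1 < R) (hφ : ContDiffOn ℝ 1 φ (ball 0 R)) (hζ : ‖ζ‖ < 1)
    (hh : ∀ᶠ z in 𝓝 ζ, DifferentiableAt ℂ φ z) (h0 : ∀ θ, φ (cis θ) = 0) :
    IntegrableOn (fun z => db φ z / (z - ζ)) (closedBall 0 1) ∧
      ∫ z in closedBall (0 : ℂ) 1, db φ z / (z - ζ) = -(2 * π * φ ζ) := by
  have hζR : ζ ∈ ball (0 : ℂ) R := mem_ball_zero_iff.2 (hζ.trans hR)
  have hev : ∀ z ≠ ζ, dslope φ ζ =ᶠ[𝓝 z] fun w => (φ w - φ ζ) * (w - ζ)⁻¹ := fun z hz => by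
    filter_upwards [isOpen_ne.mem_nhds hz] with w hw
    rw [dslope_of_ne _ hw, slope_def_field, div_eq_mul_inv]
  have hdζ : ∀ᶠ z in 𝓝 ζ, DifferentiableAt ℂ (dslope φ ζ) z := by
    obtain ⟨r, hr, hs⟩ := Metric.eventually_nhds_iff_ball.1 hh
    have := (differentiableOn_dslope (ball_mem_nhds ζ hr)).2 fun z hz =>
      (hs z hz).differentiableWithinAt
    filter_upwards [ball_mem_nhds ζ hr] with z hz
    exact this.differentiableAt (isOpen_ball.mem_nhds hz)
  have hinv : ∀ z ≠ ζ, DifferentiableAt ℂ (fun w => (w - ζ)⁻¹) z := fun z hz =>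
    (differentiableAt_id.sub_const ζ).inv (sub_ne_zero.2 hz)
  have hD : ContDiffOn ℝ 1 (dslope φ ζ) (ball 0 R) := fun z hz => by
    refine ContDiffAt.contDiffWithinAt ?_
    by_cases hz' : z = ζ
    · subst hz'
      obtain ⟨u, hu, huo, hzu⟩ := _root_.mem_nhds_iff.1 hdζ
      exact (contDiffOn_hol huo fun w hw => (hu hw).differentiableWithinAt).contDiffAt
        (huo.mem_nhds hzu)
    · refine ContDiffAt.congr_of_eventuallyEq ?_ (hev z hz')
      refine ((hφ.contDiffAt (isOpen_ball.mem_nhds hz)).sub contDiffAt_const).mul ?_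
      exact (contDiffOn_hol isOpen_ne fun w hw =>
        (hinv w hw).differentiableWithinAt).contDiffAt (isOpen_ne.mem_nhds hz')
  have e : ∀ z ∈ ball (0 : ℂ) R, db (dslope φ ζ) z = db φ z / (z - ζ) := fun z hz => by
    by_cases hz' : z = ζ
    · subst hz'
      rw [db_hol hdζ.self_of_nhds, sub_self, div_zero]
    · have d1 := ContDiffOn.diffAt hφ one_ne_zero isOpen_ball hz
      rw [db_congr (hev z hz'), db_mul (d1.sub_const _) (differentiableAt_real (hinv z hz')),
        db_hol (hinv z hz'), mul_zero, add_zero, div_eq_mul_inv]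
      congr 1
      rw [db, db, dX, dY, fderiv_sub_const]; rfl
  have e' : EqOn (db (dslope φ ζ)) (fun z => db φ z / (z - ζ)) (closedBall 0 1) :=
    fun z hz => e z (closedBall_subset_of_one_lt hR hz)
  refine ⟨(integrableOn_closedBall hR (continuousOn_db isOpen_ball hD)).congr_fun e'
    isClosed_closedBall.measurableSet, ?_⟩
  rw [← setIntegral_congr_fun isClosed_closedBall.measurableSet e', integral_db hR hD]
  have h : ∀ θ, dslope φ ζ (cis θ) * cis θ = -φ ζ * (cis θ / (cis θ - ζ)) := fun θ => by
    rw [dslope_of_ne _ (sub_ne_zero.1 (cis_sub_ne_zero hζ θ)), slope_def_field, h0]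
    ring
  simp_rw [h]
  rw [intervalIntegral.integral_const_mul, integral_cis_div_sub hζ]
  ring

end pompeiu

end

section

section kernel

variable {R : ℝ} {g F φ : ℂ → ℂ} {Z : Finset ℂ} {a : ℂ → ℂ} {z ζ : ℂ}

/-- The part of the dual extremal kernel that is holomorphic on the disc. -/
noncomputable def kerHol (Z : Finset ℂ) (a : ℂ → ℂ) (z : ℂ) : ℂ :=
  ∑ ζ ∈ Z, conj (a ζ) * (conj ζ / (1 - conj ζ * z))

/-- The dual extremal kernel. -/
noncomputable def ker (Z : Finset ℂ) (a : ℂ → ℂ) (z : ℂ) : ℂ :=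
  ∑ ζ ∈ Z, a ζ / (z - ζ) + kerHol Z a z

/-- The product of `g` with the dual extremal kernel, with removable singularities removed. -/
noncomputable def kerMul (g : ℂ → ℂ) (Z : Finset ℂ) (a : ℂ → ℂ) (z : ℂ) : ℂ :=
  ∑ ζ ∈ Z, a ζ * dslope g ζ z + g z * kerHol Z a z

lemma differentiableOn_kerHol (hZ : ∀ ζ ∈ Z, ‖ζ‖ * R < 1) :
    DifferentiableOn ℂ (kerHol Z a) (ball 0 R) :=
  DifferentiableOn.fun_sum fun ζ hζ => (differentiableOn_inv_one_sub (hZ ζ hζ) _).const_mul _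

lemma differentiableOn_kerMul (hZ : ∀ ζ ∈ Z, ‖ζ‖ * R < 1) (hZ' : ∀ ζ ∈ Z, ζ ∈ ball 0 R)
    (hg : DifferentiableOn ℂ g (ball 0 R)) : DifferentiableOn ℂ (kerMul g Z a) (ball 0 R) :=
  (DifferentiableOn.fun_sum fun ζ hζ =>
    (differentiableOn_dslope_ball (hZ' ζ hζ) hg).const_mul _).add
    (hg.mul (differentiableOn_kerHol hZ))

lemma kerMul_eq (hg : ∀ ζ ∈ Z, g ζ = 0) (hz : z ∉ Z) : kerMul g Z a z = g z * ker Z a z := by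
  rw [kerMul, ker, mul_add, Finset.mul_sum]
  congr 1
  refine Finset.sum_congr rfl fun ζ hζ => ?_
  have hne : z ≠ ζ := fun h => hz (h.symm ▸ hζ)
  rw [dslope_of_ne _ hne, slope_def_field, hg ζ hζ]
  ring

lemma cis_mul_ker (hZ : ∀ ζ ∈ Z, ‖ζ‖ < 1) (θ : ℝ) :
    cis θ * ker Z a (cis θ) = (2 * (∑ ζ ∈ Z, a ζ * (cis θ / (cis θ - ζ))).re : ℝ)
      - conj (∑ ζ ∈ Z, a ζ) := by
  rw [← add_conj, map_sum, map_sum, ker, kerHol, mul_add, Finset.mul_sum, Finset.mul_sum,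
    add_sub_assoc, ← Finset.sum_sub_distrib]
  congr 1
  · exact Finset.sum_congr rfl fun ζ _ => by ring
  · refine Finset.sum_congr rfl fun ζ hζ => ?_
    rw [map_mul, conj_cis_div_sub (hZ ζ hζ)]
    ring

lemma im_cis_mul_ker (hZ : ∀ ζ ∈ Z, ‖ζ‖ < 1) (ha : (∑ ζ ∈ Z, a ζ).im = 0) (θ : ℝ) :
    (cis θ * ker Z a (cis θ)).im = 0 := by
  rw [cis_mul_ker hZ, sub_im, ofReal_im, conj_im, ha]
  simp

lemma continuous_ker_cis (hZ : ∀ ζ ∈ Z, ‖ζ‖ < 1) : Continuous fun θ => ker Z a (cis θ) := by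
  obtain ⟨R, hR, hR'⟩ := exists_one_lt_mul_lt Z hZ
  refine (continuous_finsetSum Z fun ζ hζ => continuous_const.div
    (continuous_cis.sub continuous_const) (cis_sub_ne_zero (hZ ζ hζ))).add
    (continuous_comp_cis hR (differentiableOn_kerHol hR').continuousOn)

lemma integral_hol_mul_cis_mul_ker (hR : 1 < R) (hZ : ∀ ζ ∈ Z, ‖ζ‖ < 1)
    (hF : DifferentiableOn ℂ F (ball 0 R)) :
    ∫ θ in (-π)..π, F (cis θ) * (cis θ * ker Z a (cis θ)) = 2 * π * ∑ ζ ∈ Z, a ζ * F ζ := by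
  obtain ⟨R', hR', hZR⟩ := exists_one_lt_mul_lt Z hZ
  have hR0 : 1 < min R R' := lt_min hR hR'
  have hk := (hF.mono (ball_subset_ball (min_le_left R R'))).mul
    ((differentiableOn_kerHol (a := a) hZR).mono (ball_subset_ball (min_le_right R R')))
  have cF := continuous_comp_cis hR hF.continuousOn
  have h : ∀ θ, F (cis θ) * (cis θ * ker Z a (cis θ)) =
      (∑ ζ ∈ Z, a ζ * (F (cis θ) * (cis θ / (cis θ - ζ)))) +
        F (cis θ) * kerHol Z a (cis θ) * cis θ := fun θ => by
    rw [ker, mul_add, mul_add, Finset.mul_sum, Finset.mul_sum]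
    congr 1
    · exact Finset.sum_congr rfl fun ζ _ => by ring
    · ring
  have cc : ∀ ζ ∈ Z, Continuous fun θ => a ζ * (F (cis θ) * (cis θ / (cis θ - ζ))) := fun ζ hζ =>
    continuous_const.mul (cF.mul (continuous_cis.div (continuous_cis.sub continuous_const)
      (cis_sub_ne_zero (hZ ζ hζ))))
  simp_rw [h]
  rw [integral_add_of_continuous
    (u := fun θ => ∑ ζ ∈ Z, a ζ * (F (cis θ) * (cis θ / (cis θ - ζ))))
    (v := fun θ => F (cis θ) * kerHol Z a (cis θ) * cis θ) (continuous_finsetSum Z cc)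
    ((continuous_comp_cis hR0 hk.continuousOn).mul continuous_cis)]
  rw [intervalIntegral.integral_finsetSum fun ζ hζ => (cc ζ hζ).intervalIntegrable _ _]
  have h0 := integral_hol_mul_cis hR0 hk
  simp only [Pi.mul_apply] at h0
  rw [h0, add_zero, Finset.mul_sum]
  refine Finset.sum_congr rfl fun ζ hζ => ?_
  rw [intervalIntegral.integral_const_mul, integral_hol_mul_cis_div_sub hR (hZ ζ hζ) hF]
  ring

lemma integral_db_mul_ker (hR : 1 < R) (hZR : ∀ ζ ∈ Z, ‖ζ‖ * R < 1)
    (hφ : ContDiffOn ℝ 1 φ (ball 0 R)) (hZ : ∀ ζ ∈ Z, ‖ζ‖ < 1)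
    (hh : ∀ ζ ∈ Z, ∀ᶠ z in 𝓝 ζ, DifferentiableAt ℂ φ z) (h0 : ∀ θ, φ (cis θ) = 0) :
    ∫ z in closedBall (0 : ℂ) 1, db φ z * ker Z a z = -(2 * π * ∑ ζ ∈ Z, a ζ * φ ζ) := by
  have hk := differentiableOn_kerHol (a := a) hZR
  have hk' := contDiffOn_hol (n := 1) isOpen_ball hk
  have hφk : ContDiffOn ℝ 1 (fun z => φ z * kerHol Z a z) (ball 0 R) := hφ.mul hk'
  have e : ∀ z ∈ closedBall (0 : ℂ) 1, db φ z * ker Z a z =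
      (∑ ζ ∈ Z, a ζ * (db φ z / (z - ζ))) + db (fun z => φ z * kerHol Z a z) z := fun z hz => by
    have hz' := closedBall_subset_of_one_lt hR hz
    have hkz := hk.differentiableAt (isOpen_ball.mem_nhds hz')
    rw [db_mul (ContDiffOn.diffAt hφ one_ne_zero isOpen_ball hz') (differentiableAt_real hkz),
      db_hol hkz, ker, mul_add, Finset.mul_sum, mul_zero, add_zero]
    congr 1
    exact Finset.sum_congr rfl fun ζ _ => by ring
  have hp : ∀ ζ ∈ Z, _ := fun ζ hζ => integral_db_div_sub hR hφ (hZ ζ hζ) (hh ζ hζ) h0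
  rw [setIntegral_congr_fun isClosed_closedBall.measurableSet e, integral_add
    (integrable_finsetSum Z fun ζ hζ => (hp ζ hζ).1.const_mul (a ζ))
    (integrableOn_closedBall hR (continuousOn_db isOpen_ball hφk)), integral_db hR hφk,
    integral_finsetSum Z fun ζ hζ => (hp ζ hζ).1.const_mul (a ζ)]
  simp only [h0, zero_mul, intervalIntegral.integral_zero, add_zero]
  rw [Finset.mul_sum, ← Finset.sum_neg_distrib]
  refine Finset.sum_congr rfl fun ζ hζ => ?_
  rw [integral_const_mul, (hp ζ hζ).2]
  ring

end kernel

end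

section

section duality

instance fact_two_pi_pos : Fact (0 < 2 * π) := ⟨Real.two_pi_pos⟩

lemma toCircle_coe (θ : ℝ) : (AddCircle.toCircle (θ : AddCircle (2 * π)) : ℂ) = cis θ := by
  rw [AddCircle.toCircle_apply_mk, div_self Real.two_pi_pos.ne', one_mul, Circle.coe_exp,
    cis_eq_exp]

/-- The boundary values of the real part of a polynomial. -/
noncomputable def rePoly : Polynomial ℂ →ₗ[ℝ] C(AddCircle (2 * π), ℝ) where
  toFun p := ⟨fun x => (p.eval (x.toCircle : ℂ)).re, continuous_re.comp
    (p.continuous.comp (continuous_subtype_val.comp AddCircle.continuous_toCircle))⟩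
  map_add' p q := by ext; simp
  map_smul' c p := by ext; simp

lemma rePoly_apply (p : Polynomial ℂ) (x : AddCircle (2 * π)) :
    rePoly p x = (p.eval (x.toCircle : ℂ)).re := rfl

/-- The real part of a continuous function on the circle. -/
noncomputable def reMap (u : C(AddCircle (2 * π), ℂ)) : C(AddCircle (2 * π), ℝ) :=
  ContinuousMap.comp ⟨re, continuous_re⟩ u

lemma mem_closure_range_rePoly (φ : C(AddCircle (2 * π), ℝ)) :
    φ ∈ closure (range rePoly) := by
  have h1 : ContinuousMap.comp ⟨((↑) : ℝ → ℂ), continuous_ofReal⟩ φ ∈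
      closure (Submodule.span ℂ (range (fourier (T := 2 * π))) : Set C(AddCircle (2 * π), ℂ)) := by
    rw [← Submodule.topologicalClosure_coe, span_fourier_closure_eq_top]; trivial
  have h2 : φ = reMap (ContinuousMap.comp ⟨((↑) : ℝ → ℂ), continuous_ofReal⟩ φ) := by
    ext x; simp [reMap]
  rw [h2]
  refine map_mem_closure (ContinuousMap.continuous_postcomp _) h1 fun u hu => ?_
  suffices ∀ c : ℂ, reMap (c • u) ∈ range rePoly by simpa [reMap] using this 1
  induction hu using Submodule.span_induction with
  | mem u hu =>
    obtain ⟨n, rfl⟩ := hu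
    intro c
    obtain ⟨m, rfl | rfl⟩ := n.eq_nat_or_neg
    · refine ⟨Polynomial.monomial m c, ?_⟩
      ext x
      simp [rePoly_apply, reMap, fourier_apply, AddCircle.toCircle_nsmul]
    · refine ⟨Polynomial.monomial m (conj c), ?_⟩
      ext x
      simp [rePoly_apply, reMap, fourier_apply, AddCircle.toCircle_nsmul, AddCircle.toCircle_neg]
  | zero => exact fun c => ⟨0, by ext; simp [reMap]⟩
  | add u v _ _ hu hv =>
    intro c
    obtain ⟨p, hp⟩ := hu c
    obtain ⟨q, hq⟩ := hv c
    refine ⟨p + q, ?_⟩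
    rw [map_add, hp, hq]
    ext; simp [reMap]
  | smul d u _ hu =>
    intro c
    rw [smul_smul]
    exact hu (c * d)

variable {Z : Finset ℂ} {a : ℂ → ℂ}

lemma continuous_ker_toCircle (hZ : ∀ ζ ∈ Z, ‖ζ‖ < 1) :
    Continuous fun x : AddCircle (2 * π) => (x.toCircle * ker Z a x.toCircle : ℂ).re := by
  have := (continuous_re.comp ((continuous_cis.mul (continuous_ker_cis (a := a) hZ))))
  refine (QuotientAddGroup.isQuotientMap_mk _).continuous_iff.2 (this.congr fun θ => ?_)
  simp only [Function.comp_apply, Pi.mul_apply]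
  rw [← toCircle_coe]

lemma abs_sub_le_sq_div_sqrt {t : ℝ} (ht : 0 < t) (y : ℝ) :
    |y| - t ≤ y / √(y ^ 2 + t ^ 2) * y := by
  have h0 : 0 < √(y ^ 2 + t ^ 2) := Real.sqrt_pos.2 (by positivity)
  have h1 : √(y ^ 2 + t ^ 2) ≤ |y| + t :=
    Real.sqrt_le_iff.2 ⟨by positivity, by nlinarith [sq_abs y, abs_nonneg y]⟩
  rw [div_mul_eq_mul_div, le_div_iff₀ h0]
  by_cases h : |y| ≤ t
  · nlinarith [mul_self_nonneg y]
  · nlinarith [sq_abs y]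

lemma abs_div_sqrt_lt_one {t : ℝ} (ht : 0 < t) (y : ℝ) : |y / √(y ^ 2 + t ^ 2)| < 1 := by
  have h0 : 0 < √(y ^ 2 + t ^ 2) := Real.sqrt_pos.2 (by positivity)
  rw [abs_div, abs_of_pos h0, div_lt_one h0]
  exact Real.lt_sqrt_of_sq_lt (by rw [sq_abs]; nlinarith)

lemma exists_polynomial_of_dual (hZ : ∀ ζ ∈ Z, ‖ζ‖ < 1) (𝒞 : Submodule ℂ (ℂ → ℂ)) (t : ℂ → ℂ)
    {C : ℝ} (hC : 0 ≤ C) (h : ∀ a : ℂ → ℂ, (∀ c ∈ 𝒞, ∑ ζ ∈ Z, a ζ * c ζ = 0) →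
      (∑ ζ ∈ Z, a ζ).im = 0 →
      2 * π * (∑ ζ ∈ Z, a ζ * t ζ).re ≤ C * ∫ θ in (-π)..π, ‖ker Z a (cis θ)‖) :
    ∃ p : Polynomial ℂ, (∀ θ, |(p.eval (cis θ)).re| ≤ C + 1) ∧
      ∃ c ∈ 𝒞, ∀ ζ ∈ Z, p.eval ζ = t ζ + c ζ := by
  classical
  have hinj : InjOn (id : ℂ → ℂ) Z := injOn_id _
  let ip : (ℂ → ℂ) → Polynomial ℂ := Lagrange.interpolate Z id
  have hip : ∀ (r : ℂ → ℂ), ∀ ζ ∈ Z, (ip r).eval ζ = r ζ := fun r ζ hζ =>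
    Lagrange.eval_interpolate_at_node r hinj hζ
  let N : Submodule ℂ (Polynomial ℂ) :=
    { carrier := {p | ∃ c ∈ 𝒞, ∀ ζ ∈ Z, p.eval ζ = c ζ}
      add_mem' := by
        rintro p q ⟨c, hc, hp⟩ ⟨d, hd, hq⟩
        exact ⟨c + d, 𝒞.add_mem hc hd, fun ζ hζ => by simp [hp ζ hζ, hq ζ hζ]⟩
      zero_mem' := ⟨0, 𝒞.zero_mem, fun ζ _ => by simp⟩
      smul_mem' := by
        rintro s p ⟨c, hc, hp⟩
        exact ⟨s • c, 𝒞.smul_mem s hc, fun ζ hζ => by simp [hp ζ hζ]⟩ }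
  let S : Submodule ℝ C(AddCircle (2 * π), ℝ) := (N.restrictScalars ℝ).map rePoly
  set x₀ := rePoly (ip t) with hx₀
  by_cases hdis : Disjoint (ball x₀ (C + 1)) (S : Set C(AddCircle (2 * π), ℝ))
  swap
  · obtain ⟨v, hv, q, ⟨c, hc, hq⟩, rfl⟩ := Set.not_disjoint_iff.1 hdis
    refine ⟨ip t - q, fun θ => ?_, -c, 𝒞.neg_mem hc, fun ζ hζ => ?_⟩
    · have := (rePoly (ip t - q)).norm_coe_le_norm (θ : AddCircle (2 * π))
      rw [rePoly_apply, toCircle_coe, Real.norm_eq_abs, map_sub, ← dist_eq_norm, dist_comm] at this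
      exact this.trans (mem_ball.1 hv).le
    · rw [Polynomial.eval_sub, hip t ζ hζ, hq ζ hζ, Pi.neg_apply, sub_eq_add_neg]
  exfalso
  obtain ⟨f, u, hf, hu⟩ := geometric_hahn_banach_open (convex_ball x₀ (C + 1)) isOpen_ball
    S.convex hdis
  have hu0 : u ≤ 0 := by simpa using hu 0 S.zero_mem
  have hfS : ∀ b ∈ S, f b = 0 := fun b hb => by
    by_contra hne
    have := hu (((u - 1) / f b) • b) (S.smul_mem _ hb)
    rw [map_smul, smul_eq_mul, div_mul_cancel₀ _ hne] at this
    linarith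
  let L : Polynomial ℂ →ₗ[ℂ] ℂ :=
    Module.Dual.extendRCLike (-(f : C(AddCircle (2 * π), ℝ) →ₗ[ℝ] ℝ) ∘ₗ rePoly)
  have hLre : ∀ p, (L p).re = -f (rePoly p) := fun p =>
    Module.Dual.re_extendRCLike_apply (𝕜 := ℂ) _ p
  have hLN : ∀ p ∈ N, L p = 0 := fun p hp => by
    have h1 : f (rePoly p) = 0 := hfS _ ⟨p, hp, rfl⟩
    have h2 : f (rePoly (I • p)) = 0 := hfS _ ⟨I • p, N.smul_mem I hp, rfl⟩
    apply Complex.ext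
    · rw [hLre, h1]; simp
    · have := Module.Dual.im_extendRCLike_apply (𝕜 := ℂ)
        (-(f : C(AddCircle (2 * π), ℝ) →ₗ[ℝ] ℝ) ∘ₗ rePoly) p
      refine this.trans ?_
      simpa using h2
  set a : ℂ → ℂ := fun ζ => L (Lagrange.basis Z id ζ)
  have hLip : ∀ r : ℂ → ℂ, L (ip r) = ∑ ζ ∈ Z, a ζ * r ζ := fun r => by
    simp only [ip, Lagrange.interpolate_apply, a, ← Polynomial.smul_eq_C_mul, map_sum, map_smul,
      smul_eq_mul]
    exact Finset.sum_congr rfl fun _ _ => mul_comm _ _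
  have hLa : ∀ p, L p = ∑ ζ ∈ Z, a ζ * p.eval ζ := fun p => by
    rw [← hLip, ← sub_eq_zero, ← map_sub]
    exact hLN _ ⟨0, 𝒞.zero_mem, fun ζ hζ => by simp [hip _ ζ hζ]⟩
  have ha1 : ∀ c ∈ 𝒞, ∑ ζ ∈ Z, a ζ * c ζ = 0 := fun c hc => by
    rw [← hLip]
    exact hLN _ ⟨c, hc, hip c⟩
  have ha2 : (∑ ζ ∈ Z, a ζ).im = 0 := by
    have h1 := hLre (Polynomial.C I)
    have h2 : rePoly (Polynomial.C I) = 0 := by ext; simp [rePoly_apply]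
    rw [h2, map_zero, neg_zero, hLa] at h1
    simpa [← Finset.sum_mul] using h1
  have h := h a ha1 ha2
  rw [← hLip, hLre] at h
  let y : C(AddCircle (2 * π), ℝ) := ⟨_, continuous_ker_toCircle (a := a) hZ⟩
  have hy : ∀ θ : ℝ, (y θ : ℂ) = cis θ * ker Z a (cis θ) := fun θ => by
    apply Complex.ext
    · rw [ofReal_re, ← toCircle_coe]; rfl
    · rw [im_cis_mul_ker hZ ha2, ofReal_im]
  have hyc : Continuous fun θ : ℝ => y θ := y.continuous.comp (AddCircle.continuous_mk' _)
  have hyn : ∀ θ : ℝ, |y θ| = ‖ker Z a (cis θ)‖ := fun θ => by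
    rw [← Real.norm_eq_abs, ← norm_real, hy, norm_mul, norm_cis, one_mul]
  have hrep : ∀ φ : C(AddCircle (2 * π), ℝ), -f φ * (2 * π) = ∫ θ in (-π)..π, φ θ * y θ := by
    have hcl : IsClosed {φ : C(AddCircle (2 * π), ℝ) |
        -f φ * (2 * π) = ∫ θ in (-π)..π, φ θ * y θ} := by
      refine isClosed_eq (by fun_prop)
        (intervalIntegral.continuous_parametric_intervalIntegral_of_continuous' ?_ _ _)
      simp only [Function.uncurry_def]
      have hm : Continuous fun θ : ℝ => (θ : AddCircle (2 * π)) := AddCircle.continuous_mk' _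
      exact (continuous_fst.eval (hm.comp continuous_snd)).mul (hyc.comp continuous_snd)
    refine fun φ => closure_minimal ?_ hcl (mem_closure_range_rePoly φ)
    rintro _ ⟨p, rfl⟩
    have h1 := congrArg re (integral_hol_mul_cis_mul_ker (a := a) one_lt_two hZ
      (F := fun z => p.eval z) p.differentiable.differentiableOn)
    rw [← hLa] at h1
    have h2 : ∀ θ : ℝ, rePoly p θ * y θ =
        reCLM (p.eval (cis θ) * (cis θ * ker Z a (cis θ))) := fun θ => by
      rw [← hy, reCLM_apply, re_mul_ofReal, rePoly_apply, toCircle_coe]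
    have h3 := reCLM.intervalIntegral_comp_comm (((p.continuous.comp continuous_cis).mul
      (continuous_cis.mul (continuous_ker_cis (a := a) hZ))).intervalIntegrable (μ := volume) (-π)
        π)
    refine Eq.trans ?_ ((intervalIntegral.integral_congr fun θ _ => h2 θ).trans
      (h3.trans h1)).symm
    rw [← hLre]
    have : (2 * π : ℂ) = ((2 * π : ℝ) : ℂ) := by push_cast; rfl
    rw [this, re_ofReal_mul, mul_comm]
  set J := ∫ θ in (-π)..π, ‖ker Z a (cis θ)‖
  have hx0 : f x₀ < 0 := (hf x₀ (mem_ball_self (by linarith))).trans_le hu0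
  have key : ∀ s : ℝ, 0 < s → (C + 1) * (J - 2 * π * s) ≤ -f x₀ * (2 * π) := fun s hs => by
    let v : C(AddCircle (2 * π), ℝ) := ⟨fun x => y x / √(y x ^ 2 + s ^ 2),
      y.continuous.div (by fun_prop) fun x => (Real.sqrt_pos.2 (by positivity)).ne'⟩
    have hv : ‖v‖ < 1 := (ContinuousMap.norm_lt_iff _ one_pos).2 fun x =>
      abs_div_sqrt_lt_one hs (y x)
    have h1 := hf (x₀ - (C + 1) • v) (by
      rw [mem_ball, dist_eq_norm, sub_sub_cancel_left, norm_neg, norm_smul, Real.norm_eq_abs,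
        abs_of_pos (by linarith)]
      nlinarith)
    rw [map_sub, map_smul, smul_eq_mul] at h1
    have h2 : J - 2 * π * s ≤ -f v * (2 * π) := by
      have h3 : J - 2 * π * s = ∫ θ in (-π)..π, (|y θ| - s) := by
        rw [intervalIntegral.integral_sub (hyc.abs.intervalIntegrable _ _) (by simp)]
        simp only [hyn, J, intervalIntegral.integral_const, smul_eq_mul]
        ring
      rw [hrep, h3]
      refine intervalIntegral.integral_mono_on (by linarith [Real.pi_pos])
        ((hyc.abs.sub continuous_const).intervalIntegrable _ _)
        ((((v.continuous.comp (AddCircle.continuous_mk' _)).mul hyc)).intervalIntegrable _ _)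
        fun θ _ => abs_sub_le_sq_div_sqrt hs (y θ)
    have h4 := mul_le_mul_of_nonneg_left h2 (by linarith : 0 ≤ C + 1)
    have h5 := Real.two_pi_pos
    nlinarith
  have hJ : 0 < J := by
    have : 0 < C * J := lt_of_lt_of_le (mul_pos Real.two_pi_pos (by linarith)) h
    exact pos_of_mul_pos_right this hC
  have := key (J / (4 * π * (C + 1))) (by have := Real.pi_pos; positivity)
  have e : (C + 1) * (J - 2 * π * (J / (4 * π * (C + 1)))) = (C + 1) * J - J / 2 := by
    have := Real.pi_pos.ne'
    field_simp
    ring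
  nlinarith

end duality

end

section

section cutoff

/-- A smooth step that vanishes up to `s` and equals one from `s + e` on. -/
noncomputable def stp (s e x : ℝ) : ℝ := Real.smoothTransition ((x - s) / e)

variable {s e x : ℝ}

lemma stp_eq_zero (he : 0 < e) (h : x ≤ s) : stp s e x = 0 :=
  Real.smoothTransition.zero_of_nonpos (div_nonpos_of_nonpos_of_nonneg (by linarith) he.le)

lemma stp_eq_one (he : 0 < e) (h : s + e ≤ x) : stp s e x = 1 :=
  Real.smoothTransition.one_of_one_le ((one_le_div he).2 (by linarith))

lemma contDiff_stp (s e : ℝ) {n : ℕ∞} : ContDiff ℝ n (stp s e) :=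
  Real.smoothTransition.contDiff.comp ((contDiff_id.sub contDiff_const).div_const e)

lemma contDiffAt_of_eventually_differentiableAt {F : ℂ → ℂ} {z : ℂ} {n : ℕ∞ω}
    (h : ∀ᶠ w in 𝓝 z, DifferentiableAt ℂ F w) : ContDiffAt ℝ n F z := by
  obtain ⟨u, hu, huo, hzu⟩ := _root_.mem_nhds_iff.1 h
  exact (contDiffOn_hol huo fun w hw => (hu hw).differentiableWithinAt).contDiffAt
    (huo.mem_nhds hzu)

lemma contDiffOn_cutoff {U : Set ℂ} {F : ℂ → ℂ} {u : ℂ → ℝ} {n : ℕ∞ω} (hU : IsOpen U)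
    (hu : ContDiffOn ℝ n u U)
    (h : ∀ z ∈ U, (∀ᶠ w in 𝓝 z, u w = 0) ∨ ∀ᶠ w in 𝓝 z, DifferentiableAt ℂ F w) :
    ContDiffOn ℝ n (fun z => (u z : ℂ) * F z) U := fun z hz => by
  refine ContDiffAt.contDiffWithinAt ?_
  rcases h z hz with h | h
  · refine (contDiffAt_const (c := (0 : ℂ))).congr_of_eventuallyEq ?_
    filter_upwards [h] with w hw
    simp [hw]
  · exact (ofRealCLM.contDiff.contDiffAt.comp z (hu.contDiffAt (hU.mem_nhds hz))).mul
      (contDiffAt_of_eventually_differentiableAt h)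

end cutoff

/-- The normalised data of the corona problem with `g` a finite Blaschke product. -/
structure Nice (R e η : ℝ) (f g : ℂ → ℂ) (Z : Finset ℂ) : Prop where
  hR : 1 < R
  he : 0 < e
  he1 : 6 * e ≤ 1
  hη : 0 < η
  hη1 : η ≤ 1
  hf : DifferentiableOn ℂ f (ball 0 R)
  hf1 : ∀ z ∈ closedBall (0 : ℂ) 1, ‖f z‖ ≤ 1
  hg : DifferentiableOn ℂ g (ball 0 R)
  hg1 : ∀ z ∈ closedBall (0 : ℂ) 1, ‖g z‖ ≤ 1
  hgo : ∀ z ∈ ball (0 : ℂ) R, 1 ≤ ‖z‖ → 1 ≤ normSq (g z)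
  hZ : ∀ ζ ∈ Z, ‖ζ‖ < 1
  hZR : ∀ ζ ∈ Z, ‖ζ‖ * R < 1
  hZ0 : ∀ ζ ∈ Z, g ζ = 0
  hcor : ∀ z ∈ closedBall (0 : ℂ) 1, normSq (g z) < 6 * e → η ≤ ‖f z‖

namespace Nice

variable {R e η x : ℝ} {f g l Q F : ℂ → ℂ} {Z : Finset ℂ} {a : ℂ → ℂ} {z : ℂ}

lemma isOpen_gt (N : Nice R e η f g Z) (x : ℝ) :
    IsOpen {z | z ∈ ball (0 : ℂ) R ∧ x < normSq (g z)} :=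
  (continuous_normSq.comp_continuousOn N.hg.continuousOn).isOpen_inter_preimage isOpen_ball
    isOpen_Ioi

lemma isOpen_lt (N : Nice R e η f g Z) (x : ℝ) :
    IsOpen {z | z ∈ ball (0 : ℂ) 1 ∧ normSq (g z) < x} :=
  ((continuous_normSq.comp_continuousOn N.hg.continuousOn).mono
    (ball_subset_ball N.hR.le)).isOpen_inter_preimage isOpen_ball isOpen_Iio

lemma mem_ball_of_lt (N : Nice R e η f g Z) (hz : z ∈ ball (0 : ℂ) R) (h : normSq (g z) < 1) :
    z ∈ ball (0 : ℂ) 1 := by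
  by_contra hz1
  exact absurd (N.hgo z hz (by simpa using hz1)) (not_le.2 h)

lemma not_mem_of_lt (N : Nice R e η f g Z) (h : 0 < normSq (g z)) : z ∉ Z := fun hz => by
  rw [N.hZ0 z hz, map_zero] at h
  exact lt_irrefl _ h

lemma normSq_cis (N : Nice R e η f g Z) (θ : ℝ) : 1 ≤ normSq (g (cis θ)) :=
  N.hgo _ (cis_mem N.hR θ) (by simp)

lemma exists_Q (N : Nice R e η f g Z)
    (ha : ∀ c, LocConst {z | z ∈ ball (0 : ℂ) 1 ∧ normSq (g z) < e} c → ∑ ζ ∈ Z, a ζ * c ζ = 0) :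
    ∃ Q : ℂ → ℂ, (∀ z ∈ ball (0 : ℂ) R, e < normSq (g z) → HasDerivAt Q (-I * ker Z a z) z) ∧
      ∀ θ, (Q (cis θ)).im = 0 := by
  obtain ⟨L, hL⟩ := exists_primitive_of_sum_eq_zero
    (Ω := {z | z ∈ ball (0 : ℂ) R ∧ e < normSq (g z)})
    (N.isOpen_lt e) (Set.disjoint_left.2 fun z h1 h2 => absurd h1.2 (not_lt.2 h2.2.le)) Z a ha
  obtain ⟨W, hW⟩ := (differentiableOn_kerHol (a := a) N.hZR).isExactOn_ball
  have ha1 : ∑ ζ ∈ Z, a ζ = 0 := by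
    simpa using ha (fun _ => 1) fun z _ => Filter.Eventually.of_forall fun _ => rfl
  set Q₀ : ℂ → ℂ := fun z => -I * (L z + W z)
  have hQ₀ : ∀ z ∈ ball (0 : ℂ) R, e < normSq (g z) → HasDerivAt Q₀ (-I * ker Z a z) z :=
    fun z hz h => ((hL z ⟨hz, h⟩).add (hW z hz)).const_mul _
  have hd : ∀ θ : ℝ, HasDerivAt (fun θ => (Q₀ (cis θ)).im) 0 θ := fun θ => by
    have h1 := (hQ₀ (cis θ) (cis_mem N.hR θ) (by linarith [N.normSq_cis θ, N.he, N.he1])).scomp θ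
      (hasDerivAt_cis θ)
    have h2 := imCLM.hasFDerivAt.comp_hasDerivAt θ h1
    refine h2.congr_deriv ?_
    rw [imCLM_apply, smul_eq_mul, ← im_cis_mul_ker (a := a) N.hZ (by simp [ha1]) θ]
    congr 1
    linear_combination -(cis θ * ker Z a (cis θ)) * I_mul_I
  have hc : ∀ θ, (Q₀ (cis θ)).im = (Q₀ (cis 0)).im := fun θ =>
    is_const_of_deriv_eq_zero (fun θ => (hd θ).differentiableAt) (fun θ => (hd θ).deriv) θ 0
  refine ⟨fun z => Q₀ z - I * (Q₀ (cis 0)).im, fun z hz h => (hQ₀ z hz h).sub_const _, fun θ => ?_⟩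
  rw [sub_im, hc θ]
  simp

lemma eventually_gt (N : Nice R e η f g Z) (hz : z ∈ ball (0 : ℂ) R) (h : x < normSq (g z)) :
    ∀ᶠ w in 𝓝 z, w ∈ ball (0 : ℂ) R ∧ x < normSq (g w) :=
  (N.isOpen_gt x).mem_nhds ⟨hz, h⟩

lemma eventually_lt (N : Nice R e η f g Z) (hz : z ∈ ball (0 : ℂ) 1) (h : normSq (g z) < x) :
    ∀ᶠ w in 𝓝 z, w ∈ ball (0 : ℂ) 1 ∧ normSq (g w) < x :=
  (N.isOpen_lt x).mem_nhds ⟨hz, h⟩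

/-- A function cut off to the part of the disc where `g` is large. -/
noncomputable def cutGt (e : ℝ) (g Q : ℂ → ℂ) (z : ℂ) : ℂ :=
  (stp (2 * e) e (normSq (g z)) : ℝ) * Q z

/-- A function cut off to the part of the disc where `g` is small. -/
noncomputable def cutLt (s e : ℝ) (g l : ℂ → ℂ) (z : ℂ) : ℂ :=
  ((1 - stp s e (normSq (g z)) : ℝ) : ℂ) * l z

lemma contDiffOn_stp (N : Nice R e η f g Z) (s e' : ℝ) {n : ℕ∞} :
    ContDiffOn ℝ n (fun z => stp s e' (normSq (g z))) (ball 0 R) :=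
  (contDiff_stp s e').comp_contDiffOn (contDiffOn_normSq isOpen_ball N.hg)

lemma contDiffOn_cutGt (N : Nice R e η f g Z)
    (hQ : ∀ z ∈ ball (0 : ℂ) R, e < normSq (g z) → DifferentiableAt ℂ Q z) {n : ℕ∞} :
    ContDiffOn ℝ n (cutGt e g Q) (ball 0 R) := by
  refine contDiffOn_cutoff isOpen_ball (N.contDiffOn_stp _ _) fun z hz => ?_
  rcases lt_or_ge e (normSq (g z)) with h | h
  · exact Or.inr ((N.eventually_gt hz h).mono fun w hw => hQ w hw.1 hw.2)
  · refine Or.inl ((N.eventually_lt (x := 2 * e) (N.mem_ball_of_lt hz ?_) ?_).mono fun w hw =>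
      stp_eq_zero N.he hw.2.le) <;> linarith [N.he, N.he1]

lemma cutGt_eventuallyEq (N : Nice R e η f g Z) (hz : z ∈ ball (0 : ℂ) R)
    (h : 3 * e < normSq (g z)) : cutGt e g Q =ᶠ[𝓝 z] Q :=
  (N.eventually_gt hz h).mono fun w hw => by
    rw [cutGt, stp_eq_one N.he (by linarith [hw.2]), ofReal_one, one_mul]

lemma contDiffOn_cutLt (N : Nice R e η f g Z) {s e' : ℝ} (he' : 0 < e') (h1 : s + e' < x)
    (hx : x ≤ 1)
    (hl : ∀ z ∈ ball (0 : ℂ) 1, normSq (g z) < x → DifferentiableAt ℂ l z) {n : ℕ∞} :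
    ContDiffOn ℝ n (cutLt s e' g l) (ball 0 R) := by
  refine contDiffOn_cutoff isOpen_ball (contDiffOn_const.sub (N.contDiffOn_stp _ _)) fun z hz => ?_
  rcases lt_or_ge (normSq (g z)) x with h | h
  · exact Or.inr ((N.eventually_lt (N.mem_ball_of_lt hz (h.trans_le hx)) h).mono
      fun w hw => hl w hw.1 hw.2)
  · exact Or.inl ((N.eventually_gt hz (h1.trans_le h)).mono fun w hw => by
      simp [stp_eq_one he' hw.2.le])

lemma cutLt_eventuallyEq (N : Nice R e η f g Z) {s e' : ℝ} (he' : 0 < e') (hz : z ∈ ball (0 : ℂ) 1)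
    (h : normSq (g z) < s) : cutLt s e' g l =ᶠ[𝓝 z] l :=
  (N.eventually_lt hz h).mono fun w hw => by
    rw [cutLt, stp_eq_zero he' hw.2.le, sub_zero, ofReal_one, one_mul]

lemma cutLt_cis (N : Nice R e η f g Z) {s e' : ℝ} (he' : 0 < e') (h : s + e' ≤ 1) (θ : ℝ) :
    cutLt s e' g l (cis θ) = 0 := by
  rw [cutLt, stp_eq_one he' (h.trans (N.normSq_cis θ))]
  simp

end Nice

end

section

lemma lap_im_hol {U : Set ℂ} {h : ℂ → ℂ} {z : ℂ} (hU : IsOpen U) (hh : DifferentiableOn ℂ h U)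
    (hz : z ∈ U) : lap (fun z => (h z).im) z = 0 := by
  have hd := fun w hw => hh.differentiableAt (hU.mem_nhds (x := w) hw)
  have hd' : DifferentiableAt ℂ (deriv h) z := (hh.deriv hU).differentiableAt (hU.mem_nhds hz)
  have e1 : dX (fun z => (h z).im) =ᶠ[𝓝 z] fun z => (deriv h z).im :=
    Filter.eventually_of_mem (hU.mem_nhds hz) fun w hw => by
      rw [dX_im (differentiableAt_real (hd w hw)), dX_hol (hd w hw)]
  have e2 : dY (fun z => (h z).im) =ᶠ[𝓝 z] fun z => (I * deriv h z).im :=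
    Filter.eventually_of_mem (hU.mem_nhds hz) fun w hw => by
      rw [dY_im (differentiableAt_real (hd w hw)), dY_hol (hd w hw)]
  rw [lap, dX_congr e1, dY_congr e2, dX_im (differentiableAt_real hd'),
    dY_im (differentiableAt_real (hd'.const_mul I)), dX_hol hd', dY_hol (hd'.const_mul I),
    deriv_const_mul _ hd', ← mul_assoc, I_mul_I]
  simp

lemma integral_mono_pi {u v : ℝ → ℝ} (hu : Continuous u) (hv : Continuous v)
    (h : ∀ θ, u θ ≤ v θ) : ∫ θ in (-π)..π, u θ ≤ ∫ θ in (-π)..π, v θ :=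
  intervalIntegral.integral_mono (by linarith [Real.pi_pos]) (hu.intervalIntegrable _ _)
    (hv.intervalIntegrable _ _) h

namespace Nice

variable {R e η x : ℝ} {f g l Q F : ℂ → ℂ} {Z : Finset ℂ} {a : ℂ → ℂ} {z : ℂ}

lemma mem_ball_of_mem_closedBall (N : Nice R e η f g Z) (hz : z ∈ closedBall (0 : ℂ) 1) :
    z ∈ ball (0 : ℂ) R := closedBall_subset_of_one_lt N.hR hz

lemma integral_abs_mul_lap_le (N : Nice R e η f g Z) {M : ℝ} {P : ℂ → ℝ} (hM : 0 ≤ M)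
    (hMη : Real.log 3 / 2 - Real.log η ≤ M)
    (hP : ContDiffOn ℝ 2 P (ball 0 R))
    (hPX : ∀ z ∈ closedBall (0 : ℂ) 1, 3 * e < normSq (g z) → dX P z = -(ker Z a z).re)
    (hPY : ∀ z ∈ closedBall (0 : ℂ) 1, 3 * e < normSq (g z) → dY P z = (ker Z a z).im)
    (hPl : ∀ z ∈ closedBall (0 : ℂ) 1, 3 * e < normSq (g z) → lap P z = 0)
    (hP0 : ∀ θ, P (cis θ) = 0) :
    ∫ z in closedBall (0 : ℂ) 1, |P z| * lap (fun z => vlog η (normSq (f z))) z ≤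
      ((3 * e) ^ 3)⁻¹ * (1000 * (1 + M) * (6 + 10 * M ^ 2)) *
        ∫ θ in (-π)..π, ‖ker Z a (cis θ)‖ := by
  set V : ℂ → ℝ := fun z => vlog η (normSq (f z)) with hVdef
  have hV : ContDiffOn ℝ 2 V (ball 0 R) := contDiffOn_vlog isOpen_ball N.hf
  have he := N.he
  have hk : ∀ z, 3 * e < normSq (g z) → kerMul g Z a z = g z * ker Z a z := fun z h =>
    kerMul_eq N.hZ0 (N.not_mem_of_lt (by linarith))
  have hkd : ∀ z, 3 * e < normSq (g z) → kerMul g Z a z / g z = ker Z a z := fun z h => by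
    have : g z ≠ 0 := normSq_pos.1 (by linarith)
    rw [hk z h, mul_div_cancel_left₀ _ this]
  have hVl : ∀ z ∈ closedBall (0 : ℂ) 1, 0 ≤ lap V z := fun z hz =>
    lap_vlog_nonneg N.hη isOpen_ball N.hf (N.mem_ball_of_mem_closedBall hz)
  have hkm : DifferentiableOn ℂ (kerMul g Z a) (ball 0 R) :=
    differentiableOn_kerMul N.hZR (fun ζ hζ => ball_subset_ball N.hR.le (by simpa using N.hZ ζ hζ))
      N.hg
  have key := integral_abs_lap_le (M := M) (x0 := 3 * e) N.hR hM (by linarith) N.hg hkm N.hg1 hV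
    (fun z hz => by
      have : -(Real.log 3 / 2 - Real.log η) ≤ V z := vlog_ge _
      linarith)
    (fun z hz => vlog_nonpos N.hη N.hη1 (normSq_nonneg _) (by
      rw [normSq_eq_norm_sq]; exact pow_le_one₀ (norm_nonneg _) (N.hf1 z hz))) hVl hP
    (fun z hz h => by rw [hPX z hz h, hkd z h]) (fun z hz h => by rw [hPY z hz h, hkd z h])
    hPl hP0
  have hlapc := contDiffOn_lap isOpen_ball hV
  have hcut : ContinuousOn (cut (3 * e) g) (ball 0 R) :=
    ((continuous_normSq.comp_continuousOn N.hg.continuousOn).sub continuousOn_const).sup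
      continuousOn_const
  have h1 : ∫ z in closedBall (0 : ℂ) 1, |P z| * lap V z ≤
      ∫ z in closedBall (0 : ℂ) 1, ((3 * e) ^ 3)⁻¹ * (cut (3 * e) g z ^ 3 * |P z| * lap V z) := by
    refine setIntegral_mono_closedBall N.hR (hP.continuousOn.abs.mul hlapc)
      (continuousOn_const.mul (((hcut.pow 3).mul hP.continuousOn.abs).mul hlapc)) fun z hz => ?_
    rcases le_or_gt η ‖f z‖ with h | h
    · have : lap V z = 0 := lap_vlog_eq_zero N.hη isOpen_ball N.hf
        (N.mem_ball_of_mem_closedBall hz) h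
      simp [this]
    · have h6 : 6 * e ≤ normSq (g z) := not_lt.1 fun h' => absurd (N.hcor z hz h') (not_le.2 h)
      have hc : 3 * e ≤ cut (3 * e) g z := le_max_of_le_left (by linarith)
      have h3 : (3 * e) ^ 3 ≤ cut (3 * e) g z ^ 3 := pow_le_pow_left₀ (by linarith) hc 3
      have hp : (0 : ℝ) < (3 * e) ^ 3 := by positivity
      rw [inv_mul_eq_div, le_div_iff₀ hp]
      nlinarith [mul_le_mul_of_nonneg_right h3 (mul_nonneg (abs_nonneg (P z)) (hVl z hz))]
  refine h1.trans ?_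
  rw [integral_const_mul, mul_assoc]
  refine mul_le_mul_of_nonneg_left (key.trans ?_) (by positivity)
  refine mul_le_mul_of_nonneg_left ?_ (by positivity)
  refine integral_mono_pi ?_ ?_ fun θ => ?_
  · exact (continuous_comp_cis N.hR hkm.continuousOn).norm
  · exact (continuous_ker_cis N.hZ).norm
  · rw [hk _ (by linarith [N.normSq_cis θ, N.he1]), norm_mul]
    exact mul_le_of_le_one_left (norm_nonneg _) (N.hg1 _ (by simp))

lemma deriv_log (hl : ∀ᶠ w in 𝓝 z, DifferentiableAt ℂ l w ∧ exp (l w) = f w) :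
    deriv l z = deriv f z / f z := by
  have h1 : HasDerivAt (fun w => exp (l w)) (exp (l z) * deriv l z) z :=
    (hl.self_of_nhds.1.hasDerivAt).cexp
  have h2 : (fun w => exp (l w)) =ᶠ[𝓝 z] f := hl.mono fun w hw => hw.2
  rw [← h2.deriv_eq, h1.deriv, ← hl.self_of_nhds.2, mul_div_cancel_left₀ _ (exp_ne_zero _)]

/-- The pairing of a residue vector with a logarithm of `f` is bounded by the boundary norm. -/
lemma re_sum_mul_log_le (N : Nice R e η f g Z) {M : ℝ} (hM : 0 ≤ M)
    (hMη : Real.log 3 / 2 - Real.log η ≤ M)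
    (hl : ∀ z ∈ ball (0 : ℂ) 1, normSq (g z) < 11 / 2 * e → DifferentiableAt ℂ l z)
    (hl' : ∀ z ∈ ball (0 : ℂ) 1, normSq (g z) < 11 / 2 * e → exp (l z) = f z)
    (ha : ∀ c, LocConst {z | z ∈ ball (0 : ℂ) 1 ∧ normSq (g z) < e} c → ∑ ζ ∈ Z, a ζ * c ζ = 0) :
    2 * π * (∑ ζ ∈ Z, a ζ * l ζ).re ≤
      (M + ((3 * e) ^ 3)⁻¹ * (1000 * (1 + M) * (6 + 10 * M ^ 2))) *
        ∫ θ in (-π)..π, ‖ker Z a (cis θ)‖ := by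
  have he := N.he
  have he1 := N.he1
  obtain ⟨Q, hQ, hQ0⟩ := N.exists_Q ha
  set q := cutGt e g Q with hq
  set φ := cutLt (4 * e) e g l with hφ
  set V : ℂ → ℝ := fun z => vlog η (normSq (f z)) with hVdef
  have hV : ContDiffOn ℝ 2 V (ball 0 R) := contDiffOn_vlog isOpen_ball N.hf
  have hqC : ContDiffOn ℝ 2 q (ball 0 R) :=
    N.contDiffOn_cutGt (n := 2) fun z hz h => (hQ z hz h).differentiableAt
  have hφC : ContDiffOn ℝ 1 φ (ball 0 R) :=
    N.contDiffOn_cutLt (n := 1) he (x := 11 / 2 * e) (by linarith) (by linarith) hl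
  have hqd : ∀ z ∈ ball (0 : ℂ) R, DifferentiableAt ℝ q z := fun z hz =>
    ContDiffOn.diffAt hqC two_ne_zero isOpen_ball hz
  have hφ0 : ∀ θ, φ (cis θ) = 0 := N.cutLt_cis he (by linarith)
  have hqX : ∀ z ∈ ball (0 : ℂ) R, 3 * e < normSq (g z) → dX q z = -I * ker Z a z :=
    fun z hz h => by
      have hd := hQ z hz (by linarith)
      rw [dX_congr (N.cutGt_eventuallyEq hz h), dX_hol hd.differentiableAt, hd.deriv]
  have hqY : ∀ z ∈ ball (0 : ℂ) R, 3 * e < normSq (g z) → dY q z = ker Z a z :=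
    fun z hz h => by
      have hd := hQ z hz (by linarith)
      rw [dY_congr (N.cutGt_eventuallyEq hz h), dY_hol hd.differentiableAt, hd.deriv]
      linear_combination -ker Z a z * I_mul_I
  set S : ℂ → ℝ := fun z => (q z).re with hS
  set P : ℂ → ℝ := fun z => (q z).im with hPdef
  have hSC : ContDiffOn ℝ 2 S (ball 0 R) := reCLM.contDiff.comp_contDiffOn hqC
  have hPC : ContDiffOn ℝ 2 P (ball 0 R) := imCLM.contDiff.comp_contDiffOn hqC
  have hP0 : ∀ θ, P (cis θ) = 0 := fun θ => by
    change (q (cis θ)).im = 0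
    have h := (N.cutGt_eventuallyEq (Q := Q) (cis_mem N.hR θ)
      (by linarith [N.normSq_cis θ])).self_of_nhds
    rw [hq, h, hQ0]
  have hPl : ∀ z ∈ closedBall (0 : ℂ) 1, 3 * e < normSq (g z) → lap P z = 0 := fun z hz h =>
    lap_im_hol (N.isOpen_gt (3 * e)) (fun w hw => ((hQ w hw.1 (by linarith [hw.2])).differentiableAt
      |>.congr_of_eventuallyEq (N.cutGt_eventuallyEq hw.1 hw.2)).differentiableWithinAt)
      ⟨N.mem_ball_of_mem_closedBall hz, h⟩
  have hlap := N.integral_abs_mul_lap_le (a := a) hM hMη hPC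
    (fun z hz h => by
      rw [hPdef, dX_im (hqd z (N.mem_ball_of_mem_closedBall hz)),
        hqX z (N.mem_ball_of_mem_closedBall hz) h]; simp)
    (fun z hz h => by
      rw [hPdef, dY_im (hqd z (N.mem_ball_of_mem_closedBall hz)),
        hqY z (N.mem_ball_of_mem_closedBall hz) h]) hPl hP0
  set W : ℂ → ℂ := fun z => (((dX V z : ℝ) : ℂ) - I * (dY V z : ℝ)) * (dX q z + I * dY q z) with hW
  have hcX : ContinuousOn (dX V) (ball 0 R) :=
    (contDiffOn_dX (m := 1) isOpen_ball hV (by norm_num)).continuousOn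
  have hcY : ContinuousOn (dY V) (ball 0 R) :=
    (contDiffOn_dY (m := 1) isOpen_ball hV (by norm_num)).continuousOn
  have hqcX : ContinuousOn (dX q) (ball 0 R) :=
    (contDiffOn_dX (m := 1) isOpen_ball hqC (by norm_num)).continuousOn
  have hqcY : ContinuousOn (dY q) (ball 0 R) :=
    (contDiffOn_dY (m := 1) isOpen_ball hqC (by norm_num)).continuousOn
  have hφcX : ContinuousOn (dX φ) (ball 0 R) :=
    (contDiffOn_dX (m := 0) isOpen_ball hφC (by norm_num)).continuousOn
  have hφcY : ContinuousOn (dY φ) (ball 0 R) :=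
    (contDiffOn_dY (m := 0) isOpen_ball hφC (by norm_num)).continuousOn
  have hWc : ContinuousOn W (ball 0 R) :=
    ((continuous_ofReal.comp_continuousOn hcX).sub
      (continuousOn_const.mul (continuous_ofReal.comp_continuousOn hcY))).mul
      (hqcX.add (continuousOn_const.mul hqcY))
  have hpt : ∀ z ∈ closedBall (0 : ℂ) 1, db φ z * ker Z a z =
      (dX φ z * dY q z - dY φ z * dX q z) + I * W z := fun z hz => by
    have hzR := N.mem_ball_of_mem_closedBall hz
    rcases lt_or_ge (normSq (g z)) (4 * e) with h | h
    · have hz1 := N.mem_ball_of_lt hzR (by linarith)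
      have hev := (N.eventually_lt hz1 (x := 11 / 2 * e) (by linarith)).mono fun w hw =>
        (⟨hl w hw.1 hw.2, hl' w hw.1 hw.2⟩ : DifferentiableAt ℂ l w ∧ exp (l w) = f w)
      have hlz := hev.self_of_nhds.1
      have hη := N.hcor z hz (by linarith)
      have heq := N.cutLt_eventuallyEq (l := l) he hz1 h
      have hd : deriv l z = ((dX V z : ℝ) : ℂ) - I * (dY V z : ℝ) := by
        rw [deriv_log hev, hVdef, dX_vlog N.hη isOpen_ball N.hf hzR hη,
          dY_vlog N.hη isOpen_ball N.hf hzR hη]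
        apply Complex.ext <;> simp
      rw [db_congr heq, db_hol hlz, dX_congr heq, dY_congr heq, dX_hol hlz, dY_hol hlz, hW, hd]
      linear_combination -(((dX V z : ℝ) : ℂ) - I * (dY V z : ℝ)) * dY q z * I_mul_I
    · have h3 : 3 * e < normSq (g z) := by linarith
      have hW0 : W z = 0 := by
        change _ * (dX q z + I * dY q z) = 0
        rw [hqX z hzR h3, hqY z hzR h3]
        ring
      rw [hW0, db, hqX z hzR h3, hqY z hzR h3]
      ring
  have hJ := integral_jacobian N.hR hφC hqC
  simp only [hφ0, zero_mul, intervalIntegral.integral_zero] at hJ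
  have hK := integral_db_mul_ker (a := a) N.hR N.hZR hφC N.hZ (fun ζ hζ => by
    have hζ1 : ζ ∈ ball (0 : ℂ) 1 := by simpa using N.hZ ζ hζ
    have hζ0 : normSq (g ζ) < 4 * e := by rw [N.hZ0 ζ hζ, map_zero]; linarith
    have h1 := (N.cutLt_eventuallyEq (l := l) he hζ1 hζ0).eventuallyEq_nhds
    filter_upwards [h1, N.eventually_lt hζ1 hζ0] with w hw hw2
    exact (hl w hw2.1 (by linarith [hw2.2])).congr_of_eventuallyEq hw) hφ0
  have hJi : IntegrableOn (fun z => dX φ z * dY q z - dY φ z * dX q z) (closedBall 0 1) :=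
    integrableOn_closedBall N.hR ((hφcX.mul hqcY).sub (hφcY.mul hqcX))
  have hWi : IntegrableOn W (closedBall 0 1) := integrableOn_closedBall N.hR hWc
  rw [setIntegral_congr_fun isClosed_closedBall.measurableSet hpt,
    integral_add (f := fun z => dX φ z * dY q z - dY φ z * dX q z) (g := fun z => I * W z) hJi
    (hWi.const_mul I), hJ, zero_add, integral_const_mul] at hK
  have hφZ : ∑ ζ ∈ Z, a ζ * φ ζ = ∑ ζ ∈ Z, a ζ * l ζ := Finset.sum_congr rfl fun ζ hζ => by
    rw [hφ, (N.cutLt_eventuallyEq (l := l) he (by simpa using N.hZ ζ hζ)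
      (by rw [N.hZ0 ζ hζ, map_zero]; linarith)).self_of_nhds]
  rw [hφZ] at hK
  have hre : 2 * π * (∑ ζ ∈ Z, a ζ * l ζ).re = ∫ z in closedBall (0 : ℂ) 1, (W z).im := by
    have h1 : ∫ z in closedBall (0 : ℂ) 1, (W z).im = (∫ z in closedBall (0 : ℂ) 1, W z).im :=
      integral_im hWi
    have h2 := congrArg Complex.re hK
    have h3 : (2 * π * ∑ ζ ∈ Z, a ζ * l ζ : ℂ).re = 2 * π * (∑ ζ ∈ Z, a ζ * l ζ).re := by
      rw [← re_ofReal_mul]; push_cast; rfl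
    rw [neg_re, I_mul_re, h3] at h2
    linarith
  have hWim : ∀ z ∈ closedBall (0 : ℂ) 1, (W z).im =
      ((P z * lap V z + gr P V z) + (dX V z * dY S z - dY V z * dX S z)) - P z * lap V z :=
    fun z hz => by
    have hzR := N.mem_ball_of_mem_closedBall hz
    rw [gr, hPdef, hS, dX_im (hqd z hzR), dY_im (hqd z hzR), dX_re (hqd z hzR), dY_re (hqd z hzR),
      hW]
    simp
    ring
  have hlapc := contDiffOn_lap isOpen_ball hV
  have hG := green_first N.hR (hPC.of_le (by norm_num)) hV
  simp only [hP0, zero_mul, intervalIntegral.integral_zero] at hG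
  have hJ2 := integral_jacobian N.hR (hV.of_le (m := 1) (by norm_num)) hSC
  have hi1 : IntegrableOn (fun z => P z * lap V z) (closedBall 0 1) :=
    integrableOn_closedBall N.hR (hPC.continuousOn.mul hlapc)
  have hi2 : IntegrableOn (fun z => P z * lap V z + gr P V z) (closedBall 0 1) :=
    integrableOn_closedBall N.hR ((hPC.continuousOn.mul hlapc).add
      (continuousOn_gr isOpen_ball (hPC.of_le (by norm_num)) (hV.of_le (by norm_num))))
  have hScX : ContinuousOn (dX S) (ball 0 R) :=
    (contDiffOn_dX (m := 1) isOpen_ball hSC (by norm_num)).continuousOn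
  have hScY : ContinuousOn (dY S) (ball 0 R) :=
    (contDiffOn_dY (m := 1) isOpen_ball hSC (by norm_num)).continuousOn
  have hi3 : IntegrableOn (fun z => dX V z * dY S z - dY V z * dX S z) (closedBall 0 1) :=
    integrableOn_closedBall N.hR ((hcX.mul hScY).sub (hcY.mul hScX))
  rw [hre, setIntegral_congr_fun isClosed_closedBall.measurableSet hWim,
    integral_sub (f := fun z => (P z * lap V z + gr P V z) + (dX V z * dY S z - dY V z * dX S z))
      (hi2.add hi3) hi1,
    integral_add (f := fun z => P z * lap V z + gr P V z) hi2 hi3, hG, hJ2, zero_add, add_mul]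
  have hb1 : ∫ θ in (-π)..π, V (cis θ) * (Real.cos θ • dY S (cis θ) - Real.sin θ • dX S (cis θ)) ≤
      M * ∫ θ in (-π)..π, ‖ker Z a (cis θ)‖ := by
    rw [← intervalIntegral.integral_const_mul]
    refine integral_mono_pi ?_ ?_ fun θ => ?_
    · exact (continuous_comp_cis N.hR hV.continuousOn).mul
        ((Real.continuous_cos.smul (continuous_comp_cis N.hR hScY)).sub
          (Real.continuous_sin.smul (continuous_comp_cis N.hR hScX)))
    · exact (continuous_ker_cis N.hZ).norm.const_mul M
    · have hc := cis_mem N.hR θ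
      have h3 : 3 * e < normSq (g (cis θ)) := by linarith [N.normSq_cis θ]
      have hT : cis θ ∈ closedBall (0 : ℂ) 1 := by simp
      have h1 : Real.cos θ • dY S (cis θ) - Real.sin θ • dX S (cis θ) =
          (cis θ * ker Z a (cis θ)).re := by
        rw [hS, dX_re (hqd _ hc), dY_re (hqd _ hc), hqX _ hc h3, hqY _ hc h3]
        simp [cis_re, cis_im]
      have hV1 : |V (cis θ)| ≤ M := by
        have hge : -(Real.log 3 / 2 - Real.log η) ≤ V (cis θ) := vlog_ge _
        have hle : V (cis θ) ≤ 0 := vlog_nonpos N.hη N.hη1 (normSq_nonneg _) (by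
          rw [normSq_eq_norm_sq]; exact pow_le_one₀ (norm_nonneg _) (N.hf1 _ hT))
        exact abs_le.2 ⟨by linarith, by linarith⟩
      rw [h1]
      refine (le_abs_self _).trans ?_
      rw [abs_mul]
      refine mul_le_mul hV1 ((abs_re_le_norm _).trans ?_) (abs_nonneg _) hM
      rw [norm_mul, norm_cis, one_mul]
  have hb2 : -∫ z in closedBall (0 : ℂ) 1, P z * lap V z ≤
      ∫ z in closedBall (0 : ℂ) 1, |P z| * lap V z := by
    rw [← integral_neg]
    refine setIntegral_mono_closedBall N.hR (hPC.continuousOn.mul hlapc).neg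
      (hPC.continuousOn.abs.mul hlapc) fun z hz => ?_
    have : 0 ≤ lap V z := lap_vlog_nonneg N.hη isOpen_ball N.hf (N.mem_ball_of_mem_closedBall hz)
    nlinarith [neg_abs_le (P z)]
  linarith

end Nice

end

section

lemma LocConst.differentiableAt {U : Set ℂ} {c : ℂ → ℂ} {z : ℂ} (hc : LocConst U c) (hz : z ∈ U) :
    DifferentiableAt ℂ c z :=
  (differentiableAt_const (c z)).congr_of_eventuallyEq (hc z hz)

lemma exists_bound_deriv_stp (s e : ℝ) : ∃ B, 0 ≤ B ∧ ∀ x ∈ Icc (0 : ℝ) 1,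
    |deriv (stp s e) x| ≤ B ∧ |deriv (deriv (stp s e)) x| ≤ B := by
  have h1 : ContDiff ℝ 1 (deriv (stp s e)) := (contDiff_stp s e (n := 2)).deriv' 
  have h2 : Continuous (deriv (deriv (stp s e))) := h1.continuous_deriv le_rfl
  obtain ⟨B₁, hB₁⟩ := isCompact_Icc.exists_bound_of_continuousOn (s := Icc (0 : ℝ) 1)
    h1.continuous.continuousOn
  obtain ⟨B₂, hB₂⟩ := isCompact_Icc.exists_bound_of_continuousOn (s := Icc (0 : ℝ) 1)
    h2.continuousOn
  exact ⟨max (max B₁ B₂) 0, le_max_right _ _, fun x hx =>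
    ⟨(hB₁ x hx).trans ((le_max_left _ _).trans (le_max_left _ _)),
      (hB₂ x hx).trans ((le_max_right _ _).trans (le_max_left _ _))⟩⟩

lemma rho_weight_le {ρ B d k k' K : ℝ} (hρ : 0 ≤ ρ) (hB : 0 ≤ B) (hk : 0 ≤ k)
    (hK : 0 < K) (hkK : k ≤ K) (hρ1 : ρ ≤ 1) :
    ρ * d * (2 * (B * k) + (2 * B * d * k + B * k')) ≤
      B * K + 7 / 2 * B * (ρ * (d ^ 2 * K)) + B / 2 * (ρ * (k' ^ 2 / K)) := by
  have h1 : d * k' ≤ (d ^ 2 * K + k' ^ 2 / K) / 2 := by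
    have : k' ^ 2 / K * K = k' ^ 2 := div_mul_cancel₀ _ hK.ne'
    have h2 : 0 ≤ (d ^ 2 * K + k' ^ 2 / K - 2 * (d * k')) * K := by
      nlinarith [sq_nonneg (d * K - k')]
    have := nonneg_of_mul_nonneg_left h2 hK
    linarith
  have h2 : d * k ≤ (1 + d ^ 2) / 2 * K := by
    nlinarith [mul_nonneg hk (sq_nonneg (d - 1)),
      mul_nonneg (sub_nonneg.2 hkK) (add_nonneg zero_le_one (sq_nonneg d))]
  have h3 : d ^ 2 * k ≤ d ^ 2 * K := mul_le_mul_of_nonneg_left hkK (sq_nonneg d)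
  have hρB : 0 ≤ ρ * B := mul_nonneg hρ hB
  have e1 := mul_le_mul_of_nonneg_left h1 hρB
  have e2 := mul_le_mul_of_nonneg_left h2 hρB
  have e3 := mul_le_mul_of_nonneg_left h3 hρB
  have e4 : ρ * (B * K) ≤ 1 * (B * K) := mul_le_mul_of_nonneg_right hρ1 (mul_nonneg hB hK.le)
  nlinarith [mul_nonneg hρB (mul_nonneg (sq_nonneg d) hK.le)]

namespace Nice

variable {R e η x : ℝ} {f g l Q F : ℂ → ℂ} {Z : Finset ℂ} {a : ℂ → ℂ} {z : ℂ}

lemma normSq_le_one (N : Nice R e η f g Z) (hz : z ∈ closedBall (0 : ℂ) 1) : normSq (g z) ≤ 1 := by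
  rw [normSq_eq_norm_sq]; exact pow_le_one₀ (norm_nonneg _) (N.hg1 z hz)

section annulus

/-- A radial weight in `g`, supported where `g` is small, times a holomorphic function. -/
noncomputable def annCut (w : ℝ → ℝ) (g F : ℂ → ℂ) (z : ℂ) : ℂ := ((w (normSq (g z)) : ℝ) : ℂ) * F z

variable {w : ℝ → ℝ} {B M : ℝ} {c k : ℂ → ℂ}

lemma contDiffOn_annCut (N : Nice R e η f g Z) (hw : ContDiff ℝ 1 w)
    (hw0 : ∀ x, e / 2 < x → w x = 0)
    (hF : ∀ z ∈ ball (0 : ℂ) 1, normSq (g z) < e → DifferentiableAt ℂ F z) :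
    ContDiffOn ℝ 1 (annCut w g F) (ball 0 R) := by
  refine contDiffOn_cutoff isOpen_ball
    (hw.comp_contDiffOn (contDiffOn_normSq isOpen_ball N.hg)) fun z hz => ?_
  have he := N.he
  have he1 := N.he1
  rcases lt_or_ge (normSq (g z)) e with h | h
  · exact Or.inr ((N.eventually_lt (N.mem_ball_of_lt hz (by linarith)) h).mono
      fun w hw => hF w hw.1 hw.2)
  · exact Or.inl ((N.eventually_gt hz (x := e / 2) (by linarith)).mono fun v hv => hw0 _ hv.2)

lemma norm_dX_annCut_le (N : Nice R e η f g Z) (hw : ContDiff ℝ 1 w)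
    (hw0 : ∀ x, e / 2 < x → w x = 0) (hB : 0 ≤ B) (hM : 0 ≤ M)
    (hwB : ∀ x ∈ Icc (0 : ℝ) 1, |w x| ≤ B ∧ |deriv w x| ≤ B)
    (hc : LocConst {z | z ∈ ball (0 : ℂ) 1 ∧ normSq (g z) < e} c)
    (hcM : ∀ z ∈ ball (0 : ℂ) 1, normSq (g z) < e → ‖c z‖ ≤ M)
    (hk : DifferentiableOn ℂ k (ball 0 R)) (hz : z ∈ closedBall (0 : ℂ) 1) :
    ‖annCut w g (fun z => c z * k z) z‖ ≤ M * (B * ‖k z‖) ∧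
    ‖dX (annCut w g fun z => c z * k z) z‖ ≤ M * (2 * B * ‖deriv g z‖ * ‖k z‖ + B * ‖deriv k z‖) ∧
    ‖dY (annCut w g fun z => c z * k z) z‖ ≤
      M * (2 * B * ‖deriv g z‖ * ‖k z‖ + B * ‖deriv k z‖) := by
  have he := N.he
  have he1 := N.he1
  have hzR := N.mem_ball_of_mem_closedBall hz
  have hr : (0 : ℝ) ≤ M * (2 * B * ‖deriv g z‖ * ‖k z‖ + B * ‖deriv k z‖) := by positivity
  rcases lt_or_ge (normSq (g z)) e with h | h
  · have hz1 := N.mem_ball_of_lt hzR (by linarith)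
    have hx : normSq (g z) ∈ Icc (0 : ℝ) 1 := ⟨normSq_nonneg _, N.normSq_le_one hz⟩
    have hgd : DifferentiableAt ℂ g z := N.hg.differentiableAt (isOpen_ball.mem_nhds hzR)
    have hkd : DifferentiableAt ℂ k z := hk.differentiableAt (isOpen_ball.mem_nhds hzR)
    have hnd : DifferentiableAt ℝ (fun z => normSq (g z)) z :=
      ContDiffOn.diffAt (contDiffOn_normSq (n := 1) isOpen_ball N.hg) one_ne_zero isOpen_ball hzR
    have hwd : HasDerivAt w (deriv w (normSq (g z))) (normSq (g z)) :=
      (hw.differentiable one_ne_zero _).hasDerivAt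
    have hud : DifferentiableAt ℝ (fun z => w (normSq (g z))) z :=
      (hw.differentiable one_ne_zero _).comp z hnd
    have hud' : DifferentiableAt ℝ (fun z => ((w (normSq (g z)) : ℝ) : ℂ)) z :=
      ofRealCLM.differentiableAt.comp z hud
    have heq : annCut w g (fun z => c z * k z) =ᶠ[𝓝 z]
        fun v => ((w (normSq (g v)) : ℝ) : ℂ) * (c z * k v) :=
      (hc z ⟨hz1, h⟩).mono fun v hv => by rw [annCut, hv]
    have hck : DifferentiableAt ℂ (fun v => c z * k v) z := hkd.const_mul _
    have hdck : deriv (fun v => c z * k v) z = c z * deriv k z := deriv_const_mul _ hkd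
    have hg1 := N.hg1 z hz
    have hcz := hcM z hz1 h
    obtain ⟨b1, b2⟩ := hwB _ hx
    have key : ∀ d E : ℝ, ∀ k' : ℂ, |d| ≤ B → |E| ≤ 2 * ‖deriv g z‖ → ‖k'‖ = ‖deriv k z‖ →
        ‖((d * E : ℝ) : ℂ) * (c z * k z) + ((w (normSq (g z)) : ℝ) : ℂ) * (c z * k')‖ ≤
          M * (2 * B * ‖deriv g z‖ * ‖k z‖ + B * ‖deriv k z‖) := fun d E k' hd hE hk' => by
      refine (norm_add_le _ _).trans ?_
      rw [norm_mul, norm_mul, norm_mul, norm_mul, norm_real, norm_real, Real.norm_eq_abs,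
        Real.norm_eq_abs, abs_mul, hk']
      have e1 : |d| * |E| * (‖c z‖ * ‖k z‖) ≤ (B * (2 * ‖deriv g z‖)) * (M * ‖k z‖) := by gcongr
      have e2 : |w (normSq (g z))| * (‖c z‖ * ‖deriv k z‖) ≤ B * (M * ‖deriv k z‖) := by gcongr
      linarith
    have hcg : ‖conj (g z) * deriv g z‖ ≤ ‖deriv g z‖ := by
      rw [norm_mul, RCLike.norm_conj]; exact mul_le_of_le_one_left (norm_nonneg _) hg1
    refine ⟨?_, ?_, ?_⟩
    · rw [annCut, norm_mul, norm_mul, norm_real, Real.norm_eq_abs]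
      have : |w (normSq (g z))| * (‖c z‖ * ‖k z‖) ≤ B * (M * ‖k z‖) := by gcongr
      linarith
    · rw [dX_congr heq, dX_mul hud' (differentiableAt_real hck), dX_ofReal hud,
        dX_comp (u := fun z => normSq (g z)) hwd hnd, dX_hol hck, hdck, dX_normSq_hol hgd]
      refine key _ _ _ b2 ?_ rfl
      rw [abs_mul, abs_two]
      linarith [abs_re_le_norm (conj (g z) * deriv g z)]
    · rw [dY_congr heq, dY_mul hud' (differentiableAt_real hck), dY_ofReal hud,
        dY_comp (u := fun z => normSq (g z)) hwd hnd, dY_hol hck, hdck, dY_normSq_hol hgd,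
        mul_left_comm I]
      refine key _ _ _ b2 ?_ (by simp)
      rw [abs_mul, abs_neg, abs_two]
      linarith [abs_im_le_norm (conj (g z) * deriv g z)]
  · have heq : annCut w g (fun z => c z * k z) =ᶠ[𝓝 z] fun _ => 0 :=
      (N.eventually_gt hzR (x := e / 2) (by linarith)).mono fun v hv => by simp [annCut, hw0 _ hv.2]
    refine ⟨?_, ?_, ?_⟩
    · rw [heq.self_of_nhds, norm_zero]; positivity
    · rw [dX_congr heq, dX_const, norm_zero]; exact hr
    · rw [dY_congr heq, dY_const, norm_zero]; exact hr

lemma norm_integral_annCut_le (N : Nice R e η f g Z) (hw : ContDiff ℝ 1 w)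
    (hw0 : ∀ x, e / 2 < x → w x = 0) (hB : 0 ≤ B) (hM : 0 ≤ M)
    (hwB : ∀ x ∈ Icc (0 : ℝ) 1, |w x| ≤ B ∧ |deriv w x| ≤ B)
    (hc : LocConst {z | z ∈ ball (0 : ℂ) 1 ∧ normSq (g z) < e} c)
    (hcM : ∀ z ∈ ball (0 : ℂ) 1, normSq (g z) < e → ‖c z‖ ≤ M)
    (hk : DifferentiableOn ℂ k (ball 0 R)) :
    ‖∫ z in closedBall (0 : ℂ) 1, conj (annCut w g (fun z => c z * k z) z) * deriv g z‖ ≤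
      12 * M * B * ∫ θ in (-π)..π, ‖k (cis θ)‖ := by
  set ψ := annCut w g (fun z => c z * k z) with hψ
  have hψC : ContDiffOn ℝ 1 ψ (ball 0 R) := N.contDiffOn_annCut hw hw0 fun z hz h =>
    (hc.differentiableAt ⟨hz, h⟩).mul
      (hk.differentiableAt (isOpen_ball.mem_nhds (ball_subset_ball N.hR.le hz)))
  have hψd : ∀ z ∈ ball (0 : ℂ) R, DifferentiableAt ℝ ψ z := fun z hz =>
    ContDiffOn.diffAt hψC one_ne_zero isOpen_ball hz
  have hcC : ContDiffOn ℝ 1 (fun z => conj (ψ z)) (ball 0 R) :=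
    conjCLE.contDiff.comp_contDiffOn hψC
  have hg' : DifferentiableOn ℂ (deriv g) (ball 0 R) := N.hg.deriv isOpen_ball
  have hk' : DifferentiableOn ℂ (deriv k) (ball 0 R) := hk.deriv isOpen_ball
  refine (norm_integral_mul_hol_le N.hR hcC hg').trans ?_
  have main : ∀ t : ℝ, 0 < t → ∫ z in closedBall (0 : ℂ) 1, rho z * ‖deriv g z‖ *
      (2 * ‖conj (ψ z)‖ + (‖dX (fun z => conj (ψ z)) z‖ + ‖dY (fun z => conj (ψ z)) z‖) / 2) ≤
      12 * M * B * ∫ θ in (-π)..π, rmod t k (cis θ) := fun t ht => by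
    have hKc : ContinuousOn (rmod t k) (ball 0 R) :=
      (contDiffOn_rmod ht (n := 1) isOpen_ball hk).continuousOn
    have hrc : ContinuousOn rho (ball 0 R) := (contDiff_rho (n := 1)).continuous.continuousOn
    have c2 : ContinuousOn (fun z => rho z * (‖deriv g z‖ ^ 2 * rmod t k z)) (ball 0 R) :=
      hrc.mul ((hg'.continuousOn.norm.pow 2).mul hKc)
    have c3 : ContinuousOn (fun z => rho z * (‖deriv k z‖ ^ 2 / rmod t k z)) (ball 0 R) :=
      hrc.mul ((hk'.continuousOn.norm.pow 2).div hKc fun z _ => (rmod_pos ht k z).ne')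
    have i1 := integrableOn_closedBall N.hR hKc
    have i2 := integrableOn_closedBall N.hR c2
    have i3 := integrableOn_closedBall N.hR c3
    have hbound : ∫ z in closedBall (0 : ℂ) 1, rho z * ‖deriv g z‖ *
      (2 * ‖conj (ψ z)‖ + (‖dX (fun z => conj (ψ z)) z‖ + ‖dY (fun z => conj (ψ z)) z‖) / 2) ≤
      ∫ z in closedBall (0 : ℂ) 1, M * (B * rmod t k z + 7 / 2 * B *
        (rho z * (‖deriv g z‖ ^ 2 * rmod t k z)) +
        B / 2 * (rho z * (‖deriv k z‖ ^ 2 / rmod t k z))) := by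
      refine setIntegral_mono_closedBall N.hR ?_ ?_ fun z hz => ?_
      · refine (hrc.mul hg'.continuousOn.norm).mul ((continuousOn_const.mul
          hcC.continuousOn.norm).add ((ContinuousOn.add ?_ ?_).div_const 2))
        · exact (contDiffOn_dX (m := 0) isOpen_ball hcC (by norm_num)).continuousOn.norm
        · exact (contDiffOn_dY (m := 0) isOpen_ball hcC (by norm_num)).continuousOn.norm
      · exact continuousOn_const.mul (((continuousOn_const.mul hKc).add
          (continuousOn_const.mul c2)).add (continuousOn_const.mul c3))
      · have hzR := N.mem_ball_of_mem_closedBall hz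
        obtain ⟨b1, b2, b3⟩ := N.norm_dX_annCut_le hw hw0 hB hM hwB hc hcM hk hz
        rw [dX_conj (hψd z hzR), dY_conj (hψd z hzR)]
        simp only [RCLike.norm_conj]
        have hρ := rho_nonneg hz
        have := rho_weight_le hρ hB (d := ‖deriv g z‖) (norm_nonneg (k z))
          (k' := ‖deriv k z‖) (rmod_pos ht k z) (norm_le_rmod ht k z) (rho_le_one z)
        refine le_trans ?_ (mul_le_mul_of_nonneg_left this hM)
        rw [mul_left_comm M]
        refine mul_le_mul_of_nonneg_left ?_ (by positivity)
        linarith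
    refine hbound.trans ?_
    rw [integral_const_mul, integral_add (f := fun z => B * rmod t k z + 7 / 2 * B *
        (rho z * (‖deriv g z‖ ^ 2 * rmod t k z))) ((i1.const_mul B).add (i2.const_mul _))
        (i3.const_mul _), integral_add (f := fun z => B * rmod t k z) (i1.const_mul B)
        (i2.const_mul _), integral_const_mul, integral_const_mul, integral_const_mul]
    have b1 := integral_rmod_le ht N.hR hk
    have b2 := integral_deriv_rmod_le ht N.hR hk
    have b3 := integral_deriv_sq_mul_rmod_le ht N.hR hk N.hg N.hg1
    have hMB : 0 ≤ M * B := mul_nonneg hM hB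
    nlinarith [mul_le_mul_of_nonneg_left b1 hMB, mul_le_mul_of_nonneg_left b2 hMB,
      mul_le_mul_of_nonneg_left b3 hMB]
  have hkc : Continuous fun θ => ‖k (cis θ)‖ := (continuous_comp_cis N.hR hk.continuousOn).norm
  refine le_of_forall_pos_le_add fun ε hε => ?_
  have hMB : 0 ≤ M * B := mul_nonneg hM hB
  set t := ε / (24 * π * (M * B) + 1) with ht
  have hden : 0 < 24 * π * (M * B) + 1 := by positivity
  have ht0 : 0 < t := div_pos hε hden
  refine (main t ht0).trans ?_
  have h1 : ∫ θ in (-π)..π, rmod t k (cis θ) ≤ (∫ θ in (-π)..π, ‖k (cis θ)‖) + 2 * π * t := by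
    have h2 : ∫ θ in (-π)..π, rmod t k (cis θ) ≤ ∫ θ in (-π)..π, (‖k (cis θ)‖ + t) :=
      integral_mono_pi (continuous_comp_cis N.hR
        (contDiffOn_rmod ht0 (n := 1) isOpen_ball hk).continuousOn) (hkc.add continuous_const)
        fun θ => rmod_le ht0 k _
    rw [intervalIntegral.integral_add (hkc.intervalIntegrable _ _)
      (continuous_const.intervalIntegrable _ _), intervalIntegral.integral_const] at h2
    refine h2.trans_eq ?_
    rw [smul_eq_mul]; ring
  have h3 : 24 * π * (M * B) * t ≤ ε := by
    have : t * (24 * π * (M * B) + 1) = ε := div_mul_cancel₀ _ hden.ne'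
    nlinarith
  nlinarith [mul_le_mul_of_nonneg_left h1 hMB]

end annulus

/-- The pairing of a residue vector with a bounded locally constant function is bounded by the
boundary norm. -/
lemma re_sum_mul_locConst_le (N : Nice R e η f g Z) {M B : ℝ} {c : ℂ → ℂ} (hB : 0 ≤ B) (hM : 0 ≤ M)
    (hBs : ∀ x ∈ Icc (0 : ℝ) 1, |deriv (stp (e / 4) (e / 4)) x| ≤ B ∧
      |deriv (deriv (stp (e / 4) (e / 4))) x| ≤ B)
    (hc : LocConst {z | z ∈ ball (0 : ℂ) 1 ∧ normSq (g z) < e} c)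
    (hcM : ∀ z ∈ ball (0 : ℂ) 1, normSq (g z) < e → ‖c z‖ ≤ M) :
    2 * π * (∑ ζ ∈ Z, a ζ * c ζ).re ≤ 24 * M * B * ∫ θ in (-π)..π, ‖ker Z a (cis θ)‖ := by
  have he := N.he
  have he1 := N.he1
  have he4 : 0 < e / 4 := by linarith
  set w := deriv (stp (e / 4) (e / 4)) with hwdef
  have hw : ContDiff ℝ 1 w := (contDiff_stp _ _ (n := 2)).deriv'
  have hw1 : ∀ x, e / 2 < x → w x = 0 := fun x hx => by
    have : stp (e / 4) (e / 4) =ᶠ[𝓝 x] fun _ => 1 := by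
      filter_upwards [lt_mem_nhds hx] with y hy
      exact stp_eq_one he4 (by linarith)
    rw [hwdef, this.deriv_eq, deriv_const]
  have hw0 : ∀ x, x < e / 4 → w x = 0 := fun x hx => by
    have : stp (e / 4) (e / 4) =ᶠ[𝓝 x] fun _ => 0 := by
      filter_upwards [gt_mem_nhds hx] with y hy
      exact stp_eq_zero he4 (by linarith)
    rw [hwdef, this.deriv_eq, deriv_const]
  have hcd : ∀ z ∈ ball (0 : ℂ) 1, normSq (g z) < e → DifferentiableAt ℂ c z := fun z hz h =>
    hc.differentiableAt ⟨hz, h⟩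
  set k := kerMul g Z a with hkdef
  have hkm : DifferentiableOn ℂ k (ball 0 R) :=
    differentiableOn_kerMul N.hZR (fun ζ hζ => ball_subset_ball N.hR.le (by simpa using N.hZ ζ hζ))
      N.hg
  have hk : ∀ z, 0 < normSq (g z) → k z = g z * ker Z a z := fun z h =>
    kerMul_eq N.hZ0 (N.not_mem_of_lt h)
  set φ := cutLt (e / 4) (e / 4) g c with hφ
  have hφC : ContDiffOn ℝ 1 φ (ball 0 R) :=
    N.contDiffOn_cutLt (n := 1) he4 (x := e) (by linarith) (by linarith) hcd
  have hφ0 : ∀ θ, φ (cis θ) = 0 := N.cutLt_cis he4 (by linarith)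
  set ψ := annCut w g (fun z => c z * k z) with hψ
  have hpt : ∀ z ∈ closedBall (0 : ℂ) 1,
      db φ z * ker Z a z = -2 * conj (conj (ψ z) * deriv g z) := fun z hz => by
    have hzR := N.mem_ball_of_mem_closedBall hz
    rcases lt_or_ge (normSq (g z)) e with h | h
    · have hz1 := N.mem_ball_of_lt hzR (by linarith)
      have hgd : DifferentiableAt ℂ g z := N.hg.differentiableAt (isOpen_ball.mem_nhds hzR)
      have hnd : DifferentiableAt ℝ (fun z => normSq (g z)) z :=
        ContDiffOn.diffAt (contDiffOn_normSq (n := 1) isOpen_ball N.hg) one_ne_zero isOpen_ball hzR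
      have hsd : HasDerivAt (fun x => 1 - stp (e / 4) (e / 4) x) (-w (normSq (g z)))
          (normSq (g z)) :=
        (((contDiff_stp (e / 4) (e / 4) (n := 1)).differentiable one_ne_zero
          _).hasDerivAt).const_sub 1
      have hud : DifferentiableAt ℝ (fun z => 1 - stp (e / 4) (e / 4) (normSq (g z))) z :=
        DifferentiableAt.comp z (f := fun z => normSq (g z)) hsd.differentiableAt hnd
      have hud' : DifferentiableAt ℝ
          (fun z => ((1 - stp (e / 4) (e / 4) (normSq (g z)) : ℝ) : ℂ)) z :=
        ofRealCLM.differentiableAt.comp z hud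
      have heq : φ =ᶠ[𝓝 z]
          fun v => ((1 - stp (e / 4) (e / 4) (normSq (g v)) : ℝ) : ℂ) * c z :=
        (hc z ⟨hz1, h⟩).mono fun v hv => by rw [hφ, cutLt, hv]
      have hdb : db φ z = -2 * (w (normSq (g z)) : ℝ) * c z * (g z * conj (deriv g z)) := by
        rw [db_congr heq, db_mul hud' (differentiableAt_const _), db, dX_ofReal hud, dY_ofReal hud,
          dX_comp (u := fun z => normSq (g z)) (φ := fun x => 1 - stp (e / 4) (e / 4) x) hsd hnd,
          dY_comp (u := fun z => normSq (g z)) (φ := fun x => 1 - stp (e / 4) (e / 4) x) hsd hnd,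
          dX_normSq_hol hgd, dY_normSq_hol hgd, db_hol (differentiableAt_const _)]
        have hre : (((conj (g z) * deriv g z).re : ℝ) : ℂ) - I * ((conj (g z) * deriv g z).im : ℝ) =
            g z * conj (deriv g z) := by
          apply Complex.ext <;> simp <;> ring
        rw [← hre]
        push_cast
        ring
      rw [hdb, hψ, annCut]
      rcases lt_or_ge (normSq (g z)) (e / 4) with h4 | h4
      · simp [hw0 _ h4]
      · rw [hk z (by linarith)]
        simp only [map_mul, conj_conj]
        ring
    · have h1 : φ =ᶠ[𝓝 z] fun _ => 0 :=
        (N.eventually_gt hzR (x := e / 2) (by linarith)).mono fun v hv => by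
          rw [hφ, cutLt, stp_eq_one he4 (by linarith [hv.2])]; simp
      rw [db_congr h1, db_hol (differentiableAt_const _), hψ, annCut, hw1 _ (by linarith)]
      simp
  have hK := integral_db_mul_ker (a := a) N.hR N.hZR hφC N.hZ (fun ζ hζ => by
    have hζ1 : ζ ∈ ball (0 : ℂ) 1 := by simpa using N.hZ ζ hζ
    have hζ0 : normSq (g ζ) < e / 4 := by rw [N.hZ0 ζ hζ, map_zero]; exact he4
    have h1 := (N.cutLt_eventuallyEq (l := c) he4 hζ1 hζ0).eventuallyEq_nhds
    filter_upwards [h1, N.eventually_lt hζ1 hζ0] with w hw hw2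
    exact (hcd w hw2.1 (by linarith [hw2.2])).congr_of_eventuallyEq hw) hφ0
  have hφZ : ∑ ζ ∈ Z, a ζ * φ ζ = ∑ ζ ∈ Z, a ζ * c ζ := Finset.sum_congr rfl fun ζ hζ => by
    rw [hφ, (N.cutLt_eventuallyEq (l := c) he4 (by simpa using N.hZ ζ hζ)
      (by rw [N.hZ0 ζ hζ, map_zero]; exact he4)).self_of_nhds]
  rw [hφZ, setIntegral_congr_fun isClosed_closedBall.measurableSet hpt, integral_const_mul,
    integral_conj] at hK
  have hle := N.norm_integral_annCut_le hw hw1 hB hM hBs hc hcM hkm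
  have hre : 2 * π * (∑ ζ ∈ Z, a ζ * c ζ).re ≤ 2 * ‖∫ z in closedBall (0 : ℂ) 1,
      conj (ψ z) * deriv g z‖ := by
    have h3 : (2 * π * ∑ ζ ∈ Z, a ζ * c ζ : ℂ).re = 2 * π * (∑ ζ ∈ Z, a ζ * c ζ).re := by
      rw [← re_ofReal_mul]; push_cast; rfl
    have h4 := norm_neg (2 * π * ∑ ζ ∈ Z, a ζ * c ζ : ℂ)
    rw [← hK, norm_mul, RCLike.norm_conj, norm_neg] at h4
    rw [← h3]
    refine (re_le_norm _).trans (h4.symm.le.trans_eq ?_)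
    norm_num
  have hmono : ∫ θ in (-π)..π, ‖k (cis θ)‖ ≤ ∫ θ in (-π)..π, ‖ker Z a (cis θ)‖ := by
    refine integral_mono_pi (continuous_comp_cis N.hR hkm.continuousOn).norm
      (continuous_ker_cis N.hZ).norm fun θ => ?_
    rw [hk _ (by linarith [N.normSq_cis θ]), norm_mul]
    exact mul_le_of_le_one_left (norm_nonneg _) (N.hg1 _ (by simp))
  have := mul_le_mul_of_nonneg_left hmono (mul_nonneg hM hB)
  linarith

end Nice

end

section

lemma norm_le_of_norm_cis_le {F : ℂ → ℂ} {R A : ℝ} (hR : 1 < R)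
    (hF : DifferentiableOn ℂ F (ball 0 R)) (h : ∀ θ, ‖F (cis θ)‖ ≤ A) {z : ℂ}
    (hz : z ∈ closedBall (0 : ℂ) 1) : ‖F z‖ ≤ A := by
  have hd : DiffContOnCl ℂ F (ball 0 1) := by
    refine (hF.mono ?_).diffContOnCl
    rw [closure_ball _ one_ne_zero]
    exact closedBall_subset_of_one_lt hR
  refine norm_le_of_forall_mem_frontier_norm_le isBounded_ball hd (fun w hw => ?_)
    (by rwa [closure_ball _ one_ne_zero])
  rw [frontier_ball _ one_ne_zero, mem_sphere_zero_iff_norm] at hw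
  have : w = cis w.arg := by
    rw [cis_eq_exp]
    conv_lhs => rw [← norm_mul_exp_arg_mul_I w, hw, ofReal_one, one_mul]
  rw [this]; exact h _

lemma abs_re_le_of_abs_re_cis_le (p : Polynomial ℂ) {A : ℝ}
    (h : ∀ θ, |(p.eval (cis θ)).re| ≤ A) {z : ℂ} (hz : z ∈ closedBall (0 : ℂ) 1) :
    |(p.eval z).re| ≤ A := by
  have h1 : ‖exp (p.eval z)‖ ≤ Real.exp A :=
    norm_le_of_norm_cis_le (F := fun z => exp (p.eval z)) one_lt_two
      p.differentiable.cexp.differentiableOn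
      (fun θ => by rw [norm_exp]; exact Real.exp_le_exp.2 (abs_le.1 (h θ)).2) hz
  have h2 : ‖exp (-p.eval z)‖ ≤ Real.exp A :=
    norm_le_of_norm_cis_le (F := fun z => exp (-p.eval z)) one_lt_two
      p.differentiable.neg.cexp.differentiableOn
      (fun θ => by
        rw [norm_exp, neg_re]
        exact Real.exp_le_exp.2 (by linarith [(abs_le.1 (h θ)).1])) hz
  rw [norm_exp, Real.exp_le_exp] at h1 h2
  rw [neg_re] at h2
  exact abs_le.2 ⟨by linarith, h1⟩

/-- The locally constant functions on a set, as a subspace. -/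
def locConstSubmodule (U : Set ℂ) : Submodule ℂ (ℂ → ℂ) where
  carrier := {c | LocConst U c}
  add_mem' h1 h2 z hz := by
    filter_upwards [h1 z hz, h2 z hz] with w a b
    simp [a, b]
  zero_mem' z _ := Filter.Eventually.of_forall fun _ => rfl
  smul_mem' r c h z hz := by
    filter_upwards [h z hz] with w a
    simp [a]

open Classical in
/-- Reduction of the imaginary part modulo `2π`, with a cutoff in the real part. -/
noncomputable def redIm (M : ℝ) (w : ℂ) : ℂ :=
  if |w.re| ≤ M then w.re + toIcoMod Real.two_pi_pos 0 w.im * I else 0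

lemma norm_redIm_le {M : ℝ} (hM : 0 ≤ M) (w : ℂ) : ‖redIm M w‖ ≤ M + 2 * π := by
  rw [redIm]
  split_ifs with h
  · refine (norm_add_le _ _).trans (add_le_add ?_ ?_)
    · rwa [norm_real]
    · obtain ⟨h1, h2⟩ := toIcoMod_mem_Ico Real.two_pi_pos 0 w.im
      rw [norm_mul, norm_I, mul_one, norm_real, Real.norm_of_nonneg h1]
      linarith
  · rw [norm_zero]; positivity

lemma exp_redIm {M : ℝ} {w : ℂ} (h : |w.re| ≤ M) : exp (redIm M w) = exp w := by
  rw [redIm, if_pos h, exp_eq_exp_iff_exists_int]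
  refine ⟨-toIcoDiv Real.two_pi_pos 0 w.im, ?_⟩
  have := toIcoMod_add_toIcoDiv_zsmul Real.two_pi_pos 0 w.im
  rw [zsmul_eq_mul] at this
  apply Complex.ext
  · simp
  · simp
    linarith

namespace Nice

lemma exists_polynomial {e η : ℝ} (he : 0 < e) (hη : 0 < η) (hη1 : η ≤ 1) :
    ∃ C, 0 ≤ C ∧ ∀ (R : ℝ) (f : Polynomial ℂ) (g : ℂ → ℂ) (Z : Finset ℂ),
      f ≠ 0 → Nice R e η (fun z => f.eval z) g Z →
      ∃ h : Polynomial ℂ, (∀ z ∈ closedBall (0 : ℂ) 1, |(h.eval z).re| ≤ C) ∧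
        ∀ ζ ∈ Z, exp (h.eval ζ) = f.eval ζ := by
  obtain ⟨B, hB, hBs⟩ := exists_bound_deriv_stp (e / 4) (e / 4)
  have hlogη : Real.log η ≤ 0 := Real.log_nonpos hη.le hη1
  have hlog3 : 0 ≤ Real.log 3 := Real.log_nonneg (by norm_num)
  set M₀ := Real.log 3 / 2 - Real.log η with hM₀
  have hM₀' : 0 ≤ M₀ := by linarith
  set C₁ := M₀ + ((3 * e) ^ 3)⁻¹ * (1000 * (1 + M₀) * (6 + 10 * M₀ ^ 2)) with hC₁
  have hC₁' : 0 ≤ C₁ := by positivity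
  set M := C₁ + 1 - Real.log η with hMdef
  have hM : 0 ≤ M := by linarith
  set C₂ := 24 * (M + 2 * π) * B with hC₂
  have hC₂' : 0 ≤ C₂ := by positivity
  refine ⟨(C₁ + 1) + (C₂ + 1), by positivity, fun R f g Z hf N => ?_⟩
  obtain ⟨l, hl, hl'⟩ := hasLog_polynomial (x := √(11 / 2 * e)) N.hR N.hg f hf fun p hp hp0 => by
    by_contra hle
    have h1 : normSq (g p) ≤ 11 / 2 * e := by
      rw [normSq_eq_norm_sq]
      exact (Real.le_sqrt (norm_nonneg _) (by linarith)).1 (not_lt.1 hle)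
    have h2 : η ≤ ‖f.eval p‖ := N.hcor p (ball_subset_closedBall hp) (by linarith)
    rw [hp0, norm_zero] at h2
    linarith
  have hSo : IsOpen {z | z ∈ ball (0 : ℂ) 1 ∧ ‖g z‖ < √(11 / 2 * e)} :=
    ((N.hg.continuousOn.norm).mono (ball_subset_ball N.hR.le)).isOpen_inter_preimage isOpen_ball
      isOpen_Iio
  have hS : ∀ z ∈ ball (0 : ℂ) 1, normSq (g z) < 11 / 2 * e →
      z ∈ {z | z ∈ ball (0 : ℂ) 1 ∧ ‖g z‖ < √(11 / 2 * e)} := fun z hz h =>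
    ⟨hz, Real.lt_sqrt_of_sq_lt (by rwa [← normSq_eq_norm_sq])⟩
  have hZb : ∀ ζ ∈ Z, ζ ∈ ball (0 : ℂ) 1 := fun ζ hζ => by simpa using N.hZ ζ hζ
  have hZg : ∀ x, 0 < x → ∀ ζ ∈ Z, normSq (g ζ) < x := fun x hx ζ hζ => by
    rwa [N.hZ0 ζ hζ, map_zero]
  obtain ⟨p₁, hp₁, c, hc, hp₁c⟩ := exists_polynomial_of_dual N.hZ
    (locConstSubmodule {z | z ∈ ball (0 : ℂ) 1 ∧ normSq (g z) < e}) l hC₁' fun a ha _ =>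
      N.re_sum_mul_log_le hM₀' le_rfl
        (fun z hz h => hl.differentiableAt (hSo.mem_nhds (hS z hz h)))
        (fun z hz h => hl' z (hS z hz h)) ha
  have hc' : LocConst {z | z ∈ ball (0 : ℂ) 1 ∧ normSq (g z) < e} fun z => redIm M (c z) :=
    fun z hz => (hc z hz).mono fun w hw => congrArg (redIm M) hw
  obtain ⟨p₂, hp₂, d, hd, hp₂c⟩ := exists_polynomial_of_dual N.hZ ⊥ (fun z => redIm M (c z)) hC₂'
    fun a _ _ => N.re_sum_mul_locConst_le hB (by positivity) hBs hc'
      fun z _ _ => norm_redIm_le hM _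
  rw [Submodule.mem_bot] at hd
  have h₁ := fun z hz => abs_re_le_of_abs_re_cis_le p₁ hp₁ (z := z) hz
  have h₂ := fun z hz => abs_re_le_of_abs_re_cis_le p₂ hp₂ (z := z) hz
  refine ⟨p₁ - p₂, fun z hz => ?_, fun ζ hζ => ?_⟩
  · rw [Polynomial.eval_sub, sub_re]
    exact (abs_sub _ _).trans (add_le_add (h₁ z hz) (h₂ z hz))
  · have hζ1 := ball_subset_closedBall (hZb ζ hζ)
    have hlζ : exp (l ζ) = f.eval ζ := hl' ζ (hS ζ (hZb ζ hζ) (hZg _ (by linarith) ζ hζ))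
    have hη2 : η ≤ ‖f.eval ζ‖ := N.hcor ζ hζ1 (hZg _ (by linarith) ζ hζ)
    have hf1 : ‖f.eval ζ‖ ≤ 1 := N.hf1 ζ hζ1
    have hre : (l ζ).re = Real.log ‖f.eval ζ‖ := by
      rw [← hlζ, norm_exp, Real.log_exp]
    have hre0 : (l ζ).re ≤ 0 := by rw [hre]; exact Real.log_nonpos (norm_nonneg _) hf1
    have hre1 : Real.log η ≤ (l ζ).re := by rw [hre]; exact Real.log_le_log hη hη2
    have hcM : |(c ζ).re| ≤ M := by
      have h3 : (c ζ).re = (p₁.eval ζ).re - (l ζ).re := by rw [hp₁c ζ hζ, add_re]; ring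
      have h4 := abs_le.1 (h₁ ζ hζ1)
      rw [h3]
      exact abs_le.2 ⟨by linarith, by linarith⟩
    rw [Polynomial.eval_sub, exp_sub, hp₁c ζ hζ, hp₂c ζ hζ, hd, Pi.zero_apply, add_zero, exp_add,
      exp_redIm hcM, hlζ, mul_div_cancel_right₀ _ (exp_ne_zero _)]

end Nice

end

section

/-- The finite Blaschke product with simple zeros at the points of `Z`. -/
noncomputable def blaschke (Z : Finset ℂ) (z : ℂ) : ℂ := ∏ ζ ∈ Z, (z - ζ) / (1 - conj ζ * z)

variable {Z : Finset ℂ} {R A : ℝ} {ζ z : ℂ}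

lemma normSq_sub_sub_normSq (ζ z : ℂ) :
    normSq (z - ζ) - normSq (1 - conj ζ * z) = (normSq z - 1) * (1 - normSq ζ) := by
  simp [normSq_apply]
  ring

lemma norm_sub_le_norm_one_sub (hζ : ‖ζ‖ < 1) (hz : ‖z‖ ≤ 1) : ‖z - ζ‖ ≤ ‖1 - conj ζ * z‖ := by
  have h := normSq_sub_sub_normSq ζ z
  simp only [normSq_eq_norm_sq] at h
  refine le_of_sq_le_sq ?_ (norm_nonneg _)
  nlinarith [mul_nonneg (sub_nonneg.2 (pow_le_one₀ (norm_nonneg z) hz (n := 2)))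
    (sub_nonneg.2 (pow_le_one₀ (norm_nonneg ζ) hζ.le (n := 2)))]

lemma norm_one_sub_le_norm_sub (hζ : ‖ζ‖ < 1) (hz : 1 ≤ ‖z‖) : ‖1 - conj ζ * z‖ ≤ ‖z - ζ‖ := by
  have h := normSq_sub_sub_normSq ζ z
  simp only [normSq_eq_norm_sq] at h
  refine le_of_sq_le_sq ?_ (norm_nonneg _)
  nlinarith [mul_nonneg (sub_nonneg.2 (one_le_pow₀ hz (n := 2)))
    (sub_nonneg.2 (pow_le_one₀ (norm_nonneg ζ) hζ.le (n := 2)))]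

lemma differentiableOn_blaschke (hZR : ∀ ζ ∈ Z, ‖ζ‖ * R < 1) :
    DifferentiableOn ℂ (blaschke Z) (ball 0 R) :=
  DifferentiableOn.fun_finsetProd fun ζ hζ =>
    (differentiableOn_id.sub_const ζ).div
      ((differentiableOn_const _).sub (differentiableOn_id.const_mul _))
      fun _ hz => one_sub_conj_mul_ne_zero (hZR ζ hζ) hz

lemma norm_blaschke_le_one (hZ : ∀ ζ ∈ Z, ‖ζ‖ < 1) (hz : ‖z‖ ≤ 1) : ‖blaschke Z z‖ ≤ 1 := by
  rw [blaschke, norm_prod]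
  refine Finset.prod_le_one (fun _ _ => norm_nonneg _) fun ζ hζ => ?_
  rw [norm_div]
  exact div_le_one_of_le₀ (norm_sub_le_norm_one_sub (hZ ζ hζ) hz) (norm_nonneg _)

lemma one_le_norm_blaschke (hZ : ∀ ζ ∈ Z, ‖ζ‖ < 1) (hZR : ∀ ζ ∈ Z, ‖ζ‖ * R < 1)
    (hzR : z ∈ ball (0 : ℂ) R) (hz : 1 ≤ ‖z‖) : 1 ≤ ‖blaschke Z z‖ := by
  rw [blaschke, norm_prod]
  refine Finset.prod_induction _ (1 ≤ ·) (fun _ _ => one_le_mul_of_one_le_of_one_le) le_rfl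
    fun ζ hζ => ?_
  rw [norm_div, one_le_div (norm_pos_iff.2 (one_sub_conj_mul_ne_zero (hZR ζ hζ) hzR))]
  exact norm_one_sub_le_norm_sub (hZ ζ hζ) hz

lemma blaschke_eq_zero (hζ : ζ ∈ Z) : blaschke Z ζ = 0 :=
  Finset.prod_eq_zero hζ (by simp)

lemma exists_eq_mul_blaschke (hR : 1 < R) (hZ : ∀ ζ ∈ Z, ‖ζ‖ < 1)
    (hZR : ∀ ζ ∈ Z, ‖ζ‖ * R < 1) {F : ℂ → ℂ} (hF : DifferentiableOn ℂ F (ball 0 R))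
    (hF0 : ∀ ζ ∈ Z, F ζ = 0) (hA : ∀ θ, ‖F (cis θ)‖ ≤ A) :
    ∃ G : ℂ → ℂ, DifferentiableOn ℂ G (ball 0 R) ∧ (∀ z ∈ closedBall (0 : ℂ) 1, ‖G z‖ ≤ A) ∧
      ∀ z ∈ ball (0 : ℂ) R, F z = blaschke Z z * G z := by
  induction Z using Finset.induction_on generalizing F with
  | empty => exact ⟨F, hF, fun z hz => norm_le_of_norm_cis_le hR hF hA hz, by simp [blaschke]⟩
  | insert ζ Z hζZ ih =>
    have hζ := hZ ζ (Finset.mem_insert_self _ _)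
    have hζR := hZR ζ (Finset.mem_insert_self _ _)
    have hfac : ∀ w, F w = (w - ζ) * dslope F ζ w := fun w => by
      have := sub_smul_dslope F ζ w
      rw [hF0 ζ (Finset.mem_insert_self _ _), sub_zero, smul_eq_mul] at this
      exact this.symm
    have hζb : ζ ∈ ball (0 : ℂ) R := by simpa using hζ.trans hR
    have hd : DifferentiableOn ℂ (fun w => dslope F ζ w * (1 - conj ζ * w)) (ball 0 R) :=
      (differentiableOn_dslope_ball hζb hF).mul
        ((differentiableOn_const _).sub (differentiableOn_id.const_mul _))
    obtain ⟨G, hG, hGA, hFG⟩ := ih (fun ξ hξ => hZ ξ (Finset.mem_insert_of_mem hξ))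
      (fun ξ hξ => hZR ξ (Finset.mem_insert_of_mem hξ)) hd (fun ξ hξ => by
        have h1 := hfac ξ
        rw [hF0 ξ (Finset.mem_insert_of_mem hξ)] at h1
        have h2 : ξ - ζ ≠ 0 := sub_ne_zero.2 (by rintro rfl; exact hζZ hξ)
        rw [(mul_eq_zero.1 h1.symm).resolve_left h2, zero_mul]) (fun θ => by
        refine le_trans ?_ (hA θ)
        rw [hfac, norm_mul, norm_mul, mul_comm]
        exact mul_le_mul_of_nonneg_right (norm_one_sub_le_norm_sub hζ (norm_cis θ).ge)
          (norm_nonneg _))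
    refine ⟨G, hG, hGA, fun z hz => ?_⟩
    rw [blaschke, Finset.prod_insert hζZ, mul_assoc, ← blaschke, ← hFG z hz,
      mul_comm (dslope F ζ z), ← mul_assoc,
      div_mul_cancel₀ _ (one_sub_conj_mul_ne_zero hζR hz), hfac z]

/-- The pair `f`, `g` satisfies the conclusion of the theorem on the disc with constant `A`. -/
def Correctable (A : ℝ) (f g : ℂ → ℂ) : Prop :=
  ∃ G : ℂ → ℂ, DifferentiableOn ℂ G (ball 0 1) ∧
    ∀ z ∈ ball (0 : ℂ) 1, ‖G z‖ ≤ A ∧ 1 ≤ A * ‖f z + g z * G z‖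

/-- The quantitative theorem for a polynomial and a finite Blaschke product with simple zeros. -/
lemma exists_correctable_blaschke {δ : ℝ} (hδ : 0 < δ) (hδ1 : δ ≤ 1) : ∃ A, 0 < A ∧
    ∀ (f : Polynomial ℂ) (Z : Finset ℂ), (∀ ζ ∈ Z, ‖ζ‖ < 1) →
      (∀ z ∈ closedBall (0 : ℂ) 1, ‖f.eval z‖ ≤ 1) →
      (∀ z ∈ closedBall (0 : ℂ) 1, δ ≤ ‖f.eval z‖ + ‖blaschke Z z‖) →
      Correctable A (fun z => f.eval z) (blaschke Z) := by
  obtain ⟨C, hC, h⟩ := Nice.exists_polynomial (e := δ ^ 2 / 24) (η := δ / 2) (by positivity)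
    (by positivity) (by linarith)
  refine ⟨Real.exp C + 1, by positivity, fun f Z hZ hf1 hcor => ?_⟩
  obtain ⟨R, hR, hZR⟩ := exists_one_lt_mul_lt Z hZ
  obtain ⟨p, hp, hpZ⟩ : ∃ p : Polynomial ℂ, (∀ z ∈ closedBall (0 : ℂ) 1, |(p.eval z).re| ≤ C) ∧
      ∀ ζ ∈ Z, exp (p.eval ζ) = f.eval ζ := by
    rcases eq_or_ne f 0 with rfl | hf
    · refine ⟨0, fun z _ => by simpa using hC, fun ζ hζ => ?_⟩
      have := hcor ζ (by simpa using (hZ ζ hζ).le)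
      rw [blaschke_eq_zero hζ] at this
      simp at this
      linarith
    · refine h R f (blaschke Z) Z hf
        { hR := hR
          he := by positivity
          he1 := by nlinarith
          hη := by positivity
          hη1 := by linarith
          hf := f.differentiable.differentiableOn
          hf1 := hf1
          hg := differentiableOn_blaschke hZR
          hg1 := fun z hz => norm_blaschke_le_one hZ (by simpa using hz)
          hgo := fun z hz h1 => by
            rw [normSq_eq_norm_sq]
            exact one_le_pow₀ (one_le_norm_blaschke hZ hZR hz h1)
          hZ := hZ
          hZR := hZR
          hZ0 := fun ζ hζ => blaschke_eq_zero hζ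
          hcor := fun z hz hlt => by
            have h1 : ‖blaschke Z z‖ < δ / 2 := by
              rw [normSq_eq_norm_sq] at hlt
              refine lt_of_pow_lt_pow_left₀ 2 (by positivity) ?_
              nlinarith
            linarith [hcor z hz] }
  have hE : ∀ z ∈ closedBall (0 : ℂ) 1, ‖exp (p.eval z)‖ ≤ Real.exp C := fun z hz => by
    rw [norm_exp]; exact Real.exp_le_exp.2 (abs_le.1 (hp z hz)).2
  obtain ⟨G, hG, hGA, hFG⟩ :=
    exists_eq_mul_blaschke (F := fun z => exp (p.eval z) - f.eval z) hR hZ hZR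
      (p.differentiable.cexp.sub f.differentiable).differentiableOn
      (fun ζ hζ => sub_eq_zero.2 (hpZ ζ hζ))
      (fun θ => (norm_sub_le _ _).trans (add_le_add (hE _ (by simp)) (hf1 _ (by simp))))
  refine ⟨G, hG.mono (ball_subset_ball hR.le), fun z hz => ?_⟩
  have hz' := ball_subset_closedBall hz
  refine ⟨hGA z hz', ?_⟩
  rw [← hFG z (ball_subset_ball hR.le hz), add_sub_cancel, norm_exp]
  have h1 := Real.exp_le_exp.2 (abs_le.1 (hp z hz')).1
  have h2 : Real.exp C * Real.exp (-C) = 1 := by rw [← Real.exp_add, add_neg_cancel, Real.exp_zero]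
  nlinarith [Real.exp_pos C, Real.exp_pos (p.eval z).re]

end

section

section limits

open Filter

variable {A : ℝ} {f g : ℂ → ℂ}

/-- A uniformly bounded sequence of holomorphic functions on the disc converges along an ultrafilter
to a holomorphic function. -/
lemma exists_differentiableOn_tendsto {G : ℕ → ℂ → ℂ} (u : Ultrafilter ℕ)
    (hG : ∀ n, DifferentiableOn ℂ (G n) (ball 0 1)) (hA : ∀ n, ∀ z ∈ ball (0 : ℂ) 1, ‖G n z‖ ≤ A) :
    ∃ H : ℂ → ℂ, DifferentiableOn ℂ H (ball 0 1) ∧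
      ∀ z ∈ ball (0 : ℂ) 1, Tendsto (fun n => G n z) u (𝓝 (H z)) := by
  have hlim : ∀ z : ℂ, ∃ w : ℂ, z ∈ ball (0 : ℂ) 1 → Tendsto (fun n => G n z) u (𝓝 w) := fun z => by
    by_cases hz : z ∈ ball (0 : ℂ) 1
    · obtain ⟨w, -, hw⟩ := (isCompact_closedBall (0 : ℂ) A).ultrafilter_le_nhds
        (u.map fun n => G n z) (by
          rw [le_principal_iff]
          change ∀ᶠ n in u, G n z ∈ closedBall (0 : ℂ) A
          exact Eventually.of_forall fun n => by simpa using hA n z hz)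
      exact ⟨w, fun _ => hw⟩
    · exact ⟨0, fun h => absurd h hz⟩
  choose H hH using hlim
  refine ⟨H, ?_, hH⟩
  have hloc : TendstoLocallyUniformlyOn G H u (ball 0 1) := by
    refine Metric.tendstoLocallyUniformlyOn_iff.2 fun ε hε x hx => ?_
    have hx1 : ‖x‖ < 1 := by simpa using hx
    set r := 1 - ‖x‖ with hr
    have hr0 : 0 < r := by linarith
    have hA0 : 0 ≤ A := (norm_nonneg _).trans (hA 0 x hx)
    have hsub : ball x r ⊆ ball 0 1 := ball_subset_ball' (by simp [hr])
    set L := (2 * A + 1) / r with hL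
    have hL0 : 0 < L := by positivity
    have hlip : ∀ n, ∀ y ∈ ball x r, dist (G n y) (G n x) ≤ L * dist y x := fun n y hy => by
      refine Complex.dist_le_div_mul_dist_of_mapsTo_ball ((hG n).mono hsub) (fun w hw => ?_) hy
      have h1 := norm_sub_le (G n w) (G n x)
      have h2 := hA n w (hsub hw)
      have h3 := hA n x hx
      rw [mem_closedBall, dist_eq_norm]
      linarith
    have hlipH : ∀ y ∈ ball x r, dist (H y) (H x) ≤ L * dist y x := fun y hy =>
      le_of_tendsto ((hH y (hsub hy)).dist (hH x hx)) (Eventually.of_forall fun n => hlip n y hy)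
    refine ⟨ball x (min r (ε / (4 * L))),
      mem_nhdsWithin_of_mem_nhds (ball_mem_nhds _ (by positivity)), ?_⟩
    filter_upwards [Metric.tendsto_nhds.1 (hH x hx) (ε / 4) (by positivity)] with n hn y hy
    have hyr : y ∈ ball x r := ball_subset_ball (min_le_left _ _) hy
    have hyL : L * dist y x ≤ ε / 4 := by
      have := (mem_ball.1 hy).le.trans (min_le_right _ _)
      rw [le_div_iff₀ (by positivity)] at this
      linarith
    have h1 := dist_triangle4 (H y) (H x) (G n x) (G n y)
    have h2 := hlipH y hyr
    have h3 := hlip n y hyr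
    rw [dist_comm (G n y)] at h3
    rw [dist_comm (H x)] at h1
    linarith
  exact hloc.differentiableOn (Eventually.of_forall hG) isOpen_ball

lemma Correctable.of_tendsto {fn gn : ℕ → ℂ → ℂ} (h : ∀ᶠ n in atTop, Correctable A (fn n) (gn n))
    (hf : ∀ z ∈ ball (0 : ℂ) 1, Tendsto (fun n => fn n z) atTop (𝓝 (f z)))
    (hg : ∀ z ∈ ball (0 : ℂ) 1, Tendsto (fun n => gn n z) atTop (𝓝 (g z))) :
    Correctable A f g := by
  obtain ⟨N, hN⟩ := eventually_atTop.1 h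
  choose! G hG hGA using fun n (_ : n ≥ 0) => hN (n + N) (Nat.le_add_left N n)
  simp only [ge_iff_le, zero_le, forall_const] at hG hGA
  have hu : ((hyperfilter ℕ : Ultrafilter ℕ) : Filter ℕ) ≤ atTop := by
    rw [← Nat.cofinite_eq_atTop]; exact hyperfilter_le_cofinite
  obtain ⟨H, hH, hlim⟩ := exists_differentiableOn_tendsto (hyperfilter ℕ) hG
    fun n z hz => (hGA n z hz).1
  refine ⟨H, hH, fun z hz => ⟨?_, ?_⟩⟩
  · exact le_of_tendsto (hlim z hz).norm (Eventually.of_forall fun n => (hGA n z hz).1)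
  · have hs : Tendsto (fun n : ℕ => n + N) (hyperfilter ℕ : Ultrafilter ℕ) atTop :=
      (tendsto_add_atTop_nat N).mono_left hu
    exact ge_of_tendsto (((((hf z hz).comp hs).add
      (((hg z hz).comp hs).mul (hlim z hz))).norm).const_mul
      A) (Eventually.of_forall fun n => (hGA n z hz).2)

lemma Correctable.congr {f' g' : ℂ → ℂ} (h : Correctable A f g)
    (hf : ∀ z ∈ ball (0 : ℂ) 1, f z = f' z) (hg : ∀ z ∈ ball (0 : ℂ) 1, g z = g' z) :
    Correctable A f' g' := by
  obtain ⟨G, hG, h⟩ := h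
  exact ⟨G, hG, fun z hz => by rw [← hf z hz, ← hg z hz]; exact h z hz⟩

lemma Correctable.of_const_mul {c : ℝ} (hc : 1 ≤ c)
    (h : Correctable A (fun z => f z / c) g) : Correctable (c * A) f g := by
  obtain ⟨G, hG, h⟩ := h
  have hc0 : 0 < c := by linarith
  refine ⟨fun z => c * G z, hG.const_mul _, fun z hz => ⟨?_, ?_⟩⟩
  · rw [norm_mul, norm_real, Real.norm_of_nonneg hc0.le]
    exact mul_le_mul_of_nonneg_left (h z hz).1 hc0.le
  · have h1 : f z + g z * (c * G z) = c * (f z / c + g z * G z) := by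
      have : (c : ℂ) ≠ 0 := by exact_mod_cast hc0.ne'
      field_simp
    rw [h1, norm_mul, norm_real, Real.norm_of_nonneg hc0.le]
    have h2 := (h z hz).2
    nlinarith [mul_le_mul hc hc zero_le_one hc0.le]

end limits

lemma exists_polynomial_div_pow_near {F : ℂ → ℂ} (hF : ContinuousOn F (sphere 0 1)) {ε : ℝ}
    (hε : 0 < ε) : ∃ (m : ℕ) (s : Polynomial ℂ), ∀ z ∈ sphere (0 : ℂ) 1,
      ‖s.eval z / z ^ m - F z‖ < ε := by
  have hc : Continuous fun x : AddCircle (2 * π) => F (x.toCircle : ℂ) :=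
    hF.comp_continuous (continuous_subtype_val.comp AddCircle.continuous_toCircle)
      fun x => mem_sphere_zero_iff_norm.2 x.toCircle.norm_coe
  have h1 : (⟨_, hc⟩ : C(AddCircle (2 * π), ℂ)) ∈
      closure (Submodule.span ℂ (range (fourier (T := 2 * π))) : Set C(AddCircle (2 * π), ℂ)) := by
    rw [← Submodule.topologicalClosure_coe, span_fourier_closure_eq_top]; trivial
  obtain ⟨v, hv, hvε⟩ := Metric.mem_closure_iff.1 h1 ε hε
  obtain ⟨m, s, hs⟩ : ∃ (m : ℕ) (s : Polynomial ℂ), ∀ x : AddCircle (2 * π),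
      v x = s.eval (x.toCircle : ℂ) / (x.toCircle : ℂ) ^ m := by
    clear hvε
    induction hv using Submodule.span_induction with
    | mem v hv =>
      obtain ⟨n, rfl⟩ := hv
      obtain ⟨m, rfl | rfl⟩ := n.eq_nat_or_neg
      · exact ⟨0, Polynomial.X ^ m, fun x => by simp [fourier_apply, AddCircle.toCircle_nsmul]⟩
      · exact ⟨m, 1, fun x => by
          simp [fourier_apply, AddCircle.toCircle_nsmul, AddCircle.toCircle_neg]⟩
    | zero => exact ⟨0, 0, by simp⟩
    | add u v _ _ hu hv =>
      obtain ⟨m, s, hu⟩ := hu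
      obtain ⟨n, t, hv⟩ := hv
      refine ⟨m + n, Polynomial.X ^ n * s + Polynomial.X ^ m * t, fun x => ?_⟩
      have : (x.toCircle : ℂ) ≠ 0 := x.toCircle.coe_ne_zero
      rw [ContinuousMap.add_apply, hu, hv]
      simp only [Polynomial.eval_add, Polynomial.eval_mul, Polynomial.eval_pow, Polynomial.eval_X]
      field_simp
      ring
    | smul c u _ hu =>
      obtain ⟨m, s, hu⟩ := hu
      exact ⟨m, c • s, fun x => by rw [ContinuousMap.smul_apply, hu]; simp [mul_div_assoc]⟩
  refine ⟨m, s, fun z hz => ?_⟩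
  obtain ⟨θ, rfl⟩ : ∃ θ : ℝ, z = cis θ := ⟨arg z, by
    have := norm_mul_exp_arg_mul_I z
    rw [mem_sphere_zero_iff_norm.1 hz, ofReal_one, one_mul] at this
    rw [cis_eq_exp, this]⟩
  have h2 := (ContinuousMap.dist_apply_le_dist (f := ⟨_, hc⟩) (g := v)
    (θ : AddCircle (2 * π))).trans_lt hvε
  rw [dist_comm, hs, toCircle_coe, dist_eq_norm, ContinuousMap.coe_mk, toCircle_coe] at h2
  exact h2

end

section

section rouche

open Polynomial

variable {g : ℂ[X]} {ρ : ℝ} {N d : ℕ} {z : ℂ}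

lemma norm_eval_le_mul_pow (hd : g.natDegree ≤ d)
    (hg : ∀ z ∈ closedBall (0 : ℂ) 1, ‖g.eval z‖ ≤ ρ) (hz : 1 ≤ ‖z‖) :
    ‖g.eval z‖ ≤ ρ * ‖z‖ ^ d := by
  have key : ∀ w : ℂ, w ≠ 0 → g.eval w = (reflect d g).eval w⁻¹ * w ^ d := fun w hw => by
    let _ := invertibleOfNonzero hw
    have := eval₂_reflect_mul_pow (RingHom.id ℂ) w d g hd
    rw [invOf_eq_inv] at this
    exact this.symm
  have hz0 : z ≠ 0 := norm_pos_iff.1 (by linarith)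
  rw [key z hz0, norm_mul, norm_pow]
  refine mul_le_mul_of_nonneg_right ?_ (by positivity)
  refine norm_le_of_norm_cis_le (F := fun w => (reflect d g).eval w) one_lt_two
    (reflect d g).differentiable.differentiableOn (fun θ => ?_)
    (by simpa using inv_le_one_of_one_le₀ hz)
  have hc : cis θ ≠ 0 := norm_pos_iff.1 (by simp)
  have h := key (cis θ)⁻¹ (inv_ne_zero hc)
  rw [inv_inv] at h
  have h1 := hg (cis θ)⁻¹ (by simp)
  rw [h, norm_mul, norm_pow, norm_inv, norm_cis] at h1
  simpa using h1

lemma exists_nodup_roots_add_C {p : ℂ[X]} (hp : 0 < p.natDegree) {ε : ℝ} (hε : 0 < ε) :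
    ∃ c : ℂ, ‖c‖ < ε ∧ (p + C c).roots.Nodup := by
  have hp' : derivative p ≠ 0 := fun h => hp.ne' (derivative_eq_zero.1 h)
  have hfin : ((fun ξ => -p.eval ξ) '' (derivative p).rootSet ℂ).Finite :=
    (rootSet_finite _ _).image _
  obtain ⟨c, hc, hc'⟩ := ((infinite_of_mem_nhds (0 : ℂ) (ball_mem_nhds 0 hε)).sdiff hfin).nonempty
  refine ⟨c, by simpa using hc, Multiset.nodup_iff_count_le_one.2 fun ξ => ?_⟩
  have hne : p + C c ≠ 0 := fun h => by
    have := natDegree_add_C (p := p) (a := c)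
    rw [h, natDegree_zero] at this
    omega
  rw [count_roots]
  by_contra! h
  obtain ⟨h1, h2⟩ := (one_lt_rootMultiplicity_iff_isRoot hne).1 h
  refine hc' ⟨ξ, ?_, ?_⟩
  · rw [mem_rootSet_of_ne hp']
    simpa [IsRoot] using h2
  · simp only [IsRoot.def, eval_add, eval_C] at h1
    exact neg_eq_of_add_eq_zero_right h1

lemma exists_blaschke_mul_eq (hρ : ρ < 1) (hd : g.natDegree ≤ d) (hN : d < N)
    (hg : ∀ z ∈ closedBall (0 : ℂ) 1, ‖g.eval z‖ ≤ ρ) (hnd : (X ^ N + g).roots.Nodup) :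
    ∃ Z : Finset ℂ, (∀ ζ ∈ Z, ‖ζ‖ < 1) ∧ ∃ q : ℂ → ℂ,
      (∀ z ∈ closedBall (0 : ℂ) 1, ‖q z - 1‖ ≤ ρ * ‖z‖ ^ (N - d)) ∧
      ∀ z ∈ closedBall (0 : ℂ) 1, z ^ N + g.eval z = blaschke Z z * q z := by
  set p := X ^ N + g with hp
  have hρ0 : 0 ≤ ρ := (norm_nonneg _).trans (hg 0 (by simp))
  have hdeg : g.degree < N := degree_le_natDegree.trans_lt (by exact_mod_cast hd.trans_lt hN)
  have hmon : p.Monic := monic_X_pow_add hdeg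
  have hnat : p.natDegree = N := by
    rw [hp, natDegree_add_eq_left_of_natDegree_lt (by rw [natDegree_X_pow]; omega), natDegree_X_pow]
  have hev : ∀ z, p.eval z = z ^ N + g.eval z := fun z => by simp [hp]
  set Z := p.roots.toFinset with hZdef
  have hZval : Z.val = p.roots := by rw [hZdef, Multiset.toFinset_val, hnd.dedup]
  have hprod : ∀ z, p.eval z = ∏ ζ ∈ Z, (z - ζ) := fun z => by
    conv_lhs => rw [(IsAlgClosed.splits p).eq_prod_roots_of_monic hmon]
    rw [eval_multiset_prod, Finset.prod, hZval, Multiset.map_map]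
    simp
  have hcard : Z.card = N := by
    rw [Finset.card, hZval, ← hnat, splits_iff_card_roots.1 (IsAlgClosed.splits p)]
  have hZ : ∀ ζ ∈ Z, ‖ζ‖ < 1 := fun ζ hζ => by
    by_contra! h
    have h0 : p.eval ζ = 0 := by rw [hprod]; exact Finset.prod_eq_zero hζ (sub_self _)
    rw [hev] at h0
    have h1 := norm_eval_le_mul_pow (hd.trans hN.le) hg h
    rw [← norm_neg, ← eq_neg_of_add_eq_zero_left h0, norm_pow] at h1
    have := one_le_pow₀ h (n := N)
    nlinarith
  refine ⟨Z, hZ, fun z => ∏ ζ ∈ Z, (1 - conj ζ * z), fun z hz => ?_, fun z hz => ?_⟩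
  · rcases eq_or_ne z 0 with rfl | hz0
    · simp; positivity
    · have hz1 : ‖z‖ ≤ 1 := by simpa using hz
      have hzp : 0 < ‖z‖ := norm_pos_iff.2 hz0
      have h1 : ∏ ζ ∈ Z, (1 - conj ζ * z) = z ^ N * conj (p.eval (conj z)⁻¹) := by
        rw [hprod, map_prod, ← hcard, ← Finset.prod_const, ← Finset.prod_mul_distrib]
        refine Finset.prod_congr rfl fun ζ _ => ?_
        simp only [map_sub, map_inv₀, conj_conj]
        field_simp
      have h2 : ∏ ζ ∈ Z, (1 - conj ζ * z) - 1 = z ^ N * conj (g.eval (conj z)⁻¹) := by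
        rw [h1, hev]
        simp only [map_add, map_pow, map_inv₀, conj_conj]
        rw [mul_add, inv_pow, mul_inv_cancel₀ (pow_ne_zero N hz0), add_sub_cancel_left]
      have h3 := norm_eval_le_mul_pow (z := (conj z)⁻¹) hd hg
        (by rw [norm_inv, norm_conj]; exact (one_le_inv₀ hzp).2 hz1)
      rw [norm_inv, norm_conj, inv_pow] at h3
      rw [h2, norm_mul, norm_conj, norm_pow]
      calc ‖z‖ ^ N * ‖g.eval (conj z)⁻¹‖ ≤ ‖z‖ ^ N * (ρ * (‖z‖ ^ d)⁻¹) :=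
            mul_le_mul_of_nonneg_left h3 (by positivity)
        _ = ρ * ‖z‖ ^ (N - d) := by rw [pow_sub₀ _ hzp.ne' hN.le]; ring
  · rw [← hev, hprod, blaschke, ← Finset.prod_mul_distrib]
    obtain ⟨R, hR, hZR⟩ := exists_one_lt_mul_lt Z hZ
    refine Finset.prod_congr rfl fun ζ hζ => (div_mul_cancel₀ _ ?_).symm
    exact one_sub_conj_mul_ne_zero (hZR ζ hζ) (closedBall_subset_of_one_lt hR hz)

end rouche

end

section

section polynomial

open Polynomial Filter

variable {δ : ℝ} {f g : ℂ[X]}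

lemma norm_add_mul_conj_mul_div_norm {a : ℂ} (b : ℂ) (ha : a ≠ 0) :
    ‖a + b * (conj b * a / ‖a‖)‖ = ‖a‖ + ‖b‖ ^ 2 := by
  have h0 : 0 < ‖a‖ := norm_pos_iff.2 ha
  have h1 : (‖a‖ : ℂ) ≠ 0 := ofReal_ne_zero.2 h0.ne'
  have h2 : a + b * (conj b * a / ‖a‖) = ((1 + ‖b‖ ^ 2 / ‖a‖ : ℝ) : ℂ) * a := by
    have h3 : b * conj b = ((‖b‖ ^ 2 : ℝ) : ℂ) := by
      rw [mul_conj, normSq_eq_norm_sq]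
    rw [mul_div_assoc, ← mul_assoc, h3]
    push_cast
    field_simp
  rw [h2, norm_mul, norm_real, Real.norm_of_nonneg (by positivity)]
  field_simp

/-- Near the circle, the pair is corrected by a quotient `s / z ^ m`. -/
lemma exists_correction_near_circle (hδ : 0 < δ) (hδ1 : δ ≤ 1)
    (hg : ∀ z ∈ sphere (0 : ℂ) 1, ‖g.eval z‖ ≤ 1) (hf0 : ∀ z ∈ sphere (0 : ℂ) 1, f.eval z ≠ 0)
    (hcor : ∀ z ∈ sphere (0 : ℂ) 1, δ ≤ ‖f.eval z‖ + ‖g.eval z‖) :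
    ∃ (m : ℕ) (s : ℂ[X]) (r : ℝ), 0 < r ∧ r < 1 ∧ (∀ z ∈ sphere (0 : ℂ) 1, ‖s.eval z‖ ≤ 2) ∧
      ∀ z : ℂ, r ≤ ‖z‖ → ‖z‖ ≤ 1 → ‖s.eval z‖ ≤ 3 * ‖z‖ ^ m ∧
        δ ^ 2 / 16 * ‖z‖ ^ m ≤ ‖f.eval z * z ^ m - g.eval z * s.eval z‖ := by
  have hF : ContinuousOn (fun z => -(conj (g.eval z) * f.eval z / ‖f.eval z‖))
      (sphere (0 : ℂ) 1) := by
    refine (ContinuousOn.div ?_ ?_ fun z hz => ?_).neg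
    · exact ((continuous_conj.comp g.continuous).mul f.continuous).continuousOn
    · exact (continuous_ofReal.comp f.continuous.norm).continuousOn
    · exact ofReal_ne_zero.2 (norm_ne_zero_iff.2 (hf0 z hz))
  obtain ⟨m, s, hs⟩ := exists_polynomial_div_pow_near hF (ε := δ ^ 2 / 8) (by positivity)
  have hs2 : ∀ z ∈ sphere (0 : ℂ) 1, ‖s.eval z‖ ≤ 2 := fun z hz => by
    have hz1 : ‖z‖ = 1 := by simpa using hz
    have h1 := norm_add_le (s.eval z / z ^ m - -(conj (g.eval z) * f.eval z / ‖f.eval z‖))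
      (-(conj (g.eval z) * f.eval z / ‖f.eval z‖))
    rw [sub_add_cancel, norm_div, norm_pow, hz1, one_pow, div_one, norm_neg, norm_div, norm_mul,
      norm_conj, norm_real, norm_norm,
      mul_div_cancel_right₀ _ (norm_ne_zero_iff.2 (hf0 z hz))] at h1
    have h2 := hs z hz
    have h3 := hg z hz
    nlinarith
  have hcirc : ∀ z ∈ sphere (0 : ℂ) 1,
      δ ^ 2 / 8 ≤ ‖f.eval z * z ^ m - g.eval z * s.eval z‖ := fun z hz => by
    have hz1 : ‖z‖ = 1 := by simpa using hz
    have hz0 : z ^ m ≠ 0 := pow_ne_zero _ (norm_pos_iff.1 (by linarith))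
    have h1 : f.eval z * z ^ m - g.eval z * s.eval z
        = z ^ m * (f.eval z + g.eval z * (conj (g.eval z) * f.eval z / ‖f.eval z‖)
          - g.eval z * (s.eval z / z ^ m - -(conj (g.eval z) * f.eval z / ‖f.eval z‖))) := by
      have h2 : s.eval z = z ^ m * (s.eval z / z ^ m) := by field_simp
      generalize s.eval z / z ^ m = t at *
      rw [h2]
      ring
    rw [h1, norm_mul, norm_pow, hz1, one_pow, one_mul]
    refine le_trans ?_ (norm_sub_norm_le _ _)
    rw [norm_add_mul_conj_mul_div_norm _ (hf0 z hz), norm_mul]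
    have h3 := hs z hz
    have h4 := mul_le_mul (hg z hz) h3.le (norm_nonneg _) zero_le_one
    have h5 := hcor z hz
    nlinarith [norm_nonneg (f.eval z), norm_nonneg (g.eval z), hg z hz,
      sq_nonneg (‖g.eval z‖ - δ / 2)]
  set U := {z : ℂ | ‖s.eval z‖ < 3 * ‖z‖ ^ m ∧
    δ ^ 2 / 16 * ‖z‖ ^ m < ‖f.eval z * z ^ m - g.eval z * s.eval z‖} with hU
  have hUo : IsOpen U := (isOpen_lt s.continuous.norm (by fun_prop)).inter
    (isOpen_lt (by fun_prop) ((f.continuous.mul (by fun_prop)).sub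
      (g.continuous.mul s.continuous)).norm)
  have hsU : sphere (0 : ℂ) 1 ⊆ U := fun z hz => by
    have hz1 : ‖z‖ = 1 := by simpa using hz
    have h1 := hs2 z hz
    have h2 := hcirc z hz
    constructor
    · rw [hz1]; linarith [one_pow (M := ℝ) m]
    · rw [hz1, one_pow]; nlinarith
  obtain ⟨t, ht, htU⟩ := (isCompact_sphere (0 : ℂ) 1).exists_thickening_subset_open hUo hsU
  have hr1 : max (1 / 2) (1 - t / 2) < 1 := max_lt (by norm_num) (by linarith)
  refine ⟨m, s, max (1 / 2) (1 - t / 2), lt_max_of_lt_left (by norm_num), hr1, hs2,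
    fun z hz hz1 => ?_⟩
  have hzp : 0 < ‖z‖ := lt_of_lt_of_le (by norm_num) ((le_max_left _ _).trans hz)
  have hzt : 1 - t / 2 ≤ ‖z‖ := (le_max_right _ _).trans hz
  have hzU : z ∈ U := htU (mem_thickening_iff.2 ⟨z / ‖z‖, by
    simp [hzp.ne'], by
      rw [dist_eq_norm]
      have h1 : z - z / ‖z‖ = z / ‖z‖ * ((‖z‖ - 1 : ℝ) : ℂ) := by
        have : (‖z‖ : ℂ) ≠ 0 := ofReal_ne_zero.2 hzp.ne'
        push_cast
        field_simp
      rw [h1, norm_mul, norm_div, norm_real, norm_norm, div_self hzp.ne', one_mul, norm_real,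
        Real.norm_eq_abs, abs_lt]
      constructor <;> linarith⟩)
  exact ⟨hzU.1.le, hzU.2.le⟩

end polynomial

end

section

section polynomial

open Polynomial Filter

lemma corona_near_circle {δ c : ℝ} {a b s z l u v : ℂ} {m : ℕ} (hz : z ≠ 0)
    (hs : ‖s‖ ≤ 3 * ‖z‖ ^ m) (hc : δ ^ 2 / 16 * ‖z‖ ^ m ≤ ‖a * z ^ m - b * s‖) (hl : ‖l‖ ≤ c)
    (hcδ : c ≤ δ ^ 2 / 96) (hu : u * z ^ m = a * z ^ m + (v - b - l) * s) :
    δ ^ 2 / 32 ≤ ‖u‖ + 3 * ‖v‖ := by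
  have hzp : 0 < ‖z‖ ^ m := pow_pos (norm_pos_iff.2 hz) m
  have h1 : a * z ^ m - b * s = u * z ^ m - v * s + l * s := by rw [hu]; ring
  have h2 : ‖a * z ^ m - b * s‖ ≤ ‖u‖ * ‖z‖ ^ m + ‖v‖ * ‖s‖ + ‖l‖ * ‖s‖ := by
    rw [h1]
    refine (norm_add_le _ _).trans (add_le_add ((norm_sub_le _ _).trans ?_) (norm_mul _ _).le)
    rw [norm_mul, norm_mul, norm_pow]
  have h3 := mul_le_mul_of_nonneg_left hs (norm_nonneg v)
  have h4 := mul_le_mul (hl.trans hcδ) hs (norm_nonneg _) (by positivity)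
  refine le_of_mul_le_mul_right ?_ hzp
  nlinarith

/-- The theorem for polynomials in general position. -/
lemma exists_correctable_polynomial {δ : ℝ} (hδ : 0 < δ) (hδ1 : δ ≤ 1) : ∃ A, 0 < A ∧
    ∀ (f g : ℂ[X]) (ρ : ℝ), ρ < 1 → (∀ z ∈ closedBall (0 : ℂ) 1, ‖f.eval z‖ ≤ 1) →
      (∀ z ∈ closedBall (0 : ℂ) 1, ‖g.eval z‖ ≤ ρ) →
      (∀ z ∈ sphere (0 : ℂ) 1, f.eval z ≠ 0) →
      (∀ z ∈ closedBall (0 : ℂ) 1, δ ≤ ‖f.eval z‖ + ‖g.eval z‖) →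
      Correctable A (fun z => f.eval z) fun z => g.eval z := by
  obtain ⟨A, hA, hcorr⟩ := exists_correctable_blaschke (δ := δ ^ 2 / 300) (by positivity)
    (by nlinarith)
  refine ⟨3 * A, by positivity, fun f g ρ hρ hf1 hg1 hf0 hcor => ?_⟩
  have hss : sphere (0 : ℂ) 1 ⊆ closedBall 0 1 := sphere_subset_closedBall
  obtain ⟨m, s, r, hr0, hr1, hs2, hs⟩ := exists_correction_near_circle hδ hδ1
    (fun z hz => (hg1 z (hss hz)).trans hρ.le) hf0 fun z hz => hcor z (hss hz)
  set d := g.natDegree with hd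
  set ρ' := (1 + ρ) / 2 with hρ'
  choose l hl hlr using fun n : ℕ => show ∃ c : ℂ, ‖c‖ < 1 / ((n : ℝ) + 1) ∧
      (d < n → (X ^ n + (g + C c)).roots.Nodup) by
    by_cases hn : d < n
    · obtain ⟨c, hc, h⟩ := exists_nodup_roots_add_C (p := X ^ n + g)
        (by
          rw [natDegree_add_eq_left_of_natDegree_lt (by rwa [natDegree_X_pow]), natDegree_X_pow]
          omega)
        (Nat.one_div_pos_of_nat (n := n) (α := ℝ))
      exact ⟨c, hc, fun _ => by rwa [← add_assoc]⟩
    · exact ⟨0, by rw [norm_zero]; exact Nat.one_div_pos_of_nat, fun h => absurd h hn⟩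
  have hl0 : Tendsto (fun n => ‖l n‖) atTop (𝓝 0) :=
    squeeze_zero (fun _ => norm_nonneg _) (fun n => (hl n).le)
      tendsto_one_div_add_atTop_nhds_zero_nat
  have hg' : ∀ n, ‖l n‖ ≤ (1 - ρ) / 2 → ∀ z ∈ closedBall (0 : ℂ) 1,
      ‖(g + C (l n)).eval z‖ ≤ ρ' := fun n hn z hz => by
    rw [eval_add, eval_C]
    linarith [norm_add_le (g.eval z) (l n), hg1 z hz]
  choose Z q hZ using fun n : ℕ => show ∃ (Z : Finset ℂ) (q : ℂ → ℂ),
      d < n → ‖l n‖ ≤ (1 - ρ) / 2 → (∀ ζ ∈ Z, ‖ζ‖ < 1) ∧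
        (∀ z ∈ closedBall (0 : ℂ) 1, ‖q z - 1‖ ≤ ρ' * ‖z‖ ^ (n - d)) ∧
        ∀ z ∈ closedBall (0 : ℂ) 1, z ^ n + (g + C (l n)).eval z = blaschke Z z * q z by
    by_cases hn : d < n ∧ ‖l n‖ ≤ (1 - ρ) / 2
    · obtain ⟨Z, hZ, q, hq⟩ := exists_blaschke_mul_eq (g := g + C (l n)) (ρ := ρ') (N := n) (d := d)
        (by linarith) (by rw [natDegree_add_C]) hn.1 (hg' n hn.2) (hlr n hn.1)
      exact ⟨Z, q, fun _ _ => ⟨hZ, hq⟩⟩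
    · exact ⟨∅, 0, fun h1 h2 => absurd ⟨h1, h2⟩ hn⟩
  obtain ⟨M, hM⟩ := (isCompact_closedBall (0 : ℂ) 1).exists_bound_of_continuousOn
    s.continuous.continuousOn
  have hM0 : 0 ≤ M := (norm_nonneg _).trans (hM 0 (by simp))
  have hel : ∀ᶠ n in atTop, ‖l n‖ ≤ (1 - ρ) / 2 := hl0.eventually_le_const (by linarith)
  have hsub : ∀ k, Tendsto (fun n : ℕ => n - k) atTop atTop := tendsto_sub_atTop_nat
  have hρ0 : 0 ≤ ρ' := by linarith [(norm_nonneg _).trans (hg1 0 (by simp))]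
  set F : ℕ → ℂ[X] := fun n => C (1 / 3) * (f + X ^ (n - m) * s) with hF
  have hFev : ∀ n z, (F n).eval z = (f.eval z + z ^ (n - m) * s.eval z) / 3 := fun n z => by
    simp [hF]; ring
  have hmain : ∀ᶠ n in atTop, Correctable A (fun z => (F n).eval z) (blaschke (Z n)) := by
    have he1 : ∀ᶠ n in atTop, ‖l n‖ ≤ δ ^ 2 / 96 := hl0.eventually_le_const (by positivity)
    have he2 : ∀ᶠ n : ℕ in atTop, M * r ^ (n - m) + r ^ n + ‖l n‖ ≤ δ / 2 := by
      have ht := ((((tendsto_pow_atTop_nhds_zero_of_lt_one hr0.le hr1).comp (hsub m)).const_mul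
        M).add (tendsto_pow_atTop_nhds_zero_of_lt_one hr0.le hr1)).add hl0
      rw [mul_zero, add_zero, add_zero] at ht
      exact ht.eventually_le_const (by positivity)
    filter_upwards [hel, he1, he2, eventually_gt_atTop d, eventually_ge_atTop m]
      with n h1 h2 h3 hdn hmn
    obtain ⟨hZ1, hq, hB⟩ := hZ n hdn h1
    refine hcorr (F n) (Z n) hZ1 (fun z hz => ?_) fun z hz => ?_
    · refine norm_le_of_norm_cis_le (F := fun z => (F n).eval z) one_lt_two
        (F n).differentiable.differentiableOn (fun θ => ?_) hz
      have h4 := norm_add_le (f.eval (cis θ)) (cis θ ^ (n - m) * s.eval (cis θ))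
      rw [norm_mul, norm_pow, norm_cis, one_pow, one_mul] at h4
      rw [hFev, norm_div, RCLike.norm_ofNat, div_le_one (by norm_num)]
      linarith [hf1 (cis θ) (by simp), hs2 (cis θ) (by simp)]
    · have hz1 : ‖z‖ ≤ 1 := by simpa using hz
      have hq2 : ‖q n z‖ ≤ 2 := by
        have h4 := norm_add_le (q n z - 1) 1
        rw [sub_add_cancel, norm_one] at h4
        have h5 := mul_le_mul_of_nonneg_left (pow_le_one₀ (norm_nonneg z) hz1 (n := n - d)) hρ0
        linarith [hq z hz]
      have hB2 : ‖z ^ n + g.eval z + l n‖ ≤ ‖blaschke (Z n) z‖ * 2 := by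
        have h4 := hB z hz
        rw [eval_add, eval_C, ← add_assoc] at h4
        rw [h4, norm_mul]
        exact mul_le_mul_of_nonneg_left hq2 (norm_nonneg _)
      rw [hFev, norm_div, RCLike.norm_ofNat]
      rcases le_total r ‖z‖ with hrz | hrz
      · obtain ⟨h4, h5⟩ := hs z hrz hz1
        have := corona_near_circle (u := f.eval z + z ^ (n - m) * s.eval z)
          (v := z ^ n + g.eval z + l n) (norm_pos_iff.1 (hr0.trans_le hrz)) h4 h5 le_rfl h2 (by
            have : z ^ n = z ^ (n - m) * z ^ m := by rw [← pow_add, Nat.sub_add_cancel hmn]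
            rw [this]; ring)
        nlinarith [norm_nonneg (f.eval z + z ^ (n - m) * s.eval z)]
      · have h4 : ‖f.eval z‖ ≤ ‖f.eval z + z ^ (n - m) * s.eval z‖ + M * r ^ (n - m) := by
          have h5 := norm_sub_le (f.eval z + z ^ (n - m) * s.eval z) (z ^ (n - m) * s.eval z)
          rw [add_sub_cancel_right, norm_mul, norm_pow] at h5
          have h6 := mul_le_mul (pow_le_pow_left₀ (norm_nonneg z) hrz (n - m)) (hM z hz)
            (norm_nonneg _) (by positivity)
          linarith
        have h5 : ‖g.eval z‖ ≤ ‖z ^ n + g.eval z + l n‖ + r ^ n + ‖l n‖ := by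
          have h5 := norm_sub_le (z ^ n + g.eval z + l n) (z ^ n + l n)
          have h6 := norm_add_le (z ^ n) (l n)
          rw [norm_pow] at h6
          rw [show z ^ n + g.eval z + l n - (z ^ n + l n) = g.eval z by ring] at h5
          linarith [pow_le_pow_left₀ (norm_nonneg z) hrz n]
        have h6 := hcor z hz
        nlinarith [norm_nonneg (z ^ n + g.eval z + l n)]
  have hlim : Correctable A (fun z => f.eval z / (3 : ℝ)) fun z => g.eval z := by
    refine Correctable.of_tendsto hmain (fun z hz => ?_) fun z hz => ?_
    · have hz1 : ‖z‖ < 1 := by simpa using hz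
      have ht := ((((tendsto_pow_atTop_nhds_zero_of_norm_lt_one hz1).comp (hsub m)).mul_const
        (s.eval z)).const_add (f.eval z)).div_const 3
      rw [zero_mul, add_zero] at ht
      simpa [hFev, Function.comp_def] using ht
    · have hz1 : ‖z‖ < 1 := by simpa using hz
      have hz' := ball_subset_closedBall hz
      have hqt : Tendsto (fun n => q n z) atTop (𝓝 1) := by
        rw [tendsto_iff_norm_sub_tendsto_zero]
        have ht := ((tendsto_pow_atTop_nhds_zero_of_lt_one (norm_nonneg z) hz1).comp
          (hsub d)).const_mul ρ'
        rw [mul_zero] at ht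
        refine squeeze_zero' (Eventually.of_forall fun _ => norm_nonneg _) ?_ ht
        filter_upwards [hel, eventually_gt_atTop d] with n h1 hdn
        exact (hZ n hdn h1).2.1 z hz'
      have ht := (((tendsto_pow_atTop_nhds_zero_of_norm_lt_one hz1).add_const (g.eval z)).add
        (tendsto_zero_iff_norm_tendsto_zero.2 hl0)).div hqt one_ne_zero
      rw [zero_add, add_zero, div_one] at ht
      refine ht.congr' ?_
      filter_upwards [hel, eventually_gt_atTop d, hqt.eventually_ne one_ne_zero] with n h1 hdn hq0
      have h2 := (hZ n hdn h1).2.2 z hz'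
      rw [eval_add, eval_C, ← add_assoc] at h2
      rw [Pi.div_apply, div_eq_iff hq0, h2]
  exact hlim.of_const_mul (by norm_num)

end polynomial

end

section

section general

open Polynomial Filter

variable {f : ℂ → ℂ} {r ε : ℝ}

lemma exists_polynomial_near (hf : DifferentiableOn ℂ f (ball 0 1)) (hr : 0 < r) (hr1 : r < 1)
    (hε : 0 < ε) : ∃ P : ℂ[X], ∀ z ∈ closedBall (0 : ℂ) 1, ‖P.eval z - f (r * z)‖ < ε := by
  obtain ⟨a, hra, ha1⟩ := exists_between hr1
  obtain ⟨b, hab, hb1⟩ := exists_between ha1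
  have ha0 := hr.trans hra
  have hb0 := ha0.trans hab
  lift a to NNReal using ha0.le
  lift b to NNReal using hb0.le
  have hs := (hf.mono (closedBall_subset_ball hb1)).hasFPowerSeriesOnBall (by exact_mod_cast hb0)
  have hu := hs.tendstoUniformlyOn (r' := a) (by exact_mod_cast hab)
  obtain ⟨n, hn⟩ := (Metric.tendstoUniformlyOn_iff.1 hu ε hε).exists
  set p := cauchyPowerSeries f 0 b
  refine ⟨∑ k ∈ Finset.range n, C (r ^ k * p.coeff k) * X ^ k, fun z hz => ?_⟩
  have hz1 : ‖z‖ ≤ 1 := by simpa using hz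
  have h := hn (r * z) (by
    rw [mem_ball_zero_iff, norm_mul, norm_real, Real.norm_of_nonneg hr.le]
    nlinarith [norm_nonneg z])
  rw [dist_comm, dist_eq_norm, zero_add] at h
  have heq : (∑ k ∈ Finset.range n, C (r ^ k * p.coeff k) * X ^ k).eval z
      = p.partialSum n (r * z) := by
    rw [eval_finsetSum, FormalMultilinearSeries.partialSum]
    refine Finset.sum_congr rfl fun k _ => ?_
    rw [FormalMultilinearSeries.apply_eq_pow_smul_coeff]
    simp only [eval_mul, eval_C, eval_pow, eval_X, smul_eq_mul]
    ring
  rwa [heq]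

lemma exists_polynomial_ne_zero_near (hf : DifferentiableOn ℂ f (ball 0 1)) (hr : 0 < r)
    (hr1 : r < 1) (hε : 0 < ε) :
    ∃ P : ℂ[X], P ≠ 0 ∧ ∀ z ∈ closedBall (0 : ℂ) 1, ‖P.eval z - f (r * z)‖ < ε := by
  obtain ⟨P, hP⟩ := exists_polynomial_near hf hr hr1 (half_pos hε)
  rcases eq_or_ne P 0 with rfl | hP0
  · refine ⟨C ((ε / 2 : ℝ) : ℂ), by simpa using hε.ne', fun z hz => ?_⟩
    have h1 := hP z hz
    rw [eval_zero, zero_sub, norm_neg] at h1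
    rw [eval_C]
    refine (norm_sub_le _ _).trans_lt ?_
    rw [norm_real, Real.norm_of_nonneg (by positivity)]
    linarith
  · exact ⟨P, hP0, fun z hz => (hP z hz).trans (half_lt_self hε)⟩

lemma exists_mem_Ioo_forall_eval_ne_zero {P : ℂ[X]} (hP : P ≠ 0) (hr : 0 < r) (hr1 : r < 1) :
    ∃ t ∈ Ioo r 1, ∀ z ∈ sphere (0 : ℂ) 1, P.eval (t * z) ≠ 0 := by
  obtain ⟨t, ht, ht'⟩ := ((Ioo_infinite hr1).sdiff
    ((rootSet_finite P ℂ).image fun w => ‖w‖)).nonempty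
  refine ⟨t, ht, fun z hz h => ht' ⟨t * z, ?_, ?_⟩⟩
  · rw [mem_rootSet_of_ne hP]
    simpa using h
  · have hz1 : ‖z‖ = 1 := by simpa using hz
    simp only [norm_mul, norm_real, hz1, mul_one]
    exact Real.norm_of_nonneg (hr.trans ht.1).le

/-- The quantitative theorem on a single disc. -/
lemma exists_correctable {δ : ℝ} (hδ : 0 < δ) (hδ1 : δ ≤ 1) : ∃ A, 0 < A ∧
    ∀ f g : ℂ → ℂ, DifferentiableOn ℂ f (ball 0 1) → DifferentiableOn ℂ g (ball 0 1) →
      (∀ z ∈ ball (0 : ℂ) 1, ‖f z‖ ≤ 1) → (∀ z ∈ ball (0 : ℂ) 1, ‖g z‖ ≤ 1) →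
      (∀ z ∈ ball (0 : ℂ) 1, δ ≤ ‖f z‖ + ‖g z‖) → Correctable A f g := by
  obtain ⟨A, hA, hcorr⟩ := exists_correctable_polynomial (half_pos hδ) (by linarith)
  refine ⟨A, hA, fun f g hf hg hf1 hg1 hcor => ?_⟩
  set r : ℕ → ℝ := fun n => 1 - 1 / 2 * (1 / ((n : ℝ) + 1)) with hr
  set ε : ℕ → ℝ := fun n => δ / 8 * (1 / ((n : ℝ) + 1)) with hε
  have hn0 : ∀ n : ℕ, 0 < 1 / ((n : ℝ) + 1) := fun n => Nat.one_div_pos_of_nat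
  have hn1 : ∀ n : ℕ, 1 / ((n : ℝ) + 1) ≤ 1 := fun n =>
    div_le_one_of_le₀ (by linarith [n.cast_nonneg (α := ℝ)]) (by positivity)
  have hr0 : ∀ n, 0 < r n := fun n => by simp only [hr]; linarith [hn1 n]
  have hr1 : ∀ n, r n < 1 := fun n => by simp only [hr]; linarith [hn0 n]
  have hε0 : ∀ n, 0 < ε n := fun n => mul_pos (by positivity) (hn0 n)
  have hε8 : ∀ n, ε n ≤ δ / 8 := fun n => mul_le_of_le_one_right (by positivity) (hn1 n)
  have hrt : Tendsto r atTop (𝓝 1) := by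
    have := (tendsto_one_div_add_atTop_nhds_zero_nat (𝕜 := ℝ)).const_mul (1 / 2)
    simpa [hr] using this.const_sub 1
  have hεt : Tendsto ε atTop (𝓝 0) := by
    simpa [hε] using (tendsto_one_div_add_atTop_nhds_zero_nat (𝕜 := ℝ)).const_mul (δ / 8)
  choose P hP0 hP using fun n => exists_polynomial_ne_zero_near hf (hr0 n) (hr1 n) (hε0 n)
  choose Q hQ using fun n => exists_polynomial_near hg (hr0 n) (hr1 n) (hε0 n)
  choose t ht htP using fun n => exists_mem_Ioo_forall_eval_ne_zero (hP0 n) (hr0 n) (hr1 n)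
  have htt : Tendsto t atTop (𝓝 1) :=
    tendsto_of_tendsto_of_tendsto_of_le_of_le hrt tendsto_const_nhds (fun n => (ht n).1.le)
      fun n => (ht n).2.le
  have ht0 : ∀ n, 0 < t n := fun n => (hr0 n).trans (ht n).1
  have htz : ∀ n, ∀ z ∈ closedBall (0 : ℂ) 1, (t n : ℂ) * z ∈ closedBall (0 : ℂ) 1 :=
    fun n z hz => by
      rw [mem_closedBall_zero_iff, norm_mul, norm_real, Real.norm_of_nonneg (ht0 n).le]
      exact mul_le_one₀ (ht n).2.le (norm_nonneg _) (by simpa using hz)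
  have hrz : ∀ n, ∀ z ∈ closedBall (0 : ℂ) 1, (r n : ℂ) * z ∈ ball (0 : ℂ) 1 := fun n z hz => by
    rw [mem_ball_zero_iff, norm_mul, norm_real, Real.norm_of_nonneg (hr0 n).le]
    exact mul_lt_one_of_nonneg_of_lt_one_left (hr0 n).le (hr1 n) (by simpa using hz)
  have hev : ∀ (S : ℂ[X]) n z, (C ((1 - ε n : ℝ) : ℂ) * S.comp (C (t n : ℂ) * X)).eval z
      = ((1 - ε n : ℝ) : ℂ) * S.eval (t n * z) := fun S n z => by simp
  have hnorm : ∀ n (w : ℂ), ‖((1 - ε n : ℝ) : ℂ) * w‖ = (1 - ε n) * ‖w‖ := fun n w => by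
    rw [norm_mul, norm_real, Real.norm_of_nonneg (by linarith [hε8 n])]
  have hbound : ∀ (S : ℕ → ℂ[X]) (F : ℂ → ℂ), (∀ z ∈ ball (0 : ℂ) 1, ‖F z‖ ≤ 1) →
      (∀ n, ∀ z ∈ closedBall (0 : ℂ) 1, ‖(S n).eval z - F (r n * z)‖ < ε n) → ∀ n,
      ∀ z ∈ closedBall (0 : ℂ) 1,
        ‖(C ((1 - ε n : ℝ) : ℂ) * (S n).comp (C (t n : ℂ) * X)).eval z‖ ≤ 1 - ε n ^ 2 := by
    intro S F hF hS n z hz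
    rw [hev, hnorm]
    have h1 := norm_le_norm_add_norm_sub' ((S n).eval (t n * z)) (F (r n * (t n * z)))
    have h2 := hS n _ (htz n z hz)
    have h3 := hF _ (hrz n _ (htz n z hz))
    nlinarith [hε8 n]
  have hlim : ∀ (S : ℕ → ℂ[X]) (F : ℂ → ℂ), DifferentiableOn ℂ F (ball 0 1) →
      (∀ n, ∀ z ∈ closedBall (0 : ℂ) 1, ‖(S n).eval z - F (r n * z)‖ < ε n) →
      ∀ z ∈ ball (0 : ℂ) 1, Tendsto
        (fun n => (C ((1 - ε n : ℝ) : ℂ) * (S n).comp (C (t n : ℂ) * X)).eval z) atTop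
        (𝓝 (F z)) := by
    intro S F hF hS z hz
    have hc : ContinuousAt F z := (hF.differentiableAt (isOpen_ball.mem_nhds hz)).continuousAt
    have hrt' : Tendsto (fun n => (r n : ℂ) * (t n * z)) atTop (𝓝 z) := by
      have h1 := ((continuous_ofReal.tendsto 1).comp hrt).mul
        (((continuous_ofReal.tendsto 1).comp htt).mul_const z)
      simpa using h1
    have h1 : Tendsto (fun n => (S n).eval (t n * z) - F (r n * (t n * z))) atTop (𝓝 0) :=
      squeeze_zero_norm (fun n => (hS n _ (htz n z (ball_subset_closedBall hz))).le) hεt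
    have h2 := (h1.add (hc.tendsto.comp hrt'))
    have h3 := ((continuous_ofReal.tendsto (1 - 0)).comp (hεt.const_sub 1)).mul h2
    rw [sub_zero, ofReal_one, one_mul, zero_add] at h3
    refine h3.congr fun n => ?_
    rw [hev]
    simp
  refine Correctable.of_tendsto (Eventually.of_forall fun n => hcorr
    (C ((1 - ε n : ℝ) : ℂ) * (P n).comp (C (t n : ℂ) * X))
    (C ((1 - ε n : ℝ) : ℂ) * (Q n).comp (C (t n : ℂ) * X)) (1 - ε n ^ 2)
    (by nlinarith [hε0 n]) (fun z hz => ?_) (hbound Q g hg1 hQ n) (fun z hz => ?_)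
    fun z hz => ?_) (hlim P f hf hP) (hlim Q g hg hQ)
  · exact (hbound P f hf1 hP n z hz).trans (by nlinarith [hε0 n])
  · rw [hev]
    refine mul_ne_zero (ofReal_ne_zero.2 ?_) (htP n z hz)
    linarith [hε8 n]
  · rw [hev, hev, hnorm, hnorm]
    have h1 := norm_le_norm_add_norm_sub ((P n).eval (t n * z)) (f (r n * (t n * z)))
    have h2 := norm_le_norm_add_norm_sub ((Q n).eval (t n * z)) (g (r n * (t n * z)))
    have h3 := hP n _ (htz n z hz)
    have h4 := hQ n _ (htz n z hz)
    have h5 := hcor _ (hrz n _ (htz n z hz))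
    nlinarith [hε8 n]

end general

end

end Treil

/-- **Quantitative Treil-type theorem on `𝔻 × ℕ`.** For every `δ > 0` there is
`C > 0` (depending only on `δ`) such that for all `f, g ∈ H^∞(𝔻 × ℕ)` with
`‖f‖ ≤ 1`, `‖g‖ ≤ 1` and `|f(z,n)| + |g(z,n)| ≥ δ` everywhere, there exists
`G ∈ H^∞(𝔻 × ℕ)` with `‖G‖ ≤ C` and `|f(z,n) + g(z,n)·G(z,n)| ≥ 1/C`
everywhere; in particular `Φ = f + g·G` is invertible and `‖Φ⁻¹‖ ≤ C`. -/
theorem treil_Hinf_diskN :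
    ∀ δ : ℝ, 0 < δ →
      ∃ C : ℝ, 0 < C ∧
        ∀ f g : ℂ → ℕ → ℂ,
          MemHinfN f → MemHinfN g →
          (∀ z ∈ Metric.ball (0 : ℂ) 1, ∀ n : ℕ, ‖f z n‖ ≤ 1) →
          (∀ z ∈ Metric.ball (0 : ℂ) 1, ∀ n : ℕ, ‖g z n‖ ≤ 1) →
          (∀ z ∈ Metric.ball (0 : ℂ) 1, ∀ n : ℕ, δ ≤ ‖f z n‖ + ‖g z n‖) →
          ∃ G : ℂ → ℕ → ℂ, MemHinfN G ∧
            (∀ z ∈ Metric.ball (0 : ℂ) 1, ∀ n : ℕ, ‖G z n‖ ≤ C) ∧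
            (∀ z ∈ Metric.ball (0 : ℂ) 1, ∀ n : ℕ,
              1 / C ≤ ‖f z n + g z n * G z n‖) := by
  intro δ hδ
  obtain ⟨A, hA, h⟩ := Treil.exists_correctable (lt_min hδ one_pos) (min_le_right δ 1)
  refine ⟨A, hA, fun f g hf hg hf1 hg1 hcor => ?_⟩
  choose G hG hGA using fun n => h (fun z => f z n) (fun z => g z n) (hf.1 n) (hg.1 n)
    (fun z hz => hf1 z hz n) (fun z hz => hg1 z hz n)
    (fun z hz => (min_le_left _ _).trans (hcor z hz n))
  refine ⟨fun z n => G n z, ⟨hG, A, fun z hz n => (hGA n z hz).1⟩,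
    fun z hz n => (hGA n z hz).1, fun z hz n => ?_⟩
  rw [div_le_iff₀' hA]
  exact (hGA n z hz).2
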